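/- Let I(1) = ∫₀^∞∫₀^∞∫₀^∞ [ (1+x₁+x₂+x₃)(1+x₁⁻¹+x₂⁻¹+x₃⁻¹) − 1 ]⁻¹ (dx₁/x₁)(dx₂/x₂)(dx₃/x₃). Then I(1) = (12π/√15)·L(f,2), where f is the weight 3, level 15 cusp form f(τ) = η(3τ)³η(5τ)³ + η(τ)³η(15τ)³ and L(f,2) = 4π² ∫₀^∞ f(iy)·y dy. -/

import Mathlib

open MeasureTheory

/-- The Dedekind eta function `η(τ) = e^{πiτ/12} ∏_{n≥1} (1 - e^{2πinτ})`. -/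
noncomputable def dedekindEta (τ : ℂ) : ℂ :=
  Complex.exp (Real.pi * Complex.I * τ / 12) *
    ∏' n : ℕ, (1 - Complex.exp (2 * Real.pi * Complex.I * ((n : ℂ) + 1) * τ))

/-- The three-banana Feynman integral `I(t)`. -/
noncomputable def feynmanI (t : ℝ) : ℝ :=
  ∫ x₁ in Set.Ioi (0 : ℝ), ∫ x₂ in Set.Ioi (0 : ℝ), ∫ x₃ in Set.Ioi (0 : ℝ),
    ((1 + x₁ + x₂ + x₃) * (1 + x₁⁻¹ + x₂⁻¹ + x₃⁻¹) - t)⁻¹ / (x₁ * x₂ * x₃)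

/-- The weight 3, level 15 cusp form `f(τ) = η(3τ)³η(5τ)³ + η(τ)³η(15τ)³`. -/
noncomputable def cuspFormF (τ : ℂ) : ℂ :=
  dedekindEta (3 * τ) ^ 3 * dedekindEta (5 * τ) ^ 3 +
    dedekindEta τ ^ 3 * dedekindEta (15 * τ) ^ 3

/-- The critical L-value `L(f,2) = 4π² ∫₀^∞ f(iy) y dy`. -/
noncomputable def Lf2 : ℂ :=
  4 * (Real.pi : ℂ) ^ 2 * ∫ y in Set.Ioi (0 : ℝ), cuspFormF (Complex.I * y) * y

namespace Broadhurst

open Real MeasureTheory Filter Topology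

/-! ### Theta constants on the imaginary axis -/

noncomputable def gauss (y : ℝ) (n : ℝ) : ℝ := exp (-π * y * n ^ 2)

noncomputable def t3 (y : ℝ) : ℝ := ∑' n : ℤ, gauss y n
noncomputable def t2 (y : ℝ) : ℝ := ∑' n : ℤ, gauss y (n + 1 / 2)
noncomputable def t4 (y : ℝ) : ℝ := ∑' n : ℤ, (if Even n then 1 else -1) * gauss y n

lemma gauss_pos (y n : ℝ) : 0 < gauss y n := exp_pos _

lemma summable_pow_mul_gauss_add {y : ℝ} (hy : 0 < y) (k : ℕ) :
    Summable fun n : ℤ ↦ (|n| : ℝ) ^ k * gauss y n := by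
  have := summable_pow_mul_jacobiTheta₂_term_bound 0 hy k
  refine this.congr fun n ↦ ?_
  simp only [gauss]
  congr 1
  · push_cast; rfl
  · congr 1; ring

lemma summable_gauss {y : ℝ} (hy : 0 < y) : Summable fun n : ℤ ↦ gauss y n := by
  simpa using summable_pow_mul_gauss_add hy 0

lemma summable_gauss_half {y : ℝ} (hy : 0 < y) :
    Summable fun n : ℤ ↦ gauss y (n + 1 / 2) := by
  have h := (summable_gauss (y := y / 4) (by positivity)).comp_injective
    (i := fun n : ℤ ↦ 2 * n + 1) (fun a b h ↦ by simpa using h)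
  refine h.congr fun n ↦ ?_
  simp only [gauss, Function.comp]
  congr 1; push_cast; ring

lemma summable_sign_gauss {y : ℝ} (hy : 0 < y) :
    Summable fun n : ℤ ↦ (if Even n then 1 else -1 : ℝ) * gauss y n := by
  refine Summable.of_norm ((summable_gauss hy).congr fun n ↦ ?_)
  rw [norm_mul, Real.norm_of_nonneg (gauss_pos y n).le]
  split_ifs <;> simp

lemma t3_pos {y : ℝ} (hy : 0 < y) : 0 < t3 y :=
  (summable_gauss hy).tsum_pos (fun _ ↦ (gauss_pos _ _).le) 0 (gauss_pos _ _)

lemma t2_pos {y : ℝ} (hy : 0 < y) : 0 < t2 y :=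
  (summable_gauss_half hy).tsum_pos (fun _ ↦ (gauss_pos _ _).le) 0 (gauss_pos _ _)

noncomputable def latSum (w : ℤ × ℤ → ℝ) (y z : ℝ) : ℝ :=
  ∑' p : ℤ × ℤ, w p * (gauss y p.1 * gauss z p.2)

lemma summable_gauss_prod {y z : ℝ} (hy : 0 < y) (hz : 0 < z) :
    Summable fun p : ℤ × ℤ ↦ gauss y p.1 * gauss z p.2 :=
  (summable_gauss hy).mul_of_nonneg (summable_gauss hz) (fun _ ↦ (gauss_pos _ _).le)
    (fun _ ↦ (gauss_pos _ _).le)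

lemma summable_latSum {w : ℤ × ℤ → ℝ} (hw : ∀ p, |w p| ≤ 1) {y z : ℝ} (hy : 0 < y) (hz : 0 < z) :
    Summable fun p : ℤ × ℤ ↦ w p * (gauss y p.1 * gauss z p.2) := by
  refine Summable.of_norm_bounded (summable_gauss_prod hy hz) fun p ↦ ?_
  have h := mul_pos (gauss_pos y p.1) (gauss_pos z p.2)
  rw [norm_mul, Real.norm_of_nonneg h.le, Real.norm_eq_abs]
  exact mul_le_of_le_one_left h.le (hw p)

lemma t3_mul_t3 {y z : ℝ} (hy : 0 < y) (hz : 0 < z) :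
    t3 y * t3 z = latSum (fun _ ↦ 1) y z := by
  simp only [t3, latSum, one_mul]
  exact tsum_mul_tsum_of_summable_norm (summable_gauss hy).norm (summable_gauss hz).norm

lemma t4_mul_t4 {y z : ℝ} (hy : 0 < y) (hz : 0 < z) :
    t4 y * t4 z = latSum (fun p ↦ if Even (p.1 + p.2) then 1 else -1) y z := by
  simp only [t4, latSum]
  rw [tsum_mul_tsum_of_summable_norm (summable_sign_gauss hy).norm (summable_sign_gauss hz).norm]
  refine tsum_congr fun p ↦ ?_
  by_cases h1 : Even p.1 <;> by_cases h2 : Even p.2 <;> simp [h1, h2, Int.even_add]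

lemma latSum_reindex {φ : ℤ × ℤ → ℤ × ℤ} (hφ : Function.Injective φ) {w v : ℤ × ℤ → ℝ}
    {y z y' z' : ℝ} (hr : ∀ p, w p ≠ 0 → ∃ q, φ q = p) (hv : ∀ q, w (φ q) = v q)
    (hQ : ∀ q, v q ≠ 0 → y * (φ q).1 ^ 2 + z * (φ q).2 ^ 2 = y' * q.1 ^ 2 + z' * q.2 ^ 2) :
    latSum w y z = latSum v y' z' := by
  unfold latSum
  rw [← hφ.tsum_eq]
  · refine tsum_congr fun q ↦ ?_
    rw [hv]
    by_cases h0 : v q = 0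
    · simp [h0]
    congr 1
    simp only [gauss, ← Real.exp_add]
    congr 1
    linear_combination (-π) * hQ q h0
  · intro p hp
    simp only [Function.mem_support] at hp
    obtain ⟨q, hq⟩ := hr p (left_ne_zero_of_mul hp)
    exact ⟨q, hq⟩

lemma latSum_add {w v : ℤ × ℤ → ℝ} (hw : ∀ p, |w p| ≤ 1) (hv : ∀ p, |v p| ≤ 1) {y z : ℝ}
    (hy : 0 < y) (hz : 0 < z) :
    latSum w y z + latSum v y z = latSum (fun p ↦ w p + v p) y z := by
  unfold latSum
  rw [← (summable_latSum hw hy hz).tsum_add (summable_latSum hv hy hz)]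
  simp only [add_mul]

/-- Indicator of a predicate, as a weight. -/
def ind (P : Prop) [Decidable P] : ℝ := if P then 1 else 0

lemma abs_ind_le (P : Prop) [Decidable P] : |ind P| ≤ 1 := by
  unfold ind; split_ifs <;> simp

lemma ind_ne_zero {P : Prop} [Decidable P] : ind P ≠ 0 ↔ P := by
  unfold ind; split_ifs with h <;> simp [h]

lemma ind_congr {P Q : Prop} [Decidable P] [Decidable Q] (h : P ↔ Q) : ind P = ind Q := by
  unfold ind; simp [h]

lemma t3_sub_t4 {y z : ℝ} (hy : 0 < y) (hz : 0 < z) :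
    t3 y * t3 z - t4 y * t4 z = 2 * latSum (fun p ↦ ind ((p.1 + p.2) % 2 = 1)) y z := by
  rw [t3_mul_t3 hy hz, t4_mul_t4 hy hz, latSum, latSum, ← Summable.tsum_sub, latSum, ← tsum_mul_left]
  · refine tsum_congr fun p ↦ ?_
    rcases Int.emod_two_eq_zero_or_one (p.1 + p.2) with h | h <;> simp [ind, h, Int.even_iff]; ring
  · exact summable_latSum (by simp) hy hz
  · exact summable_latSum (fun p ↦ by split_ifs <;> simp) hy hz

lemma t3_add_t4 {y z : ℝ} (hy : 0 < y) (hz : 0 < z) :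
    t3 y * t3 z + t4 y * t4 z = 2 * latSum (fun p ↦ ind ((p.1 + p.2) % 2 = 0)) y z := by
  rw [t3_mul_t3 hy hz, t4_mul_t4 hy hz, latSum, latSum, ← Summable.tsum_add, latSum, ← tsum_mul_left]
  · refine tsum_congr fun p ↦ ?_
    rcases Int.emod_two_eq_zero_or_one (p.1 + p.2) with h | h <;> simp [ind, h, Int.even_iff]; ring
  · exact summable_latSum (by simp) hy hz
  · exact summable_latSum (fun p ↦ by split_ifs <;> simp) hy hz

lemma t2_mul_t2 {y z : ℝ} (hy : 0 < y) (hz : 0 < z) :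
    t2 y * t2 z = latSum (fun p ↦ ind (p.1 % 2 = 1 ∧ p.2 % 2 = 1)) (y / 4) (z / 4) := by
  rw [t2, t2, tsum_mul_tsum_of_summable_norm (summable_gauss_half hy).norm
    (summable_gauss_half hz).norm, latSum]
  have hφ : Function.Injective fun p : ℤ × ℤ ↦ (2 * p.1 + 1, 2 * p.2 + 1) := by
    rintro ⟨a, b⟩ ⟨c, d⟩ h
    simpa using h
  symm
  rw [← hφ.tsum_eq]
  · refine tsum_congr fun p ↦ ?_
    have : ind ((2 * p.1 + 1) % 2 = 1 ∧ (2 * p.2 + 1) % 2 = 1) = 1 := if_pos (by omega)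
    rw [this, one_mul]
    simp only [gauss]
    congr 2 <;> push_cast <;> ring
  · rintro ⟨a, b⟩ hp
    have h := ind_ne_zero.1 (left_ne_zero_of_mul (Function.mem_support.1 hp))
    simp only at h
    exact ⟨(a / 2, b / 2), Prod.ext (by simp only; omega) (by simp only; omega)⟩

lemma t2_mul_t3 {y z : ℝ} (hy : 0 < y) (hz : 0 < z) :
    t2 y * t3 z = latSum (fun p ↦ ind (p.1 % 2 = 1 ∧ p.2 % 2 = 0)) (y / 4) (z / 4) := by
  rw [t2, t3, tsum_mul_tsum_of_summable_norm (summable_gauss_half hy).norm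
    (summable_gauss hz).norm, latSum]
  have hφ : Function.Injective fun p : ℤ × ℤ ↦ (2 * p.1 + 1, 2 * p.2) := by
    rintro ⟨a, b⟩ ⟨c, d⟩ h
    simpa using h
  symm
  rw [← hφ.tsum_eq]
  · refine tsum_congr fun p ↦ ?_
    have : ind ((2 * p.1 + 1) % 2 = 1 ∧ (2 * p.2) % 2 = 0) = 1 := if_pos (by omega)
    rw [this, one_mul]
    simp only [gauss]
    congr 2 <;> push_cast <;> ring
  · rintro ⟨a, b⟩ hp
    have h := ind_ne_zero.1 (left_ne_zero_of_mul (Function.mem_support.1 hp))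
    simp only at h
    exact ⟨(a / 2, b / 2), Prod.ext (by simp only; omega) (by simp only; omega)⟩

lemma injective_linear {a b c d : ℤ} (h : a * d - b * c ≠ 0) :
    Function.Injective fun p : ℤ × ℤ ↦ (a * p.1 + b * p.2, c * p.1 + d * p.2) := by
  rintro ⟨x, y⟩ ⟨x', y'⟩ he
  simp only [Prod.mk.injEq] at he
  obtain ⟨h1, h2⟩ := he
  have e1 : (a * d - b * c) * (x - x') = 0 := by linear_combination d * h1 - b * h2
  have e2 : (a * d - b * c) * (y - y') = 0 := by linear_combination a * h2 - c * h1
  have f1 := (mul_eq_zero.1 e1).resolve_left h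
  have f2 := (mul_eq_zero.1 e2).resolve_left h
  exact Prod.ext (by simp only; omega) (by simp only; omega)

/-- Splitting of an indicator weight into two disjoint halves of equal sum. -/
lemma latSum_double {P Q R : ℤ × ℤ → Prop} [DecidablePred P] [DecidablePred Q] [DecidablePred R]
    (h : ∀ p, ind (P p) = ind (Q p) + ind (R p)) {φ : ℤ × ℤ → ℤ × ℤ}
    (hφ : Function.Injective φ) (hs : Function.Surjective φ) (hQR : ∀ p, R (φ p) ↔ Q p) {y z : ℝ}
    (hy : 0 < y) (hz : 0 < z)
    (hE : ∀ q, y * (φ q).1 ^ 2 + z * (φ q).2 ^ 2 = y * q.1 ^ 2 + z * q.2 ^ 2) :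
    latSum (fun p ↦ ind (P p)) y z = 2 * latSum (fun p ↦ ind (Q p)) y z := by
  simp only [h]
  rw [← latSum_add (fun p ↦ abs_ind_le (Q p)) (fun p ↦ abs_ind_le (R p)) hy hz, two_mul]
  congr 1
  exact latSum_reindex hφ (fun p _ ↦ hs p) (fun q ↦ ind_congr (hQR q)) (fun q _ ↦ hE q)

lemma two_mul_t3_two_mul_sq {y : ℝ} (hy : 0 < y) :
    t3 y ^ 2 + t4 y ^ 2 = 2 * t3 (2 * y) ^ 2 := by
  simp only [sq]
  rw [t3_add_t4 hy hy, t3_mul_t3 (by positivity) (by positivity)]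
  congr 1
  refine latSum_reindex (injective_linear (a := 1) (b := 1) (c := 1) (d := -1) (by norm_num))
    ?_ ?_ ?_
  · rintro ⟨a, b⟩ h
    have h := ind_ne_zero.1 h
    simp only at h
    exact ⟨((a + b) / 2, (a - b) / 2), Prod.ext (by simp only; omega) (by simp only; omega)⟩
  · rintro ⟨a, b⟩
    exact if_pos (by simp only; omega)
  · rintro ⟨a, b⟩ -
    push_cast; ring

lemma two_mul_t2_two_mul_sq {y : ℝ} (hy : 0 < y) :
    t3 y ^ 2 - t4 y ^ 2 = 2 * t2 (2 * y) ^ 2 := by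
  simp only [sq]
  rw [t3_sub_t4 hy hy, t2_mul_t2 (by positivity) (by positivity)]
  congr 1
  symm
  refine latSum_reindex (injective_linear (a := 1) (b := 1) (c := 1) (d := -1) (by norm_num))
    ?_ ?_ ?_
  · rintro ⟨a, b⟩ h
    have h := ind_ne_zero.1 h
    simp only at h
    exact ⟨((a + b) / 2, (a - b) / 2), Prod.ext (by simp only; omega) (by simp only; omega)⟩
  · rintro ⟨a, b⟩
    exact ind_congr (by simp only; omega)
  · rintro ⟨a, b⟩ -
    push_cast; ring

lemma t2_sq {y : ℝ} (hy : 0 < y) : t2 y ^ 2 = 2 * (t2 (2 * y) * t3 (2 * y)) := by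
  rw [sq, t2_mul_t2 hy hy, t2_mul_t3 (by positivity) (by positivity),
    ← latSum_double (P := fun p ↦ (p.1 + p.2) % 2 = 1) (R := fun p ↦ p.1 % 2 = 0 ∧ p.2 % 2 = 1)
      (φ := Prod.swap) ?_ Prod.swap_injective Prod.swap_surjective ?_ (by positivity)
      (by positivity) ?_]
  · refine latSum_reindex (injective_linear (a := 1) (b := 1) (c := 1) (d := -1) (by norm_num))
      ?_ ?_ ?_
    · rintro ⟨a, b⟩ h
      have h := ind_ne_zero.1 h
      simp only at h
      exact ⟨((a + b) / 2, (a - b) / 2), Prod.ext (by simp only; omega) (by simp only; omega)⟩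
    · rintro ⟨a, b⟩
      exact ind_congr (by simp only; omega)
    · rintro ⟨a, b⟩ -
      push_cast; ring
  · rintro ⟨a, b⟩
    rcases Int.emod_two_eq_zero_or_one a with h | h <;>
      rcases Int.emod_two_eq_zero_or_one b with h' | h' <;> simp [ind, h, h', Int.add_emod]
  · rintro ⟨a, b⟩
    simp only [Prod.swap]; omega
  · rintro ⟨a, b⟩
    simp only [Prod.swap]; ring

lemma jacobi_quartic {y : ℝ} (hy : 0 < y) : t3 y ^ 4 = t2 y ^ 4 + t4 y ^ 4 := by
  have h1 := two_mul_t3_two_mul_sq hy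
  have h2 := two_mul_t2_two_mul_sq hy
  have h3 := t2_sq hy
  have : t3 y ^ 4 - t4 y ^ 4 = (2 * t3 (2 * y) ^ 2) * (2 * t2 (2 * y) ^ 2) := by
    rw [← h1, ← h2]; ring
  have h4 : t2 y ^ 4 = (t2 y ^ 2) ^ 2 := by ring
  rw [h4, h3]; linarith

lemma theta_degree_three {y : ℝ} (hy : 0 < y) :
    t3 y * t3 (3 * y) = t2 y * t2 (3 * y) + t4 y * t4 (3 * y) := by
  have h := t3_sub_t4 hy (z := 3 * y) (by positivity)
  rw [t2_mul_t2 hy (by positivity), latSum_double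
    (Q := fun p ↦ p.1 % 2 = 1 ∧ (p.1 - p.2) % 4 = 0)
    (R := fun p ↦ p.1 % 2 = 1 ∧ (p.1 + p.2) % 4 = 0)
    (φ := fun p ↦ (p.1, -p.2)) ?_ ?_ ?_ ?_ (by positivity) (by positivity) ?_]
  · rw [← sub_eq_iff_eq_add, h]
    congr 1
    symm
    refine latSum_reindex (injective_linear (a := 1) (b := 3) (c := 1) (d := -1) (by norm_num))
      ?_ ?_ ?_
    · rintro ⟨a, b⟩ h
      have h := ind_ne_zero.1 h
      simp only at h
      exact ⟨((a + 3 * b) / 4, (a - b) / 4), Prod.ext (by simp only; omega) (by simp only; omega)⟩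
    · rintro ⟨a, b⟩
      exact ind_congr (by simp only; omega)
    · rintro ⟨a, b⟩ -
      push_cast; ring
  · rintro ⟨a, b⟩
    have ha := Int.emod_two_eq_zero_or_one a
    simp only [ind]
    split_ifs <;> first | (exfalso; omega) | norm_num
  · rintro ⟨a, b⟩ ⟨c, d⟩ h; simpa using h
  · rintro ⟨a, b⟩; exact ⟨(a, -b), by simp⟩
  · rintro ⟨a, b⟩; simp only; omega
  · rintro ⟨a, b⟩; push_cast; ring

lemma theta_degree_fifteen {y : ℝ} (hy : 0 < y) :
    t3 y * t3 (15 * y) + t2 y * t2 (15 * y) - t4 y * t4 (15 * y)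
      = t2 (3 * y / 2) * t2 (5 * y / 2) := by
  have h := t3_sub_t4 hy (z := 15 * y) (by positivity)
  have flip_inj : Function.Injective fun p : ℤ × ℤ ↦ (p.1, -p.2) := by
    rintro ⟨a, b⟩ ⟨c, d⟩ h; simpa using h
  have flip_surj : Function.Surjective fun p : ℤ × ℤ ↦ (p.1, -p.2) := by
    rintro ⟨a, b⟩; exact ⟨(a, -b), by simp⟩
  have e1 : t2 y * t2 (15 * y) =
      2 * latSum (fun p ↦ ind (p.1 % 2 = 1 ∧ (p.1 - p.2) % 4 = 0)) (y / 4) (15 * y / 4) := by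
    rw [t2_mul_t2 hy (by positivity)]
    refine latSum_double (R := fun p ↦ p.1 % 2 = 1 ∧ (p.1 + p.2) % 4 = 0) ?_ flip_inj flip_surj
      ?_ (by positivity) (by positivity) ?_
    · rintro ⟨a, b⟩
      have ha := Int.emod_two_eq_zero_or_one a
      simp only [ind]
      split_ifs <;> first | (exfalso; omega) | norm_num
    · rintro ⟨a, b⟩; simp only; omega
    · rintro ⟨a, b⟩; push_cast; ring
  have e2 : t2 (3 * y / 2) * t2 (5 * y / 2) =
      2 * latSum (fun p ↦ ind (p.1 % 2 = 1 ∧ (p.1 - p.2) % 4 = 0)) (3 * y / 8) (5 * y / 8) := by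
    rw [t2_mul_t2 (by positivity) (by positivity), show 3 * y / 2 / 4 = 3 * y / 8 by ring,
      show 5 * y / 2 / 4 = 5 * y / 8 by ring]
    refine latSum_double (R := fun p ↦ p.1 % 2 = 1 ∧ (p.1 + p.2) % 4 = 0) ?_ flip_inj flip_surj
      ?_ (by positivity) (by positivity) ?_
    · rintro ⟨a, b⟩
      have ha := Int.emod_two_eq_zero_or_one a
      simp only [ind]
      split_ifs <;> first | (exfalso; omega) | norm_num
    · rintro ⟨a, b⟩; simp only; omega
    · rintro ⟨a, b⟩; push_cast; ring
  have e3 : latSum (fun p ↦ ind (p.1 % 2 = 1 ∧ (p.1 - p.2) % 4 = 0)) (3 * y / 8) (5 * y / 8)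
      = latSum (fun p ↦ ind (p.1 % 2 = 1 ∧ (p.1 - p.2) % 8 = 0)) (3 * y / 8) (5 * y / 8)
      + latSum (fun p ↦ ind (p.1 % 2 = 1 ∧ (p.1 - p.2) % 8 = 4)) (3 * y / 8) (5 * y / 8) := by
    rw [latSum_add (fun p ↦ abs_ind_le _) (fun p ↦ abs_ind_le _) (by positivity) (by positivity)]
    congr 1
    ext ⟨a, b⟩
    simp only [ind]
    split_ifs <;> first | (exfalso; omega) | norm_num
  have e4 : latSum (fun p ↦ ind (p.1 % 2 = 1 ∧ (p.1 - p.2) % 8 = 0)) (3 * y / 8) (5 * y / 8)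
      = latSum (fun p ↦ ind ((p.1 + p.2) % 2 = 1)) y (15 * y) := by
    refine latSum_reindex (injective_linear (a := 1) (b := 5) (c := 1) (d := -3) (by norm_num))
      ?_ ?_ ?_
    · rintro ⟨a, b⟩ h
      have h := ind_ne_zero.1 h
      simp only at h
      exact ⟨(b + 3 * ((a - b) / 8), (a - b) / 8),
        Prod.ext (by simp only; omega) (by simp only; omega)⟩
    · rintro ⟨a, b⟩
      exact ind_congr (by simp only; omega)
    · rintro ⟨a, b⟩ -
      push_cast; ring
  have e5 : latSum (fun p ↦ ind (p.1 % 2 = 1 ∧ (p.1 - p.2) % 8 = 4)) (3 * y / 8) (5 * y / 8)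
      = latSum (fun p ↦ ind (p.1 % 2 = 1 ∧ (p.1 - p.2) % 4 = 0)) (y / 4) (15 * y / 4) := by
    trans ∑' p : ℤ × ℤ, ind (p.1 % 2 = 1 ∧ p.2 % 2 = 1) *
        (gauss (3 * y / 8) (p.1 + 4 * p.2) * gauss (5 * y / 8) p.1)
    · unfold latSum
      rw [← (injective_linear (a := 1) (b := 4) (c := 1) (d := 0) (by norm_num)).tsum_eq]
      · refine tsum_congr fun ⟨a, b⟩ ↦ ?_
        refine congrArg₂ (· * ·) (ind_congr (by simp only; omega)) ?_
        push_cast; simp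
      · rintro ⟨a, b⟩ h
        have h := ind_ne_zero.1 (left_ne_zero_of_mul (Function.mem_support.1 h))
        simp only at h
        exact ⟨(b, (a - b) / 4), Prod.ext (by simp only; omega) (by simp only; omega)⟩
    · unfold latSum
      symm
      rw [← (injective_linear (a := 2) (b := 3) (c := 0) (d := 1) (by norm_num)).tsum_eq]
      · refine tsum_congr fun ⟨a, b⟩ ↦ ?_
        refine congrArg₂ (· * ·) (ind_congr (by simp only; omega)) ?_
        simp only [gauss, ← Real.exp_add]
        congr 1
        push_cast; ring
      · rintro ⟨a, b⟩ h
        have h := ind_ne_zero.1 (left_ne_zero_of_mul (Function.mem_support.1 h))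
        simp only at h
        exact ⟨((a - 3 * b) / 2, b), Prod.ext (by simp only; omega) (by simp only; omega)⟩
  rw [e2, e3, e4, e5, e1]
  linarith

lemma theta_degree_three_five {y : ℝ} (hy : 0 < y) :
    t3 (3 * y) * t3 (5 * y) + t2 (3 * y) * t2 (5 * y) - t4 (3 * y) * t4 (5 * y)
      = t2 (y / 2) * t2 (15 * y / 2) := by
  have h := t3_sub_t4 (y := 3 * y) (z := 5 * y) (by positivity) (by positivity)
  have flip_inj : Function.Injective fun p : ℤ × ℤ ↦ (p.1, -p.2) := by
    rintro ⟨a, b⟩ ⟨c, d⟩ h; simpa using h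
  have flip_surj : Function.Surjective fun p : ℤ × ℤ ↦ (p.1, -p.2) := by
    rintro ⟨a, b⟩; exact ⟨(a, -b), by simp⟩
  have e1 : t2 (3 * y) * t2 (5 * y) =
      2 * latSum (fun p ↦ ind (p.1 % 2 = 1 ∧ (p.1 + p.2) % 4 = 0)) (3 * y / 4) (5 * y / 4) := by
    rw [t2_mul_t2 (by positivity) (by positivity)]
    refine latSum_double (R := fun p ↦ p.1 % 2 = 1 ∧ (p.1 - p.2) % 4 = 0) ?_ flip_inj flip_surj
      ?_ (by positivity) (by positivity) ?_
    · rintro ⟨a, b⟩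
      have ha := Int.emod_two_eq_zero_or_one a
      simp only [ind]
      split_ifs <;> first | (exfalso; omega) | norm_num
    · rintro ⟨a, b⟩; simp only; omega
    · rintro ⟨a, b⟩; push_cast; ring
  have e2 : t2 (y / 2) * t2 (15 * y / 2) =
      2 * latSum (fun p ↦ ind (p.1 % 2 = 1 ∧ (p.1 + p.2) % 4 = 0)) (y / 8) (15 * y / 8) := by
    rw [t2_mul_t2 (by positivity) (by positivity), show y / 2 / 4 = y / 8 by ring,
      show 15 * y / 2 / 4 = 15 * y / 8 by ring]
    refine latSum_double (R := fun p ↦ p.1 % 2 = 1 ∧ (p.1 - p.2) % 4 = 0) ?_ flip_inj flip_surj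
      ?_ (by positivity) (by positivity) ?_
    · rintro ⟨a, b⟩
      have ha := Int.emod_two_eq_zero_or_one a
      simp only [ind]
      split_ifs <;> first | (exfalso; omega) | norm_num
    · rintro ⟨a, b⟩; simp only; omega
    · rintro ⟨a, b⟩; push_cast; ring
  have e3 : latSum (fun p ↦ ind (p.1 % 2 = 1 ∧ (p.1 + p.2) % 4 = 0)) (y / 8) (15 * y / 8)
      = latSum (fun p ↦ ind (p.1 % 2 = 1 ∧ (p.1 - 3 * p.2) % 8 = 0)) (y / 8) (15 * y / 8)
      + latSum (fun p ↦ ind (p.1 % 2 = 1 ∧ (p.1 - 3 * p.2) % 8 = 4)) (y / 8) (15 * y / 8) := by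
    rw [latSum_add (fun p ↦ abs_ind_le _) (fun p ↦ abs_ind_le _) (by positivity) (by positivity)]
    congr 1
    ext ⟨a, b⟩
    simp only [ind]
    split_ifs <;> first | (exfalso; omega) | norm_num
  have e4 : latSum (fun p ↦ ind (p.1 % 2 = 1 ∧ (p.1 - 3 * p.2) % 8 = 0)) (y / 8) (15 * y / 8)
      = latSum (fun p ↦ ind ((p.1 + p.2) % 2 = 1)) (3 * y) (5 * y) := by
    refine latSum_reindex (injective_linear (a := 3) (b := 5) (c := 1) (d := -1) (by norm_num))
      ?_ ?_ ?_
    · rintro ⟨a, b⟩ h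
      have h := ind_ne_zero.1 h
      simp only at h
      exact ⟨(b + (a - 3 * b) / 8, (a - 3 * b) / 8),
        Prod.ext (by simp only; omega) (by simp only; omega)⟩
    · rintro ⟨a, b⟩
      exact ind_congr (by simp only; omega)
    · rintro ⟨a, b⟩ -
      push_cast; ring
  have e5 : latSum (fun p ↦ ind (p.1 % 2 = 1 ∧ (p.1 - 3 * p.2) % 8 = 4)) (y / 8) (15 * y / 8)
      = latSum (fun p ↦ ind (p.1 % 2 = 1 ∧ (p.1 + p.2) % 4 = 0)) (3 * y / 4) (5 * y / 4) := by
    trans ∑' p : ℤ × ℤ, ind (p.1 % 2 = 1 ∧ p.2 % 2 = 1) *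
        (gauss (y / 8) (3 * p.1 + 4 * p.2) * gauss (15 * y / 8) p.1)
    · unfold latSum
      rw [← (injective_linear (a := 3) (b := 4) (c := 1) (d := 0) (by norm_num)).tsum_eq]
      · refine tsum_congr fun ⟨a, b⟩ ↦ ?_
        refine congrArg₂ (· * ·) (ind_congr (by simp only; omega)) ?_
        push_cast; simp
      · rintro ⟨a, b⟩ h
        have h := ind_ne_zero.1 (left_ne_zero_of_mul (Function.mem_support.1 h))
        simp only at h
        exact ⟨(b, (a - 3 * b) / 4), Prod.ext (by simp only; omega) (by simp only; omega)⟩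
    · unfold latSum
      symm
      rw [← (injective_linear (a := 2) (b := 1) (c := 0) (d := 1) (by norm_num)).tsum_eq]
      · refine tsum_congr fun ⟨a, b⟩ ↦ ?_
        refine congrArg₂ (· * ·) (ind_congr (by simp only; omega)) ?_
        simp only [gauss, ← Real.exp_add]
        congr 1
        push_cast; ring
      · rintro ⟨a, b⟩ h
        have h := ind_ne_zero.1 (left_ne_zero_of_mul (Function.mem_support.1 h))
        simp only at h
        exact ⟨((a - b) / 2, b), Prod.ext (by simp only; omega) (by simp only; omega)⟩
  rw [e2, e3, e4, e5, e1]
  linarith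

lemma t3_inv {y : ℝ} (hy : 0 < y) : t3 (1 / y) = √y * t3 y := by
  have h := Real.tsum_exp_neg_mul_int_sq (a := 1 / y) (by positivity)
  simp only [t3, gauss]
  rw [h]
  congr 1
  · rw [one_div, one_div, Real.inv_rpow hy.le, inv_inv, Real.sqrt_eq_rpow, one_div]
  · refine tsum_congr fun n ↦ ?_
    congr 2; simp

lemma hasSum_int_even_add_odd {f : ℤ → ℝ} {a b : ℝ} (h1 : HasSum (fun n ↦ f (2 * n)) a)
    (h2 : HasSum (fun n ↦ f (2 * n + 1)) b) : HasSum f (a + b) := by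
  have i1 : Function.Injective fun n : ℤ ↦ 2 * n := fun a b h ↦ by simpa using h
  have i2 : Function.Injective fun n : ℤ ↦ 2 * n + 1 := fun a b h ↦ by simpa using h
  refine HasSum.add_isCompl (s := Set.range fun n : ℤ ↦ 2 * n)
    (t := Set.range fun n : ℤ ↦ 2 * n + 1) ?_ (i1.hasSum_range_iff.2 h1) (i2.hasSum_range_iff.2 h2)
  simpa [Function.comp_def] using Int.isCompl_even_odd

lemma t3_split {y : ℝ} (hy : 0 < y) : t3 (y / 4) = t3 y + t2 y := by
  have h1 : HasSum (fun n : ℤ ↦ gauss (y / 4) ((2 * n : ℤ) : ℝ)) (t3 y) := by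
    rw [t3]
    convert (summable_gauss hy).hasSum using 2 with n
    simp only [gauss]; congr 1; push_cast; ring
  have h2 : HasSum (fun n : ℤ ↦ gauss (y / 4) ((2 * n + 1 : ℤ) : ℝ)) (t2 y) := by
    rw [t2]
    convert (summable_gauss_half hy).hasSum using 2 with n
    simp only [gauss]; congr 1; push_cast; ring
  exact (hasSum_int_even_add_odd (f := fun n : ℤ ↦ gauss (y / 4) n) h1 h2).tsum_eq

lemma t3_split_sign {y : ℝ} (hy : 0 < y) : t3 y + t4 y = 2 * t3 (4 * y) := by
  unfold t3 t4
  rw [← (summable_gauss hy).tsum_add (summable_sign_gauss hy), ← tsum_mul_left,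
    ← (mul_right_injective₀ (two_ne_zero' ℤ)).tsum_eq]
  · refine tsum_congr fun n ↦ ?_
    simp only [gauss, even_two, Even.mul_right, if_true]
    push_cast
    rw [show -π * y * (2 * n : ℝ) ^ 2 = -π * (4 * y) * n ^ 2 by ring]; ring
  · intro n hn
    simp only [Function.mem_support] at hn
    by_cases h : Even n
    · obtain ⟨m, hm⟩ := h
      exact ⟨m, by simp only; omega⟩
    · simp [h] at hn

lemma t2_inv {y : ℝ} (hy : 0 < y) : t2 (1 / y) = √y * t4 y := by
  have h1 := t3_split (y := 1 / y) (by positivity)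
  have h2 := t3_split_sign hy
  have h3 := t3_inv (y := 4 * y) (by positivity)
  rw [t3_inv hy, show 1 / y / 4 = 1 / (4 * y) by field_simp, h3, Real.sqrt_mul (by norm_num),
    show √4 = 2 by rw [show (4:ℝ) = 2 ^ 2 by norm_num]; simp] at h1
  linear_combination -h1 - √y * h2

lemma t4_inv {y : ℝ} (hy : 0 < y) : t4 (1 / y) = √y * t2 y := by
  have h1 := t2_inv (y := 1 / y) (by positivity)
  rw [one_div_one_div] at h1
  rw [h1, ← mul_assoc, ← Real.sqrt_mul hy.le, mul_one_div_cancel hy.ne']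
  simp

lemma t4_pos {y : ℝ} (hy : 0 < y) : 0 < t4 y := by
  have h := t4_inv (y := 1 / y) (by positivity)
  rw [one_div_one_div] at h
  rw [h]
  have := t2_pos (y := 1 / y) (by positivity)
  positivity

lemma t4_two_mul_sq {y : ℝ} (hy : 0 < y) : t4 (2 * y) ^ 2 = t3 y * t4 y := by
  have h1 := two_mul_t3_two_mul_sq hy
  have h2 := two_mul_t2_two_mul_sq hy
  have h3 := jacobi_quartic (y := 2 * y) (by positivity)
  have h : (t4 (2 * y) ^ 2) ^ 2 = (t3 y * t4 y) ^ 2 := by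
    linear_combination -h3 + (-(t3 y ^ 2 + t4 y ^ 2 + 2 * t3 (2 * y) ^ 2) / 4) * h1 + ((t3 y ^ 2 - t4 y ^ 2) + 2 * t2 (2 * y) ^ 2) / 4 * h2
  have h5 := t3_pos hy
  have h6 := t4_pos hy
  rwa [sq_eq_sq₀ (by positivity) (by positivity)] at h

lemma one_le_t3 {y : ℝ} (hy : 0 < y) : 1 ≤ t3 y := by
  have := (summable_gauss hy).le_tsum 0 fun _ _ ↦ (gauss_pos _ _).le
  simpa [gauss, t3] using this

lemma two_sub_t3_le_t4 {y : ℝ} (hy : 0 < y) : 2 - t3 y ≤ t4 y := by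
  have h1 := t3_split_sign hy
  have h2 := one_le_t3 (y := 4 * y) (by positivity)
  linarith

lemma t3_le {y : ℝ} (hy : 0 < y) : t3 y ≤ 1 + 2 / (1 - exp (-π * y)) * exp (-π * y) := by
  have h := norm_jacobiTheta_sub_one_le (τ := Complex.I * y) (by simpa using hy)
  have e : jacobiTheta (Complex.I * y) = (t3 y : ℂ) := by
    rw [jacobiTheta, t3, Complex.ofReal_tsum]
    refine tsum_congr fun n ↦ ?_
    simp only [gauss]
    push_cast
    congr 1
    linear_combination (π * n ^ 2 * y : ℂ) * Complex.I_sq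
  rw [e, ← Complex.ofReal_one, ← Complex.ofReal_sub, Complex.norm_real] at h
  have h' := (le_abs_self _).trans h
  simp at h'
  simp
  linarith

lemma t3_lt {y : ℝ} (hy : 1.2 < y) : t3 y < 1.07 := by
  have h := t3_le (y := y) (by linarith)
  have h1 : exp (-π * y) < 1 / 31 := by
    have h3 : exp (-π * y) < exp (-3.6) := by
      apply exp_lt_exp.2; nlinarith [pi_gt_d2]
    have h4 : exp (-3.6) = exp (-1) ^ 3 * exp (-0.6) := by
      rw [← exp_nat_mul, ← exp_add]; norm_num
    have h5 : exp (-1) < 0.3678794412 := exp_neg_one_lt_d9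
    have h6 : exp (-0.6) < 0.626 := by
      rw [exp_neg, inv_lt_comm₀ (exp_pos _) (by norm_num)]
      have := add_one_lt_exp (x := 0.6) (by norm_num)
      refine lt_of_lt_of_le ?_ this.le
      norm_num
    have h7 : exp (-1) ^ 3 < 0.3678794412 ^ 3 := by gcongr
    have h8 : exp (-1) ^ 3 * exp (-0.6) < 0.3678794412 ^ 3 * 0.626 := by gcongr
    rw [h4] at h3
    refine h3.trans (h8.trans ?_)
    norm_num
  have hp := exp_pos (-π * y)
  have : 2 / (1 - exp (-π * y)) * exp (-π * y) < 0.07 := by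
    rw [div_mul_eq_mul_div, div_lt_iff₀ (by linarith)]; linarith
  linarith

/-- Algebraic elimination: the singular moduli determined by the degree `15` relations. -/
lemma moduli_algebra {M a a' b b' : ℝ} (ha : 0 < a) (ha' : 0 < a') (hb : 0 < b) (hb' : 0 < b')
    (hM : 0 < M) (hM1 : M ^ 2 < 3) (hja : a ^ 4 + a' ^ 4 = 1) (hjb : b ^ 4 + b' ^ 4 = 1)
    (h1 : 4 * M ^ 2 * (a * a') = 3) (h2 : M ^ 2 = 12 * (b * b')) (h3 : a * b + a' * b' = 1)
    (hlt : a < a') (hlt' : b < b') :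
    a ^ 4 = (1 - (7 * √3 - √15) / 16) / 2 ∧ b ^ 4 = (1 - (7 * √3 + √15) / 16) / 2 ∧
    8 * ((a * a') ^ 2 * M + 3 * (b * b') ^ 2 / M) = √15 := by
  have s3 : √3 ^ 2 = 3 := by simp
  have s5 : √5 ^ 2 = 5 := by simp
  have s15 : √15 = √3 * √5 := by rw [← Real.sqrt_mul (by norm_num)]; norm_num
  have p3 : 0 < √3 := by positivity
  have p5 : 0 < √5 := by positivity
  have hpq : (a * b) * (a' * b') = 1 / 16 := by
    have : M ^ 2 * ((a * b) * (a' * b') - 1 / 16) = 0 := by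
      linear_combination (b * b') / 4 * h1 - h2 / 16
    have := (mul_eq_zero.1 this).resolve_left (by positivity)
    linarith
  have hltpq : a * b < a' * b' := by gcongr
  have hp : a * b = (2 - √3) / 4 := by
    have : (a * b - (2 - √3) / 4) * (a * b - (2 + √3) / 4) = 0 := by
      linear_combination (a * b) * h3 - hpq - s3 / 16
    rcases mul_eq_zero.1 this with h | h
    · linarith
    · nlinarith
  have hq : a' * b' = (2 + √3) / 4 := by linarith
  -- sum and product of the fourth powers
  have hprod : a ^ 4 * b ^ 4 = (97 - 56 * √3) / 256 := by
    rw [← mul_pow, hp]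
    linear_combination (√3 ^ 2 + 27 - 8 * √3) / 256 * s3
  have hprod' : a' ^ 4 * b' ^ 4 = (97 + 56 * √3) / 256 := by
    rw [← mul_pow, hq]
    linear_combination (√3 ^ 2 + 27 + 8 * √3) / 256 * s3
  have hsum : a ^ 4 + b ^ 4 = 1 - 7 * √3 / 16 := by
    linear_combination hprod - hprod' + a' ^ 4 * hjb - (b ^ 4 - 1) * hja
  set s := a * a' with hs
  set r := b * b' with hr
  have hs0 : 0 < s := by positivity
  have hr0 : 0 < r := by positivity
  have hsr : s * r = 1 / 16 := by rw [hs, hr, ← hpq]; ring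
  have hs4 : 1 / 4 < s := by nlinarith
  have hrs : r < s := by nlinarith
  have hba : b ^ 4 < a ^ 4 := by
    have hr4 : r ^ 4 < s ^ 4 := by gcongr
    have e1 : s ^ 4 = a ^ 4 * (1 - a ^ 4) := by rw [hs]; linear_combination a ^ 4 * hja
    have e2 : r ^ 4 = b ^ 4 * (1 - b ^ 4) := by rw [hr]; linear_combination b ^ 4 * hjb
    have f1 : a ^ 4 < a' ^ 4 := by gcongr
    have f2 : b ^ 4 < b' ^ 4 := by gcongr
    rw [e1, e2] at hr4
    by_contra! hcon
    nlinarith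
  have hdisc : (a ^ 4 - b ^ 4 - √15 / 16) * (a ^ 4 - b ^ 4 + √15 / 16) = 0 := by
    have : √15 ^ 2 = 15 := by simp
    linear_combination (a ^ 4 + b ^ 4 + 1 - 7 * √3 / 16) * hsum - 4 * hprod - this / 256
      + 49 / 256 * s3
  have hdiff : a ^ 4 - b ^ 4 = √15 / 16 := by
    have : 0 < √15 := by positivity
    rcases mul_eq_zero.1 hdisc with h | h <;> linarith
  refine ⟨by linarith, by linarith, ?_⟩
  have hs4' : s ^ 4 = ((3 + √5) / 8) ^ 4 := by
    have : a ^ 4 = (1 - (7 * √3 - √15) / 16) / 2 := by linarith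
    have e1 : s ^ 4 = a ^ 4 * (1 - a ^ 4) := by rw [hs]; linear_combination a ^ 4 * hja
    rw [e1, this, s15]
    linear_combination (-(49 - 14 * √5 + √5 ^ 2) / 1024) * s3
      - (3 / 1024 + (√5 ^ 2 + 12 * √5 + 59) / 4096) * s5
  have hsv : s = (3 + √5) / 8 := by
    rwa [pow_left_inj₀ hs0.le (by positivity) (by norm_num)] at hs4'
  have hrv : r = (3 - √5) / 8 := by
    have : s * (r - (3 - √5) / 8) = 0 := by
      rw [mul_sub, hsr, hsv]; linear_combination s5 / 64
    have := (mul_eq_zero.1 this).resolve_left hs0.ne'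
    linarith
  have hM2 : M ^ 2 = 3 * (3 - √5) / 2 := by rw [h2, hrv]; ring
  have hsq : (8 * (s ^ 2 * M + 3 * r ^ 2 / M)) ^ 2 = 15 := by
    have : (8 * (s ^ 2 * M + 3 * r ^ 2 / M)) ^ 2
        = 64 * (s ^ 4 * M ^ 2 + 6 * (s * r) ^ 2 + 9 * r ^ 4 / M ^ 2) := by
      field_simp; ring
    rw [this, hsr]
    have h12 : 9 * r ^ 4 / M ^ 2 = 3 / 4 * r ^ 3 := by
      rw [h2]; field_simp; ring
    rw [h12, hsv, hrv, hM2]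
    have h53 : √5 ^ 3 = 5 * √5 := by rw [pow_succ, s5]
    have h54 : √5 ^ 4 = 25 := by rw [show √5 ^ 4 = (√5 ^ 2) ^ 2 by ring, s5]; norm_num
    have h55 : √5 ^ 5 = 25 * √5 := by rw [pow_succ, h54]
    ring_nf
    rw [h53, h54, h55, s5]; ring
  symm
  rw [Real.sqrt_eq_iff_mul_self_eq (by norm_num) (by positivity)]
  rw [← sq, hsq]

lemma t2_lt_t4 {y : ℝ} (hy : 1.2 < y) : t2 y < t4 y := by
  have h0 : 0 < y := by linarith
  have h1 := t3_lt hy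
  have h2 := two_sub_t3_le_t4 h0
  have h3 := jacobi_quartic h0
  have h5 := t3_pos h0
  have h6 : 0.93 < t4 y := by linarith
  have h7 : (0.93 : ℝ) ^ 4 < t4 y ^ 4 := by gcongr
  have h8 : t3 y ^ 4 < 1.07 ^ 4 := by gcongr
  refine lt_of_pow_lt_pow_left₀ 4 (t4_pos h0).le ?_
  linarith

lemma t2_half_sq {y : ℝ} (hy : 0 < y) : t2 (y / 2) ^ 2 = 2 * (t2 y * t3 y) := by
  have := t2_sq (y := y / 2) (by positivity)
  rwa [show 2 * (y / 2) = y by ring] at this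

lemma t2_inv_two_mul_sq {y : ℝ} (hy : 0 < y) :
    t2 (1 / (2 * y)) ^ 2 = 2 * y * (t3 y * t4 y) := by
  rw [t2_inv (by positivity), mul_pow, Real.sq_sqrt (by positivity), t4_two_mul_sq hy]

lemma theta_level_fifteen_first {α β : ℝ} (hα : 0 < α) (h : α * β = 5) (hβ : β = 3 * α) :
    4 * t3 α ^ 2 * (t2 α * t4 α) = 3 * t3 β ^ 4 := by
  have hβ0 : 0 < β := by linarith
  have hI := theta_degree_fifteen (y := 1 / β) (by positivity)
  have hα2 : α ^ 2 = 5 / 3 := by rw [hβ] at h; linarith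
  have e1 : 15 * (1 / β) = β := by rw [hβ]; field_simp; linarith
  have e2 : 3 * (1 / β) / 2 = 1 / (2 * α) := by rw [hβ]; field_simp
  have e3 : 5 * (1 / β) / 2 = α / 2 := by rw [hβ]; field_simp; linarith
  rw [e1, e2, e3, t3_inv hβ0, t2_inv hβ0, t4_inv hβ0] at hI
  have hI2 : √β ^ 2 * (t3 β ^ 2) ^ 2 = t2 (1 / (2 * α)) ^ 2 * t2 (α / 2) ^ 2 := by
    rw [← mul_pow, ← mul_pow, ← hI]; ring
  rw [Real.sq_sqrt hβ0.le, t2_inv_two_mul_sq hα, t2_half_sq hα, hβ] at hI2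
  rw [hβ]
  have : α * (4 * t3 α ^ 2 * (t2 α * t4 α) - 3 * t3 (3 * α) ^ 4) = 0 := by
    linear_combination -hI2
  have := (mul_eq_zero.1 this).resolve_left hα.ne'
  linarith

lemma theta_level_fifteen_second {α β : ℝ} (hα : 0 < α) (h : α * β = 5) (hβ : β = 3 * α) :
    t3 α ^ 4 = 12 * t3 β ^ 2 * (t2 β * t4 β) := by
  have hβ0 : 0 < β := by linarith
  have hI := theta_degree_three_five (y := 1 / β) (by positivity)
  have hα2 : α ^ 2 = 5 / 3 := by rw [hβ] at h; linarith
  have e1 : 15 * (1 / β) / 2 = β / 2 := by rw [hβ]; field_simp; linarith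
  have e2 : 3 * (1 / β) = 1 / α := by rw [hβ]; field_simp
  have e3 : 5 * (1 / β) = α := by rw [hβ]; field_simp; linarith
  have e4 : 1 / β / 2 = 1 / (2 * β) := by field_simp
  rw [e1, e2, e3, e4, t3_inv hα, t2_inv hα, t4_inv hα] at hI
  have hI2 : √α ^ 2 * (t3 α ^ 2) ^ 2 = t2 (1 / (2 * β)) ^ 2 * t2 (β / 2) ^ 2 := by
    rw [← mul_pow, ← mul_pow, ← hI]; ring
  rw [Real.sq_sqrt hα.le, t2_inv_two_mul_sq hβ0, t2_half_sq hβ0, hβ] at hI2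
  rw [hβ]
  have : α * (t3 α ^ 4 - 12 * t3 (3 * α) ^ 2 * (t2 (3 * α) * t4 (3 * α))) = 0 := by
    linear_combination hI2
  have := (mul_eq_zero.1 this).resolve_left hα.ne'
  linarith

lemma theta_level_fifteen_third {α β : ℝ} (hα : 0 < α) (hβ : β = 3 * α) :
    t3 α * t3 β = t2 α * t2 β + t4 α * t4 β := by
  rw [hβ, theta_degree_three hα]

/-- Values of the theta quotients at `√(5/3)` and `√15`. -/
theorem theta_values {α β : ℝ} (hα : 0 < α) (h : α * β = 5) (hβ : β = 3 * α) :
    (t2 α / t3 α) ^ 4 = (1 - (7 * √3 - √15) / 16) / 2 ∧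
    (t2 β / t3 β) ^ 4 = (1 - (7 * √3 + √15) / 16) / 2 ∧
    t2 α ^ 2 * t4 α ^ 2 + 3 * (t2 β ^ 2 * t4 β ^ 2) = √15 / 8 * (t3 α ^ 2 * t3 β ^ 2) := by
  have hβ0 : 0 < β := by linarith
  have hα1 : 1.2 < α := by rw [hβ] at h; nlinarith
  have hA := t3_pos hα
  have hB := t3_pos hβ0
  have f1 := theta_level_fifteen_first hα h hβ
  have f2 := theta_level_fifteen_second hα h hβ
  have f3 := theta_level_fifteen_third hα hβ
  have j1 := jacobi_quartic hα
  have j2 := jacobi_quartic hβ0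
  have hA1 := t3_lt hα1
  have hB1 := one_le_t3 hβ0
  have := moduli_algebra (M := t3 α ^ 2 / t3 β ^ 2) (a := t2 α / t3 α) (a' := t4 α / t3 α)
    (b := t2 β / t3 β) (b' := t4 β / t3 β) (div_pos (t2_pos hα) hA) (div_pos (t4_pos hα) hA)
    (div_pos (t2_pos hβ0) hB) (div_pos (t4_pos hβ0) hB) (by positivity) ?_ ?_ ?_ ?_ ?_ ?_
    (by gcongr; exact t2_lt_t4 hα1) (by gcongr; exact t2_lt_t4 (by linarith))
  · refine ⟨this.1, this.2.1, ?_⟩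
    rw [← this.2.2]
    field_simp
  · rw [← div_pow, ← pow_mul]
    have : t3 α / t3 β < 1.07 := by
      rw [div_lt_iff₀ hB]; linarith
    have : (t3 α / t3 β) ^ (2 * 2) < 1.07 ^ 4 := by gcongr
    refine this.trans ?_
    norm_num
  · field_simp; linarith
  · field_simp; linarith
  · field_simp; linarith
  · field_simp; linarith
  · field_simp; linarith

/-- The complete elliptic integral of the first kind, as a function of the parameter. -/
noncomputable def ellK (m : ℝ) : ℝ := ∫ θ in (0 : ℝ)..(π / 2), 1 / √(1 - m * sin θ ^ 2)

/-- The algebraic form of the complete elliptic integral. -/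
noncomputable def ellL (a b : ℝ) : ℝ :=
  ∫ x in Set.Ioi (0 : ℝ), 1 / √((x ^ 2 + a ^ 2) * (x ^ 2 + b ^ 2))

lemma tan_image_Ioo : tan '' Set.Ioo 0 (π / 2) = Set.Ioi 0 := by
  ext x
  constructor
  · rintro ⟨θ, hθ, rfl⟩
    exact tan_pos_of_pos_of_lt_pi_div_two hθ.1 hθ.2
  · intro hx
    exact ⟨arctan x, ⟨arctan_pos.2 hx, arctan_lt_pi_div_two x⟩, tan_arctan x⟩

lemma cos_pos_of_mem_Ioo_zero {θ : ℝ} (hθ : θ ∈ Set.Ioo 0 (π / 2)) : 0 < cos θ :=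
  cos_pos_of_mem_Ioo ⟨by linarith [hθ.1, pi_pos], hθ.2⟩

/-- The substitution `x = tan θ`. -/
lemma integral_Ioi_eq_integral_tan (f : ℝ → ℝ) :
    ∫ x in Set.Ioi (0 : ℝ), f x = ∫ θ in (0 : ℝ)..(π / 2), f (tan θ) / cos θ ^ 2 := by
  rw [← tan_image_Ioo, integral_image_eq_integral_abs_deriv_smul measurableSet_Ioo
    (fun θ hθ => (hasDerivAt_tan (cos_pos_of_mem_Ioo_zero hθ).ne').hasDerivWithinAt)
    (injOn_tan.mono (Set.Ioo_subset_Ioo_left (by linarith [pi_pos]))),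
    intervalIntegral.integral_of_le (by positivity), ← integral_Ioc_eq_integral_Ioo]
  refine setIntegral_congr_fun measurableSet_Ioc fun θ _ => ?_
  simp only [smul_eq_mul, abs_of_nonneg (show 0 ≤ 1 / cos θ ^ 2 by positivity)]
  ring

lemma ellK_eq_ellL (k : ℝ) : ellK (1 - k ^ 2) = ellL k 1 := by
  have h := intervalIntegral.integral_comp_sub_left (a := 0) (b := π / 2)
    (fun θ => 1 / √(1 - (1 - k ^ 2) * sin θ ^ 2)) (π / 2)
  rw [sub_self, sub_zero] at h
  rw [ellK, ellL, ← h, integral_Ioi_eq_integral_tan, intervalIntegral.integral_of_le (by positivity),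
    intervalIntegral.integral_of_le (by positivity), integral_Ioc_eq_integral_Ioo,
    integral_Ioc_eq_integral_Ioo]
  refine setIntegral_congr_fun measurableSet_Ioo fun θ hθ => ?_
  have hc := cos_pos_of_mem_Ioo_zero hθ
  have e : (tan θ ^ 2 + k ^ 2) * (tan θ ^ 2 + 1 ^ 2) =
      (1 - (1 - k ^ 2) * cos θ ^ 2) / (cos θ ^ 2) ^ 2 := by
    rw [tan_eq_sin_div_cos]
    field_simp
    have := sin_sq θ
    linear_combination (sin θ ^ 2 + k ^ 2 * cos θ ^ 2) * this + this
  simp only [sin_pi_div_two_sub]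
  rw [e, Real.sqrt_div' _ (by positivity), Real.sqrt_sq (by positivity)]
  field_simp

lemma integral_univ_eq_two_mul_of_even {f : ℝ → ℝ} (hf : ∀ x, f (-x) = f x) :
    ∫ x, f x = 2 * ∫ x in Set.Ioi (0 : ℝ), f x := by
  rw [← integral_comp_abs]
  refine integral_congr_ae (Eventually.of_forall fun x => ?_)
  rcases abs_cases x with h | h <;> simp [h.1, hf]

/-- The Landen transformation. -/
lemma ellL_agm {a b : ℝ} (ha : 0 < a) (hb : 0 < b) :
    ellL ((a + b) / 2) (√(a * b)) = ellL a b := by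
  have hab : 0 < a * b := by positivity
  have himg : (fun x : ℝ => (x - a * b / x) / 2) '' Set.Ioi 0 = Set.univ := by
    ext t
    simp only [Set.mem_image, Set.mem_Ioi, Set.mem_univ, iff_true]
    have h1 : √(t ^ 2 + a * b) ^ 2 = t ^ 2 + a * b := Real.sq_sqrt (by positivity)
    have h2 : |t| < √(t ^ 2 + a * b) := by
      rw [← Real.sqrt_sq_eq_abs]; exact Real.sqrt_lt_sqrt (by positivity) (by linarith)
    have h3 : 0 < t + √(t ^ 2 + a * b) := by linarith [neg_abs_le t]
    refine ⟨t + √(t ^ 2 + a * b), h3, ?_⟩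
    field_simp
    linear_combination h1
  have hinj : Set.InjOn (fun x : ℝ => (x - a * b / x) / 2) (Set.Ioi 0) := by
    refine StrictMonoOn.injOn fun x hx y hy hxy => ?_
    have : a * b / y < a * b / x := div_lt_div_of_pos_left hab hx hxy
    linarith
  have hder : ∀ x ∈ Set.Ioi (0 : ℝ), HasDerivWithinAt (fun x : ℝ => (x - a * b / x) / 2)
      ((x ^ 2 + a * b) / (2 * x ^ 2)) (Set.Ioi 0) x := by
    intro x hx
    have hx' : x ≠ 0 := ne_of_gt hx
    have := (((hasDerivAt_id x).sub ((hasDerivAt_inv hx').const_mul (a * b))).div_const 2)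
    refine HasDerivAt.hasDerivWithinAt ?_
    refine this.congr_deriv ?_
    field_simp
    ring
  have hM := integral_univ_eq_two_mul_of_even
    (f := fun x => 1 / √((x ^ 2 + ((a + b) / 2) ^ 2) * (x ^ 2 + √(a * b) ^ 2))) (fun x => by simp)
  rw [← setIntegral_univ, ← himg,
    integral_image_eq_integral_abs_deriv_smul measurableSet_Ioi hder hinj] at hM
  have key : ∀ x ∈ Set.Ioi (0 : ℝ), |(x ^ 2 + a * b) / (2 * x ^ 2)| •
      (fun x => 1 / √((x ^ 2 + ((a + b) / 2) ^ 2) * (x ^ 2 + √(a * b) ^ 2)))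
        ((x - a * b / x) / 2) = 2 * (1 / √((x ^ 2 + a ^ 2) * (x ^ 2 + b ^ 2))) := by
    intro x hx
    have hx' : 0 < x := hx
    have e : (((x - a * b / x) / 2) ^ 2 + ((a + b) / 2) ^ 2) *
        (((x - a * b / x) / 2) ^ 2 + √(a * b) ^ 2) =
        ((x ^ 2 + a * b) / (4 * x ^ 2)) ^ 2 * ((x ^ 2 + a ^ 2) * (x ^ 2 + b ^ 2)) := by
      rw [Real.sq_sqrt hab.le]
      field_simp
      ring
    simp only [smul_eq_mul]
    rw [e, Real.sqrt_mul (by positivity), Real.sqrt_sq (by positivity), abs_of_pos (by positivity)]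
    have : 0 < √((x ^ 2 + a ^ 2) * (x ^ 2 + b ^ 2)) := Real.sqrt_pos.2 (by positivity)
    field_simp
    ring
  rw [setIntegral_congr_fun measurableSet_Ioi key, integral_const_mul] at hM
  unfold ellL
  linarith

lemma ellL_smul {a b c : ℝ} (hc : 0 < c) : ellL (c * a) (c * b) = ellL a b / c := by
  have := integral_comp_mul_left_Ioi
    (fun x => 1 / √((x ^ 2 + (c * a) ^ 2) * (x ^ 2 + (c * b) ^ 2))) 0 hc
  rw [mul_zero] at this
  have e : ∀ x : ℝ, 1 / √(((c * x) ^ 2 + (c * a) ^ 2) * ((c * x) ^ 2 + (c * b) ^ 2)) =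
      (1 / c ^ 2) * (1 / √((x ^ 2 + a ^ 2) * (x ^ 2 + b ^ 2))) := by
    intro x
    rw [show ((c * x) ^ 2 + (c * a) ^ 2) * ((c * x) ^ 2 + (c * b) ^ 2) =
      (c ^ 2) ^ 2 * ((x ^ 2 + a ^ 2) * (x ^ 2 + b ^ 2)) by ring, Real.sqrt_mul (by positivity),
      Real.sqrt_sq (by positivity)]
    rw [one_div_mul_one_div]
  simp only [e, integral_const_mul, smul_eq_mul] at this
  unfold ellL
  field_simp at this ⊢
  linarith

lemma ellL_comm (a b : ℝ) : ellL a b = ellL b a := by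
  simp only [ellL, mul_comm]

lemma ellL_tendsto {a b : ℕ → ℝ} (ha : Tendsto a atTop (𝓝 1)) (hb : Tendsto b atTop (𝓝 1)) :
    Tendsto (fun n => ellL (a n) (b n)) atTop (𝓝 (π / 2)) := by
  have h1 : π / 2 = ∫ x in Set.Ioi (0 : ℝ), 1 / √((x ^ 2 + 1 ^ 2) * (x ^ 2 + 1 ^ 2)) := by
    have := integral_Ioi_inv_one_add_sq (i := 0)
    rw [arctan_zero, sub_zero] at this
    rw [← this]
    congr 1
    ext x
    rw [Real.sqrt_mul_self (by positivity)]
    ring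
  rw [h1]
  have hinteg : Integrable (fun x : ℝ => 4 * (1 + x ^ 2)⁻¹) := integrable_inv_one_add_sq.const_mul 4
  have hev : ∀ {a : ℕ → ℝ}, Tendsto a atTop (𝓝 1) → ∀ᶠ n in atTop, 1 / 2 < a n := fun h =>
    h.eventually (lt_mem_nhds (by norm_num))
  refine tendsto_integral_filter_of_dominated_convergence (fun x => 4 * (1 + x ^ 2)⁻¹) ?_ ?_
    hinteg.integrableOn ?_
  · exact Eventually.of_forall fun n => Measurable.aestronglyMeasurable (by fun_prop)
  · filter_upwards [hev ha, hev hb] with n h1 h2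
    refine Eventually.of_forall fun x => ?_
    rw [Real.norm_of_nonneg (by positivity), ← div_eq_mul_inv, div_le_div_iff₀ (Real.sqrt_pos.2 (by
      have : 0 < a n := by linarith
      have : 0 < b n := by linarith
      positivity)) (by positivity)]
    rw [← div_le_iff₀' (by norm_num)]
    apply Real.le_sqrt_of_sq_le
    rw [one_mul, sq]
    gcongr <;> nlinarith [sq_nonneg x]
  · refine Eventually.of_forall fun x => ?_
    refine Tendsto.div tendsto_const_nhds ?_ (Real.sqrt_ne_zero'.2 (by positivity))
    exact (continuous_sqrt.tendsto _).comp
      (((ha.pow 2).const_add _).mul ((hb.pow 2).const_add _))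

lemma t3_tendsto {y : ℝ} (hy : 0 < y) : Tendsto (fun n : ℕ => t3 (2 ^ n * y)) atTop (𝓝 1) := by
  have hz : Tendsto (fun n : ℕ => -π * (2 ^ n * y)) atTop atBot := by
    have : Tendsto (fun n : ℕ => (2 : ℝ) ^ n * y) atTop atTop :=
      (tendsto_pow_atTop_atTop_of_one_lt (by norm_num)).atTop_mul_const hy
    exact this.const_mul_atTop_of_neg (by linarith [pi_pos])
  have he := tendsto_exp_atBot.comp hz
  have hu : Tendsto (fun n : ℕ => 1 + 2 / (1 - exp (-π * (2 ^ n * y))) * exp (-π * (2 ^ n * y)))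
      atTop (𝓝 (1 + 2 / (1 - 0) * 0)) :=
    (((tendsto_const_nhds (x := (2 : ℝ))).div (he.const_sub 1) (by norm_num)).mul he).const_add 1
  rw [mul_zero, add_zero] at hu
  exact tendsto_of_tendsto_of_tendsto_of_le_of_le tendsto_const_nhds hu
    (fun n => one_le_t3 (by positivity)) (fun n => t3_le (by positivity))

lemma t4_le_t3 {y : ℝ} (hy : 0 < y) : t4 y ≤ t3 y := by
  refine le_of_pow_le_pow_left₀ (n := 4) (by norm_num) (t3_pos hy).le ?_
  have := jacobi_quartic hy
  have : 0 ≤ t2 y ^ 4 := by positivity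
  linarith

lemma t4_tendsto {y : ℝ} (hy : 0 < y) : Tendsto (fun n : ℕ => t4 (2 ^ n * y)) atTop (𝓝 1) := by
  have h := (t3_tendsto hy).const_sub 2
  norm_num only at h
  exact tendsto_of_tendsto_of_tendsto_of_le_of_le h (t3_tendsto hy)
    (fun n => two_sub_t3_le_t4 (by positivity)) (fun n => t4_le_t3 (by positivity))

lemma ellL_theta {y : ℝ} (hy : 0 < y) : ellL (t3 y ^ 2) (t4 y ^ 2) = π / 2 := by
  have hstep : ∀ n : ℕ, ellL (t3 (2 ^ n * y) ^ 2) (t4 (2 ^ n * y) ^ 2) =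
      ellL (t3 y ^ 2) (t4 y ^ 2) := by
    intro n
    induction n with
    | zero => simp
    | succ n ih =>
      have hn : 0 < 2 ^ n * y := by positivity
      have h3 := t3_pos hn
      have h4 := t4_pos hn
      rw [← ih, ← ellL_agm (pow_pos h3 2) (pow_pos h4 2), two_mul_t3_two_mul_sq hn,
        ← mul_pow, Real.sqrt_sq (by positivity), ← t4_two_mul_sq hn,
        show 2 * (2 ^ n * y) = 2 ^ (n + 1) * y by ring]
      congr 1
      ring
  have h := ellL_tendsto (by simpa using (t3_tendsto hy).pow 2)
    (by simpa using (t4_tendsto hy).pow 2)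
  simp only [hstep] at h
  exact tendsto_nhds_unique tendsto_const_nhds h

/-- `K = (π / 2) θ₃²`. -/
theorem ellK_theta {y : ℝ} (hy : 0 < y) : ellK ((t2 y / t3 y) ^ 4) = π / 2 * t3 y ^ 2 := by
  have h3 := t3_pos hy
  have h4 := t4_pos hy
  have h := ellL_theta hy
  have e : (t2 y / t3 y) ^ 4 = 1 - ((t4 y / t3 y) ^ 2) ^ 2 := by
    have := jacobi_quartic hy
    field_simp
    linarith
  rw [e, ellK_eq_ellL]
  have := ellL_smul (a := (t4 y / t3 y) ^ 2) (b := 1) (pow_pos h3 2)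
  rw [mul_one, ← mul_pow, mul_div_cancel₀ _ h3.ne', ellL_comm, h] at this
  field_simp at this ⊢
  linarith

theorem ellK_theta_compl {y : ℝ} (hy : 0 < y) :
    ellK (1 - (t2 y / t3 y) ^ 4) = π / 2 * y * t3 y ^ 2 := by
  have h := ellK_theta (y := 1 / y) (by positivity)
  have h3 := t3_pos hy
  have hs : 0 < √y := Real.sqrt_pos.2 hy
  rw [t2_inv hy, t3_inv hy, mul_div_mul_left _ _ hs.ne', mul_pow, Real.sq_sqrt hy.le] at h
  rw [mul_assoc, ← h]
  congr 1
  have := jacobi_quartic hy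
  field_simp
  linarith

/-- Differentiation under the integral sign over a compact interval. -/
lemma hasDerivAt_intervalIntegral_param {g g' : ℝ → ℝ → ℝ} {a b x : ℝ} {U : Set ℝ} (hU : IsOpen U)
    (hx : x ∈ U) (hg : ∀ y ∈ U, Continuous (g y))
    (hd : ∀ y ∈ U, ∀ θ, HasDerivAt (fun y => g y θ) (g' y θ) y)
    (hg' : ContinuousOn (Function.uncurry g') (U ×ˢ Set.univ)) :
    HasDerivAt (fun y => ∫ θ in a..b, g y θ) (∫ θ in a..b, g' x θ) x := by
  obtain ⟨ε, hε, hball⟩ := Metric.nhds_basis_closedBall.mem_iff.1 (hU.mem_nhds hx)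
  have hcomp : IsCompact (Metric.closedBall x ε ×ˢ Set.uIcc a b) :=
    (isCompact_closedBall x ε).prod isCompact_uIcc
  obtain ⟨C, hC⟩ := hcomp.exists_bound_of_continuousOn
    (hg'.mono (Set.prod_mono hball (Set.subset_univ _)))
  have hcont : Continuous (g' x) := by
    rw [← continuousOn_univ]
    exact hg'.comp (by fun_prop : Continuous fun θ : ℝ => (x, θ)).continuousOn fun θ _ => ⟨hx, trivial⟩
  refine (intervalIntegral.hasDerivAt_integral_of_dominated_loc_of_deriv_le (bound := fun _ => C)
    (F' := g') (Metric.closedBall_mem_nhds x hε) ?_ ((hg x hx).intervalIntegrable a b)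
    hcont.aestronglyMeasurable ?_ intervalIntegrable_const ?_).2
  · filter_upwards [hU.mem_nhds hx] with y hy using (hg y hy).aestronglyMeasurable
  · exact Eventually.of_forall fun θ hθ y hy => hC (y, θ) ⟨hy, Set.uIoc_subset_uIcc hθ⟩
  · exact Eventually.of_forall fun θ _ y hy => hd y (hball hy) θ

/-- The Legendre function `P_{-1/2}`, up to the factor `π / 2`. -/
noncomputable def ellF (z : ℝ) : ℝ := ellK ((1 - z) / 2)

lemma legendre_base_pos {z : ℝ} (hz : -1 < z) (θ : ℝ) : 0 < 1 - (1 - z) / 2 * sin θ ^ 2 := by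
  have h1 := sin_sq_le_one θ
  rcases le_or_gt z 1 with h | h <;> nlinarith [sq_nonneg (sin θ)]

/-- The moments occurring in the derivatives of `ellF`. -/
noncomputable def legendreMoment (n : ℕ) (r z : ℝ) : ℝ :=
  ∫ θ in (0 : ℝ)..(π / 2), sin θ ^ n * (1 - (1 - z) / 2 * sin θ ^ 2) ^ r

lemma hasDerivAt_legendreMoment (n : ℕ) (r : ℝ) {z : ℝ} (hz : -1 < z) :
    HasDerivAt (legendreMoment n r) (r / 2 * legendreMoment (n + 2) (r - 1) z) z := by
  have hc : ∀ r : ℝ, ContinuousOn (fun p : ℝ × ℝ => (1 - (1 - p.1) / 2 * sin p.2 ^ 2) ^ r)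
      (Set.Ioi (-1) ×ˢ Set.univ) := fun r =>
    ContinuousOn.rpow_const (by fun_prop) fun p hp => Or.inl (legendre_base_pos hp.1 p.2).ne'
  have := hasDerivAt_intervalIntegral_param (a := 0) (b := π / 2) (isOpen_Ioi (a := (-1 : ℝ))) hz
    (g := fun z θ => sin θ ^ n * (1 - (1 - z) / 2 * sin θ ^ 2) ^ r)
    (g' := fun z θ => r / 2 * (sin θ ^ (n + 2) * (1 - (1 - z) / 2 * sin θ ^ 2) ^ (r - 1)))
    (fun y hy => ?_) (fun y hy θ => ?_) ?_
  · rwa [intervalIntegral.integral_const_mul] at this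
  · have hp := fun θ => (legendre_base_pos hy θ).ne'
    exact (by fun_prop : Continuous fun θ => sin θ ^ n).mul
      (Continuous.rpow_const (by fun_prop) fun θ => Or.inl (hp θ))
  · have h1 : HasDerivAt (fun y : ℝ => 1 - (1 - y) / 2 * sin θ ^ 2) (sin θ ^ 2 / 2) y := by
      have := (((hasDerivAt_id y).const_sub 1).div_const 2 |>.mul_const (sin θ ^ 2)).const_sub 1
      exact this.congr_deriv (by ring)
    refine ((h1.rpow_const (p := r) (Or.inl (legendre_base_pos hy θ).ne')).const_mul
      (sin θ ^ n)).congr_deriv ?_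
    ring
  · exact continuousOn_const.mul ((by fun_prop : Continuous fun p : ℝ × ℝ =>
      sin p.2 ^ (n + 2)).continuousOn.mul (hc (r - 1)))

lemma ellF_eq_legendreMoment {z : ℝ} (hz : -1 < z) : ellF z = legendreMoment 0 (-1 / 2) z := by
  unfold ellF ellK legendreMoment
  refine intervalIntegral.integral_congr fun θ _ => ?_
  have h := legendre_base_pos hz θ
  simp only [pow_zero, one_mul]
  rw [show (-1 / 2 : ℝ) = -(1 / 2) by norm_num, rpow_neg h.le, ← Real.sqrt_eq_rpow, one_div]

/-- First derivative of `ellF`. -/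
noncomputable def ellF₁ (z : ℝ) : ℝ := -1 / 4 * legendreMoment 2 (-3 / 2) z

/-- Second derivative of `ellF`. -/
noncomputable def ellF₂ (z : ℝ) : ℝ := 3 / 16 * legendreMoment 4 (-5 / 2) z

lemma hasDerivAt_ellF {z : ℝ} (hz : -1 < z) : HasDerivAt ellF (ellF₁ z) z := by
  have h := hasDerivAt_legendreMoment 0 (-1 / 2) hz
  have e : ellF =ᶠ[𝓝 z] legendreMoment 0 (-1 / 2) := by
    filter_upwards [lt_mem_nhds hz] with y hy using ellF_eq_legendreMoment hy
  refine (h.congr_of_eventuallyEq e).congr_deriv ?_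
  norm_num [ellF₁]

lemma hasDerivAt_ellF₁ {z : ℝ} (hz : -1 < z) : HasDerivAt ellF₁ (ellF₂ z) z := by
  refine ((hasDerivAt_legendreMoment 2 (-3 / 2) hz).const_mul (-1 / 4)).congr_deriv ?_
  unfold ellF₂
  norm_num
  ring

lemma continuousOn_ellF₂ : ContinuousOn ellF₂ (Set.Ioi (-1)) := fun _ hz =>
  ((hasDerivAt_legendreMoment 4 (-5 / 2) hz).const_mul
    (3 / 16)).continuousAt.continuousWithinAt

lemma continuousOn_ellF₁ : ContinuousOn ellF₁ (Set.Ioi (-1)) := fun _ hz =>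
  (hasDerivAt_ellF₁ hz).continuousAt.continuousWithinAt

lemma continuousOn_ellF : ContinuousOn ellF (Set.Ioi (-1)) := fun _ hz =>
  (hasDerivAt_ellF hz).continuousAt.continuousWithinAt

lemma ellF_one : ellF 1 = π / 2 := by
  simp [ellF, ellK]

lemma ellF_pos {z : ℝ} (hz : -1 < z) : 0 < ellF z := by
  rw [ellF_eq_legendreMoment hz]
  refine intervalIntegral.intervalIntegral_pos_of_pos ?_ (fun θ => ?_) (by positivity)
  · refine Continuous.intervalIntegrable ?_ _ _
    exact (by fun_prop : Continuous fun θ => sin θ ^ 0).mul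
      (Continuous.rpow_const (by fun_prop) fun θ => Or.inl (legendre_base_pos hz θ).ne')
  · simpa using rpow_pos_of_pos (legendre_base_pos hz θ) _

/-- Legendre's differential equation of degree `-1/2`. -/
lemma ellF_legendre {z : ℝ} (hz : -1 < z) :
    (1 - z ^ 2) * ellF₂ z - 2 * z * ellF₁ z = ellF z / 4 := by
  have hp := legendre_base_pos hz
  have hder : ∀ θ, HasDerivAt
      (fun θ => -1 / 4 * (sin θ * cos θ * (1 - (1 - z) / 2 * sin θ ^ 2) ^ (-3 / 2 : ℝ)))
      ((1 - z ^ 2) * (3 / 16 * (sin θ ^ 4 * (1 - (1 - z) / 2 * sin θ ^ 2) ^ (-5 / 2 : ℝ))) -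
      2 * z * (-1 / 4 * (sin θ ^ 2 * (1 - (1 - z) / 2 * sin θ ^ 2) ^ (-3 / 2 : ℝ))) -
      1 / 4 * (sin θ ^ 0 * (1 - (1 - z) / 2 * sin θ ^ 2) ^ (-1 / 2 : ℝ))) θ := by
    intro θ
    have h1 : HasDerivAt (fun θ : ℝ => 1 - (1 - z) / 2 * sin θ ^ 2)
        (-((1 - z) / 2 * (2 * sin θ * cos θ))) θ := by
      have := (((hasDerivAt_sin θ).pow 2).const_mul ((1 - z) / 2)).const_sub 1
      exact this.congr_deriv (by norm_num)
    refine ((((hasDerivAt_sin θ).mul (hasDerivAt_cos θ)).mul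
      (h1.rpow_const (p := -3 / 2) (Or.inl (hp θ).ne'))).const_mul (-1 / 4)).congr_deriv ?_
    have e1 : (1 - (1 - z) / 2 * sin θ ^ 2) ^ (-3 / 2 : ℝ) =
        (1 - (1 - z) / 2 * sin θ ^ 2) ^ (-5 / 2 : ℝ) * (1 - (1 - z) / 2 * sin θ ^ 2) := by
      rw [← rpow_add_one (hp θ).ne']; norm_num
    have e2 : (1 - (1 - z) / 2 * sin θ ^ 2) ^ (-1 / 2 : ℝ) =
        (1 - (1 - z) / 2 * sin θ ^ 2) ^ (-5 / 2 : ℝ) * (1 - (1 - z) / 2 * sin θ ^ 2) ^ 2 := by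
      rw [← rpow_add_natCast (hp θ).ne']; norm_num
    rw [show (-3 / 2 - 1 : ℝ) = -5 / 2 by norm_num, e2, Pi.mul_apply, e1]
    have hc := cos_sq' θ
    generalize (1 - (1 - z) / 2 * sin θ ^ 2) ^ (-5 / 2 : ℝ) = P
    ring_nf
    simp only [hc]
    ring
  have hcont : ∀ (n : ℕ) (r : ℝ), Continuous
      fun θ => sin θ ^ n * (1 - (1 - z) / 2 * sin θ ^ 2) ^ r := fun n r =>
    (by fun_prop : Continuous fun θ => sin θ ^ n).mul
      (Continuous.rpow_const (by fun_prop) fun θ => Or.inl (hp θ).ne')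
  have h4 := hcont 4 (-5 / 2)
  have h2 := hcont 2 (-3 / 2)
  have h0 := hcont 0 (-1 / 2)
  have hinteg := intervalIntegral.integral_eq_sub_of_hasDerivAt (a := 0) (b := π / 2)
    (fun θ _ => hder θ) (Continuous.intervalIntegrable (by
      exact ((h4.const_mul _).const_mul _).sub ((h2.const_mul _).const_mul _) |>.sub
        (h0.const_mul _)) _ _)
  rw [intervalIntegral.integral_sub, intervalIntegral.integral_sub] at hinteg
  · simp only [intervalIntegral.integral_const_mul, sin_zero, cos_pi_div_two] at hinteg
    rw [ellF_eq_legendreMoment hz]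
    unfold ellF₁ ellF₂ legendreMoment
    linarith
  · exact (((h4.const_mul _).const_mul _)).intervalIntegrable _ _
  · exact (((h2.const_mul _).const_mul _)).intervalIntegrable _ _
  · exact (((h4.const_mul _).const_mul _).sub ((h2.const_mul _).const_mul _)).intervalIntegrable _ _
  · exact (h0.const_mul _).intervalIntegrable _ _

/-- The cosine of the third side of a spherical triangle. -/
noncomputable def sphZ (α β ω : ℝ) : ℝ := cos α * cos β + sin α * sin β * cos ω

/-- The derivative of `sphZ` with respect to the second side. -/
noncomputable def sphZ₁ (α β ω : ℝ) : ℝ := -(cos α * sin β) + sin α * cos β * cos ω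

lemma neg_one_lt_sphZ {α β : ℝ} (hα : 0 < α) (h1 : -(π - α) < β) (h2 : β < π - α) (ω : ℝ) :
    -1 < sphZ α β ω := by
  have hs : 0 < sin α := sin_pos_of_pos_of_lt_pi hα (by
    by_contra! h; linarith)
  have hb : |β| < π - α := abs_lt.2 ⟨h1, h2⟩
  have hc : -1 < cos (α + |β|) := by
    rw [← cos_pi]
    exact cos_lt_cos_of_nonneg_of_le_pi (by positivity) le_rfl (by linarith)
  have h3 : cos (α + |β|) = cos α * cos β - sin α * |sin β| := by
    rw [cos_add, cos_abs, ← abs_sin_eq_sin_abs_of_abs_le_pi]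
    linarith [hb]
  have h4 : -|sin β| ≤ sin β * cos ω := by
    refine neg_le_of_abs_le ?_
    rw [abs_mul]
    exact mul_le_of_le_one_right (abs_nonneg _) (abs_cos_le_one _)
  unfold sphZ
  nlinarith

lemma hasDerivAt_sphZ (α β ω : ℝ) : HasDerivAt (fun β => sphZ α β ω) (sphZ₁ α β ω) β := by
  unfold sphZ sphZ₁
  exact (((hasDerivAt_cos β).const_mul (cos α)).add
    (((hasDerivAt_sin β).const_mul (sin α)).mul_const (cos ω))).congr_deriv (by ring)

lemma hasDerivAt_sphZ₁ (α β ω : ℝ) : HasDerivAt (fun β => sphZ₁ α β ω) (-sphZ α β ω) β := by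
  unfold sphZ sphZ₁
  exact (((hasDerivAt_sin β).const_mul (cos α)).neg.add
    (((hasDerivAt_cos β).const_mul (sin α)).mul_const (cos ω))).congr_deriv (by ring)

lemma hasDerivAt_sphZ_angle (α β ω : ℝ) :
    HasDerivAt (fun ω => sphZ α β ω) (-(sin α * sin β * sin ω)) ω := by
  unfold sphZ
  exact (((hasDerivAt_cos ω).const_mul (sin α * sin β)).const_add _).congr_deriv (by ring)

lemma continuous_sphZ (α : ℝ) : Continuous (Function.uncurry (sphZ α)) := by
  unfold sphZ Function.uncurry; fun_prop

lemma continuous_sphZ₁ (α : ℝ) : Continuous (Function.uncurry (sphZ₁ α)) := by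
  unfold sphZ₁ Function.uncurry; fun_prop

/-- The mean of `ellF` over a spherical circle. -/
noncomputable def sphMean (α β : ℝ) : ℝ := ∫ ω in (0 : ℝ)..π, ellF (sphZ α β ω)

/-- First derivative of `sphMean`. -/
noncomputable def sphMean₁ (α β : ℝ) : ℝ :=
  ∫ ω in (0 : ℝ)..π, ellF₁ (sphZ α β ω) * sphZ₁ α β ω

/-- Second derivative of `sphMean`. -/
noncomputable def sphMean₂ (α β : ℝ) : ℝ :=
  ∫ ω in (0 : ℝ)..π, (ellF₂ (sphZ α β ω) * sphZ₁ α β ω ^ 2 - ellF₁ (sphZ α β ω) * sphZ α β ω)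

lemma continuousOn_comp_sphZ {α : ℝ} (hα : 0 < α) {f : ℝ → ℝ} (hf : ContinuousOn f (Set.Ioi (-1))) :
    ContinuousOn (fun p : ℝ × ℝ => f (sphZ α p.1 p.2))
      (Set.Ioo (-(π - α)) (π - α) ×ˢ Set.univ) :=
  hf.comp (continuous_sphZ α).continuousOn fun p hp => neg_one_lt_sphZ hα hp.1.1 hp.1.2 p.2

lemma continuous_comp_sphZ {α : ℝ} (hα : 0 < α) {f : ℝ → ℝ} (hf : ContinuousOn f (Set.Ioi (-1))) {β : ℝ}
    (hβ : β ∈ Set.Ioo (-(π - α)) (π - α)) : Continuous fun ω => f (sphZ α β ω) := by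
  rw [← continuousOn_univ]
  exact hf.comp ((continuous_sphZ α).comp
    (by fun_prop : Continuous fun ω : ℝ => (β, ω))).continuousOn
    fun ω _ => neg_one_lt_sphZ hα hβ.1 hβ.2 ω

lemma hasDerivAt_sphMean {α : ℝ} (hα : 0 < α) {β : ℝ} (hβ : β ∈ Set.Ioo (-(π - α)) (π - α)) :
    HasDerivAt (sphMean α) (sphMean₁ α β) β := by
  refine hasDerivAt_intervalIntegral_param (g := fun β ω => ellF (sphZ α β ω))
    (g' := fun β ω => ellF₁ (sphZ α β ω) * sphZ₁ α β ω) isOpen_Ioo hβ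
    (fun y hy => continuous_comp_sphZ hα continuousOn_ellF hy) (fun y hy ω => ?_) ?_
  · exact HasDerivAt.comp (h₂ := ellF) (h := fun β => sphZ α β ω) y
      (hasDerivAt_ellF (neg_one_lt_sphZ hα hy.1 hy.2 ω)) (hasDerivAt_sphZ α y ω)
  · exact (continuousOn_comp_sphZ hα continuousOn_ellF₁).mul (continuous_sphZ₁ α).continuousOn

lemma hasDerivAt_sphMean₁ {α : ℝ} (hα : 0 < α) {β : ℝ} (hβ : β ∈ Set.Ioo (-(π - α)) (π - α)) :
    HasDerivAt (sphMean₁ α) (sphMean₂ α β) β := by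
  have hcont : ∀ y ∈ Set.Ioo (-(π - α)) (π - α),
      Continuous fun ω => ellF₁ (sphZ α y ω) * sphZ₁ α y ω := fun y hy => by
    have h1 : Continuous fun ω => ellF₁ (sphZ α y ω) :=
      continuous_comp_sphZ hα continuousOn_ellF₁ hy
    have h2 : Continuous fun ω => sphZ₁ α y ω := by unfold sphZ₁; fun_prop
    exact h1.mul h2
  refine hasDerivAt_intervalIntegral_param (g := fun β ω => ellF₁ (sphZ α β ω) * sphZ₁ α β ω)
    (g' := fun β ω => ellF₂ (sphZ α β ω) * sphZ₁ α β ω ^ 2 - ellF₁ (sphZ α β ω) * sphZ α β ω)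
    isOpen_Ioo hβ hcont (fun y hy ω => ?_) ?_
  · have h1 := HasDerivAt.comp (h₂ := ellF₁) (h := fun β => sphZ α β ω) y
      (hasDerivAt_ellF₁ (neg_one_lt_sphZ hα hy.1 hy.2 ω)) (hasDerivAt_sphZ α y ω)
    refine HasDerivAt.congr_deriv (h1.fun_mul (hasDerivAt_sphZ₁ α y ω)) ?_
    simp only [Function.comp]
    ring
  · exact ((continuousOn_comp_sphZ hα continuousOn_ellF₂).mul
      ((continuous_sphZ₁ α).pow 2).continuousOn).sub
      ((continuousOn_comp_sphZ hα continuousOn_ellF₁).mul (continuous_sphZ α).continuousOn)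

lemma sphMean_ode {α : ℝ} (hα : 0 < α) {β : ℝ} (hβ : β ∈ Set.Ioo (-(π - α)) (π - α)) :
    sin β * (sin β * sphMean₂ α β + cos β * sphMean₁ α β) = sin β ^ 2 * (sphMean α β / 4) := by
  have hz := fun ω => neg_one_lt_sphZ hα hβ.1 hβ.2 ω
  have hder : ∀ ω, HasDerivAt
      (fun ω => ellF₁ (sphZ α β ω) * (-(sin α * sin β * sin ω)))
      (sin β ^ 2 * (1 / 4 * ellF (sphZ α β ω)) -
        sin β * cos β * (ellF₁ (sphZ α β ω) * sphZ₁ α β ω) -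
        sin β ^ 2 * (ellF₂ (sphZ α β ω) * sphZ₁ α β ω ^ 2 -
          ellF₁ (sphZ α β ω) * sphZ α β ω)) ω := by
    intro ω
    have h1 := HasDerivAt.comp (h₂ := ellF₁) (h := fun ω => sphZ α β ω) ω
      (hasDerivAt_ellF₁ (hz ω)) (hasDerivAt_sphZ_angle α β ω)
    refine HasDerivAt.congr_deriv
      (h1.fun_mul ((hasDerivAt_sin ω).const_mul (sin α * sin β)).fun_neg) ?_
    simp only [Function.comp]
    have h := ellF_legendre (hz ω)
    have e1 : sin β ^ 2 * sphZ₁ α β ω ^ 2 + (sin α * sin β * sin ω) ^ 2 =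
        sin β ^ 2 * (1 - sphZ α β ω ^ 2) := by
      unfold sphZ sphZ₁
      have a1 := sin_sq α
      have a2 := sin_sq β
      have a3 := sin_sq ω
      ring_nf
      simp only [show sin β ^ 4 = (sin β ^ 2) ^ 2 by ring, a1, a2, a3]
      ring
    have e2 : -(sin β ^ 2 * sphZ α β ω) + sin β * cos β * sphZ₁ α β ω - sin α * sin β * cos ω =
        -2 * sphZ α β ω * sin β ^ 2 := by
      unfold sphZ sphZ₁
      have a2 := cos_sq' β
      ring_nf
      simp only [a2]
      ring
    linear_combination ellF₂ (sphZ α β ω) * e1 + ellF₁ (sphZ α β ω) * e2 + sin β ^ 2 * h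
  have c0 := continuous_comp_sphZ hα continuousOn_ellF hβ
  have c1 := (continuous_comp_sphZ hα continuousOn_ellF₁ hβ)
  have cz := (continuous_sphZ α).comp (by fun_prop : Continuous fun ω : ℝ => (β, ω))
  have cz1 := (continuous_sphZ₁ α).comp (by fun_prop : Continuous fun ω : ℝ => (β, ω))
  have c2 := ((continuous_comp_sphZ hα continuousOn_ellF₂ hβ).mul (cz1.pow 2)).sub (c1.mul cz)
  have d1 := c1.mul cz1
  have hinteg := intervalIntegral.integral_eq_sub_of_hasDerivAt (a := 0) (b := π)
    (fun ω _ => hder ω) (Continuous.intervalIntegrable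
      ((((c0.const_mul _).const_mul _).sub (d1.const_mul _)).sub (c2.const_mul _)) _ _)
  rw [intervalIntegral.integral_sub, intervalIntegral.integral_sub] at hinteg
  · simp only [intervalIntegral.integral_const_mul, sin_zero, sin_pi] at hinteg
    unfold sphMean sphMean₁ sphMean₂
    linarith
  · exact ((c0.const_mul _).const_mul _).intervalIntegrable _ _
  · exact (d1.const_mul _).intervalIntegrable _ _
  · exact (((c0.const_mul _).const_mul _).sub (d1.const_mul _)).intervalIntegrable _ _
  · exact (c2.const_mul _).intervalIntegrable _ _

/-- The product formula for Legendre functions. -/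
theorem sphMean_eq {α : ℝ} (hα : 0 < α) {β : ℝ} (hβ0 : 0 < β) (hβ : α + β < π) :
    sphMean α β = 2 * ellF (cos α) * ellF (cos β) := by
  have hmem : ∀ x ∈ Set.Icc 0 β, x ∈ Set.Ioo (-(π - α)) (π - α) := fun x hx =>
    ⟨by linarith [hx.1, hx.2], by linarith [hx.2]⟩
  have hcos : ∀ x ∈ Set.Icc 0 β, -1 < cos x := fun x hx => by
    rw [← cos_pi]
    exact cos_lt_cos_of_nonneg_of_le_pi hx.1 le_rfl (by linarith [hx.2])
  have hG : ∀ x ∈ Set.Icc 0 β, HasDerivAt (fun x => ellF (cos x)) (ellF₁ (cos x) * -sin x) x :=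
    fun x hx => (hasDerivAt_ellF (hcos x hx)).comp x (hasDerivAt_cos x)
  have hG1 : ∀ x ∈ Set.Icc 0 β, HasDerivAt (fun x => ellF₁ (cos x) * -sin x)
      (ellF₂ (cos x) * sin x ^ 2 - ellF₁ (cos x) * cos x) x := fun x hx =>
    (((hasDerivAt_ellF₁ (hcos x hx)).comp x (hasDerivAt_cos x)).mul
      (hasDerivAt_sin x).neg).congr_deriv (by simp only [Function.comp, Pi.neg_apply]; ring)
  let W : ℝ → ℝ := fun x => sin x * (sphMean₁ α x * ellF (cos x) -
    sphMean α x * (ellF₁ (cos x) * -sin x))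
  have hW : ∀ x ∈ Set.Icc 0 β, HasDerivAt W (cos x * (sphMean₁ α x * ellF (cos x) -
      sphMean α x * (ellF₁ (cos x) * -sin x)) + sin x * (sphMean₂ α x * ellF (cos x) -
      sphMean α x * (ellF₂ (cos x) * sin x ^ 2 - ellF₁ (cos x) * cos x))) x := fun x hx => by
    have h1 := hasDerivAt_sphMean hα (hmem x hx)
    have h2 := hasDerivAt_sphMean₁ hα (hmem x hx)
    exact ((hasDerivAt_sin x).mul ((h2.mul (hG x hx)).sub (h1.mul (hG1 x hx)))).congr_deriv
      (by simp only [Pi.mul_apply, Pi.sub_apply]; ring)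
  have hsin : ∀ x ∈ Set.Ioc 0 β, 0 < sin x := fun x hx =>
    sin_pos_of_pos_of_lt_pi hx.1 (by linarith [hx.2])
  have hW0 : ∀ x ∈ Set.Icc 0 β, W x = 0 := by
    intro x hx
    rcases hx.1.eq_or_lt with h0 | h0
    · simp [W, ← h0]
    have hsub : ∀ y ∈ Set.Icc 0 x, y ∈ Set.Icc 0 β := fun y hy => ⟨hy.1, hy.2.trans hx.2⟩
    obtain ⟨c, hc, he⟩ := exists_hasDerivAt_eq_slope W _ h0
      (fun y hy => (hW y (hsub y hy)).continuousAt.continuousWithinAt)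
      (fun y hy => hW y (hsub y (Set.Ioo_subset_Icc_self hy)))
    have hc' := hsub c (Set.Ioo_subset_Icc_self hc)
    have hs := hsin c ⟨hc.1, hc.2.le.trans hx.2⟩
    have o1 := sphMean_ode hα (hmem c hc')
    have o2 := ellF_legendre (hcos c hc')
    have : sin c * (cos c * (sphMean₁ α c * ellF (cos c) -
      sphMean α c * (ellF₁ (cos c) * -sin c)) + sin c * (sphMean₂ α c * ellF (cos c) -
      sphMean α c * (ellF₂ (cos c) * sin c ^ 2 - ellF₁ (cos c) * cos c))) = 0 := by
      have e := cos_sq' c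
      rw [e] at o2
      linear_combination ellF (cos c) * o1 - sphMean α c * sin c ^ 2 * o2
    rw [(mul_eq_zero.1 this).resolve_left hs.ne', eq_comm, div_eq_zero_iff] at he
    have : W 0 = 0 := by simp [W]
    rcases he with he | he <;> linarith
  have hG0 : ∀ x ∈ Set.Icc 0 β, 0 < ellF (cos x) := fun x hx => ellF_pos (hcos x hx)
  obtain ⟨c, hc, he⟩ := exists_hasDerivAt_eq_slope (fun x => sphMean α x / ellF (cos x)) _ hβ0
    (fun y hy => ((hasDerivAt_sphMean hα (hmem y hy)).div (hG y hy)
      (hG0 y hy).ne').continuousAt.continuousWithinAt)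
    (fun y hy => (hasDerivAt_sphMean hα (hmem y (Set.Ioo_subset_Icc_self hy))).div
      (hG y (Set.Ioo_subset_Icc_self hy)) (hG0 y (Set.Ioo_subset_Icc_self hy)).ne')
  have hw := (mul_eq_zero.1 (hW0 c (Set.Ioo_subset_Icc_self hc))).resolve_left
    (hsin c ⟨hc.1, hc.2.le⟩).ne'
  rw [hw, zero_div, eq_comm, div_eq_zero_iff] at he
  have h0 : sphMean α 0 = π * ellF (cos α) := by simp [sphMean, sphZ]
  have hb := hG0 β ⟨hβ0.le, le_rfl⟩
  have hpi := pi_pos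
  rcases he with he | he
  · simp only [cos_zero, ellF_one, h0] at he
    field_simp at he
    linarith
  · linarith

theorem integral_ellK_level_fifteen :
    ∫ ω in (0 : ℝ)..π, ellK (97 / 128 - cos ω / 128) =
      2 * ellK (1 - (1 - (7 * √3 - √15) / 16) / 2) * ellK ((1 - (7 * √3 + √15) / 16) / 2) := by
  have h3 : √3 ^ 2 = 3 := Real.sq_sqrt (by norm_num)
  have h15 : √15 ^ 2 = 15 := Real.sq_sqrt (by norm_num)
  have p3 : 0 < √3 := by positivity
  have p15 : 0 < √15 := by positivity
  have l15 : √15 < 4 := by nlinarith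
  have l3 : √3 < 1.7321 := by nlinarith
  have g3 : 1.7320 < √3 := by nlinarith
  have g15 : 3.872 < √15 := by nlinarith
  have l15' : √15 < 3.873 := by nlinarith
  set x := (7 * √3 - √15) / 16 with hx
  set y := (7 * √3 + √15) / 16 with hy
  have hxy : x * y = 33 / 64 := by rw [hx, hy]; linarith
  have hx0 : 0 < x := by rw [hx]; linarith
  have hlt : x < y := by rw [hx, hy]; linarith
  have hy1 : y < 1 := by rw [hy]; linarith
  have hs : sin (arccos (-x)) * sin (arccos y) = 1 / 64 := by
    rw [sin_arccos, sin_arccos, ← Real.sqrt_mul (by nlinarith)]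
    rw [show (1 / 64 : ℝ) = √((1 / 64) ^ 2) by rw [Real.sqrt_sq (by norm_num)]]
    congr 1
    have : x ^ 2 + y ^ 2 = (147 + 15) / 128 := by rw [hx, hy]; linarith
    linear_combination -this + (x * y + 33 / 64) * hxy
  have hα : 0 < arccos (-x) := arccos_pos.2 (by linarith)
  have hβ : 0 < arccos y := arccos_pos.2 hy1
  have hab : arccos (-x) + arccos y < π := by
    rw [arccos_neg]
    have := arccos_lt_arccos (x := x) (y := y) (by linarith) hlt hy1.le
    linarith
  have h := sphMean_eq hα hβ hab
  unfold sphMean sphZ at h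
  rw [hs, cos_arccos (by linarith) (by linarith), cos_arccos (by linarith) hy1.le] at h
  unfold ellF at h
  rw [show 1 - (1 - x) / 2 = (1 - -x) / 2 by ring, ← h]
  congr 1
  ext ω
  congr 1
  linear_combination -hxy / 2

/-- The discriminant `(1 + m + n)² - 4 m`. -/
noncomputable def quadDisc (m n : ℝ) : ℝ := (1 + m + n) ^ 2 - 4 * m

lemma lintegral_sinh_substitution {m : ℝ} (hm : 0 < m) :
    ∫⁻ u in Set.Ioi (0 : ℝ), ENNReal.ofReal (1 / √(quadDisc m (4 * sinh u ^ 2))) =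
      ∫⁻ r in {r : ℝ | 0 < r ∧ 1 < (1 + r) * m}, ENNReal.ofReal (1 / (2 * r * (1 + r)) *
        (1 / √((m - 1 / (1 + r)) * (m - 1 / (1 + r) + 4 / r)))) := by
  set S := {r : ℝ | 0 < r ∧ 1 < (1 + r) * m} with hS
  have hSm : MeasurableSet S := by
    rw [hS]; measurability
  have hpos : ∀ r ∈ S, 0 < m - 1 / (1 + r) := fun r hr => by
    have : 0 < 1 + r := by linarith [hr.1]
    rw [sub_pos, div_lt_iff₀ this]
    linarith [hr.2]
  have hpos' : ∀ r ∈ S, 0 < m - 1 / (1 + r) ^ 2 := fun r hr => by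
    have h0 := hpos r hr
    have h1 : 0 < 1 + r := by linarith [hr.1]
    have : 1 / (1 + r) ^ 2 ≤ 1 / (1 + r) := by
      apply one_div_le_one_div_of_le h1
      nlinarith [hr.1]
    linarith
  have hder : ∀ r ∈ S, HasDerivWithinAt (fun r => arsinh (√(r * (m - 1 / (1 + r))) / 2))
      ((√(1 + (√(r * (m - 1 / (1 + r))) / 2) ^ 2))⁻¹ *
        ((m - 1 / (1 + r) ^ 2) / (2 * √(r * (m - 1 / (1 + r)))) / 2)) S r := by
    intro r hr
    have h1 : 1 + r ≠ 0 := by linarith [hr.1]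
    have hn : r * (m - 1 / (1 + r)) ≠ 0 := (mul_pos hr.1 (hpos r hr)).ne'
    have hd : HasDerivAt (fun r => r * (m - 1 / (1 + r))) (m - 1 / (1 + r) ^ 2) r := by
      refine ((hasDerivAt_id r).mul ((((hasDerivAt_const r (1 : ℝ)).div
        ((hasDerivAt_id r).const_add 1) h1)).const_sub m)).congr_deriv ?_
      simp only [id, Pi.div_apply]
      field_simp
      ring
    refine HasDerivAt.hasDerivWithinAt ?_
    exact ((hd.sqrt hn).div_const 2).arsinh
  have hinj : Set.InjOn (fun r => arsinh (√(r * (m - 1 / (1 + r))) / 2)) S := by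
    refine StrictMonoOn.injOn fun x hx y hy hxy => ?_
    have hx1 : 0 < 1 + x := by linarith [hx.1]
    have hy1 : 0 < 1 + y := by linarith [hy.1]
    refine arsinh_lt_arsinh.2 (div_lt_div_of_pos_right (Real.sqrt_lt_sqrt
      (mul_pos hx.1 (hpos x hx)).le ?_) (by norm_num))
    have : y * (m - 1 / (1 + y)) - x * (m - 1 / (1 + x)) =
        (y - x) * ((1 + x) * m * (1 + y) - 1) / ((1 + x) * (1 + y)) := by
      field_simp
      ring
    rw [← sub_pos, this]
    have : 0 < (1 + x) * m * (1 + y) - 1 := by nlinarith [hx.2, hy.1]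
    have : 0 < y - x := by linarith
    positivity
  have himg : (fun r => arsinh (√(r * (m - 1 / (1 + r))) / 2)) '' S = Set.Ioi 0 := by
    ext u
    constructor
    · rintro ⟨r, hr, rfl⟩
      exact arsinh_pos_iff.2 (div_pos (Real.sqrt_pos.2 (mul_pos hr.1 (hpos r hr))) two_pos)
    · intro hu
      have hsu : 0 < sinh u := sinh_pos_iff.2 hu
      set n := 4 * sinh u ^ 2 with hn
      have hn0 : 0 < n := by positivity
      set s := √((1 + n - m) ^ 2 + 4 * m * n) with hs
      have hs2 : s ^ 2 = (1 + n - m) ^ 2 + 4 * m * n := Real.sq_sqrt (by positivity)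
      have hsl : |1 + n - m| < s := by
        rw [← Real.sqrt_sq_eq_abs]
        exact Real.sqrt_lt_sqrt (by positivity) (by nlinarith [mul_pos hm hn0])
      set r := ((1 + n - m) + s) / (2 * m) with hr
      have hr0 : 0 < r := div_pos (by linarith [neg_abs_le (1 + n - m)]) (by positivity)
      have hq : m * r ^ 2 + (m - 1 - n) * r - n = 0 := by
        rw [hr]
        field_simp
        linear_combination hs2
      have h1 : 0 < 1 + r := by linarith
      have he : r * (m - 1 / (1 + r)) = n := by
        field_simp
        linarith
      refine ⟨r, ⟨hr0, ?_⟩, ?_⟩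
      · have : 0 < m - 1 / (1 + r) := by
          by_contra! h
          nlinarith
        rw [sub_pos, div_lt_iff₀ h1] at this
        linarith
      · simp only
        rw [he, hn, show (4 : ℝ) * sinh u ^ 2 = (2 * sinh u) ^ 2 by ring,
          Real.sqrt_sq (by positivity), mul_div_cancel_left₀ _ two_ne_zero, arsinh_sinh]
  rw [← himg, lintegral_image_eq_lintegral_abs_deriv_mul hSm hder hinj]
  refine setLIntegral_congr_fun hSm fun r hr => ?_
  have h0 := hpos r hr
  have h1 := hpos' r hr
  have hr0 := hr.1
  have h2 : 0 < 1 + r := by linarith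
  simp only [sinh_arsinh]
  rw [← ENNReal.ofReal_mul (abs_nonneg _)]
  congr 1
  have hn : 0 < r * (m - 1 / (1 + r)) := mul_pos hr0 h0
  rw [div_pow, Real.sq_sqrt hn.le, show 4 * (r * (m - 1 / (1 + r)) / 2 ^ 2) = r * (m - 1 / (1 + r)) by ring]
  have hD : quadDisc m (r * (m - 1 / (1 + r))) = ((1 + r) * (m - 1 / (1 + r) ^ 2)) ^ 2 := by
    unfold quadDisc
    field_simp
    ring
  have e1 : 1 + r * (m - 1 / (1 + r)) / 2 ^ 2 =
      (r * (m - 1 / (1 + r) + 4 / r)) / 2 ^ 2 := by field_simp; ring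
  have h3 : 0 < m - 1 / (1 + r) + 4 / r := by positivity
  rw [hD, Real.sqrt_sq (by positivity), e1, Real.sqrt_div' _ (by positivity),
    Real.sqrt_sq (by norm_num), Real.sqrt_mul hr0.le, Real.sqrt_mul hr0.le,
    Real.sqrt_mul h0.le, abs_of_pos (by positivity)]
  have hrs : √r * √r = r := Real.mul_self_sqrt hr0.le
  have p1 : 0 < √(m - 1 / (1 + r)) := Real.sqrt_pos.2 h0
  have p2 : 0 < √(m - 1 / (1 + r) + 4 / r) := Real.sqrt_pos.2 h3
  have p3 : 0 < √r := Real.sqrt_pos.2 hr0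
  generalize √(m - 1 / (1 + r)) = A at *
  generalize √(m - 1 / (1 + r) + 4 / r) = B at *
  generalize m - 1 / (1 + r) ^ 2 = C at *
  field_simp
  rw [sq, hrs]

lemma ellK_continuousOn : ContinuousOn ellK (Set.Iio 1) := by
  have h : ContinuousOn (fun m : ℝ => ellF (1 - 2 * m)) (Set.Iio 1) :=
    continuousOn_ellF.comp (by fun_prop) fun m hm => by
      have : m < 1 := hm
      change -1 < 1 - 2 * m
      linarith
  refine h.congr fun m _ => ?_
  unfold ellF
  congr 1
  ring

lemma ellK_base_pos {m : ℝ} (hm : m < 1) (θ : ℝ) : 0 < 1 - m * sin θ ^ 2 := by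
  have := legendre_base_pos (z := 1 - 2 * m) (by linarith) θ
  rwa [show (1 - (1 - 2 * m)) / 2 = m by ring] at this

lemma ellK_pos {m : ℝ} (hm : m < 1) : 0 < ellK m := by
  have := ellF_pos (z := 1 - 2 * m) (by linarith)
  unfold ellF at this
  rwa [show (1 - (1 - 2 * m)) / 2 = m by ring] at this

lemma ofReal_ellK {m : ℝ} (hm : m < 1) : ENNReal.ofReal (ellK m) =
    ∫⁻ ψ in Set.Ioo 0 (π / 2), ENNReal.ofReal (1 / √(1 - m * sin ψ ^ 2)) := by
  have hc : Continuous fun ψ => 1 / √(1 - m * sin ψ ^ 2) :=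
    continuous_const.div (by fun_prop) fun ψ => (Real.sqrt_pos.2 (ellK_base_pos hm ψ)).ne'
  rw [ellK, intervalIntegral.integral_of_le (by positivity), integral_Ioc_eq_integral_Ioo,
    ofReal_integral_eq_lintegral_ofReal]
  · exact (hc.integrableOn_Icc (a := 0) (b := π / 2)).mono_set Set.Ioo_subset_Icc_self
  · exact Eventually.of_forall fun ψ => by positivity

lemma lintegral_angle_substitution {r : ℝ} (hr : 0 < r) :
    ∫⁻ φ in {φ : ℝ | φ ∈ Set.Ioo 0 π ∧ 1 < (1 + r) * (2 + 2 * cos φ)},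
      ENNReal.ofReal (1 / √((2 + 2 * cos φ - 1 / (1 + r)) * (2 + 2 * cos φ - 1 / (1 + r) + 4 / r)))
      = ENNReal.ofReal (√r / 2 * ellK (3 / 4 + r / (16 * (1 + r) ^ 2))) := by
  have h1r : 0 < 1 + r := by linarith
  set c := √(3 + 4 * r) with hc
  have hc0 : 0 < c := Real.sqrt_pos.2 (by positivity)
  have hc2 : c ^ 2 = 3 + 4 * r := Real.sq_sqrt (by positivity)
  have hcos : ∀ s : ℝ, 2 + 2 * cos (2 * arctan s) = 4 / (1 + s ^ 2) := fun s => by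
    rw [cos_two_mul, cos_sq_arctan]
    ring
  have hM : 3 / 4 + r / (16 * (1 + r) ^ 2) < 1 := by
    have : r / (16 * (1 + r) ^ 2) < 1 / 4 := by
      rw [div_lt_div_iff₀ (by positivity) (by norm_num)]
      nlinarith
    linarith
  have hder : ∀ ψ ∈ Set.Ioo 0 (π / 2), HasDerivWithinAt (fun ψ => 2 * arctan (c * cos ψ))
      (2 * (1 / (1 + (c * cos ψ) ^ 2) * (c * -sin ψ))) (Set.Ioo 0 (π / 2)) ψ := fun ψ _ =>
    ((((hasDerivAt_cos ψ).const_mul c).arctan).const_mul 2).hasDerivWithinAt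
  have hinj : Set.InjOn (fun ψ => 2 * arctan (c * cos ψ)) (Set.Ioo 0 (π / 2)) := by
    intro x hx y hy hxy
    have h := arctan_injective (mul_left_cancel₀ two_ne_zero hxy)
    exact injOn_cos ⟨hx.1.le, by linarith [hx.2, pi_pos]⟩ ⟨hy.1.le, by linarith [hy.2, pi_pos]⟩
      (mul_left_cancel₀ hc0.ne' h)
  have himg : (fun ψ => 2 * arctan (c * cos ψ)) '' Set.Ioo 0 (π / 2) =
      {φ : ℝ | φ ∈ Set.Ioo 0 π ∧ 1 < (1 + r) * (2 + 2 * cos φ)} := by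
    ext φ
    constructor
    · rintro ⟨ψ, hψ, rfl⟩
      have hcp := cos_pos_of_mem_Ioo_zero hψ
      have hs := sin_pos_of_pos_of_lt_pi hψ.1 (by linarith [hψ.2, pi_pos])
      refine ⟨⟨?_, ?_⟩, ?_⟩
      · have := arctan_pos.2 (mul_pos hc0 hcp)
        simp only
        linarith
      · have := arctan_lt_pi_div_two (c * cos ψ)
        simp only
        linarith
      · rw [hcos, mul_div_assoc', lt_div_iff₀ (by positivity), mul_pow, hc2]
        have := sin_sq_add_cos_sq ψ
        nlinarith [sq_pos_of_pos hs]
    · rintro ⟨⟨h0, hpi⟩, h1⟩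
      have hs : 0 < tan (φ / 2) := tan_pos_of_pos_of_lt_pi_div_two (by linarith) (by linarith)
      have hφ : φ = 2 * arctan (tan (φ / 2)) := by
        rw [arctan_tan (by linarith) (by linarith)]; ring
      rw [hφ, hcos, mul_div_assoc', lt_div_iff₀ (by positivity)] at h1
      have hlt : tan (φ / 2) < c := by
        refine lt_of_pow_lt_pow_left₀ 2 hc0.le ?_
        linarith
      have hd : tan (φ / 2) / c < 1 := (div_lt_one hc0).2 hlt
      have hd0 : 0 < tan (φ / 2) / c := by positivity
      refine ⟨arccos (tan (φ / 2) / c), ⟨arccos_pos.2 hd, arccos_lt_pi_div_two.2 hd0⟩, ?_⟩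
      simp only
      rw [cos_arccos (by linarith) hd.le, mul_div_cancel₀ _ hc0.ne', ← hφ]
  rw [← himg, lintegral_image_eq_lintegral_abs_deriv_mul measurableSet_Ioo hder hinj,
    ENNReal.ofReal_mul (by positivity), ofReal_ellK hM,
    ← lintegral_const_mul' _ _ ENNReal.ofReal_ne_top]
  refine setLIntegral_congr_fun measurableSet_Ioo fun ψ hψ => ?_
  have hcp := cos_pos_of_mem_Ioo_zero hψ
  have hs := sin_pos_of_pos_of_lt_pi hψ.1 (by linarith [hψ.2, pi_pos])
  have hb := ellK_base_pos hM ψ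
  rw [← ENNReal.ofReal_mul (abs_nonneg _), ← ENNReal.ofReal_mul (by positivity), hcos]
  congr 1
  have hsc := cos_sq' ψ
  have e1 : 4 / (1 + (c * cos ψ) ^ 2) - 1 / (1 + r) =
      (c * sin ψ) ^ 2 / ((1 + r) * (1 + (c * cos ψ) ^ 2)) := by
    rw [mul_pow, mul_pow, hc2, hsc]
    have : 0 < 1 + (3 + 4 * r) * (1 - sin ψ ^ 2) := by rw [← hsc]; positivity
    field_simp
    ring
  have e2 : (c * sin ψ) ^ 2 / ((1 + r) * (1 + (c * cos ψ) ^ 2)) + 4 / r =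
      (16 * (1 + r) ^ 2) * (1 - (3 / 4 + r / (16 * (1 + r) ^ 2)) * sin ψ ^ 2) /
        (r * ((1 + r) * (1 + (c * cos ψ) ^ 2))) := by
    rw [mul_pow, mul_pow, hc2, hsc]
    have : 0 < 1 + (3 + 4 * r) * (1 - sin ψ ^ 2) := by rw [← hsc]; positivity
    field_simp
    ring
  have e3 : (c * sin ψ) ^ 2 / ((1 + r) * (1 + (c * cos ψ) ^ 2)) *
      ((16 * (1 + r) ^ 2) * (1 - (3 / 4 + r / (16 * (1 + r) ^ 2)) * sin ψ ^ 2) /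
        (r * ((1 + r) * (1 + (c * cos ψ) ^ 2)))) =
      (4 * (c * sin ψ) / (1 + (c * cos ψ) ^ 2)) ^ 2 *
        ((1 - (3 / 4 + r / (16 * (1 + r) ^ 2)) * sin ψ ^ 2) / r) := by
    field_simp
    ring
  rw [e1, e2, e3, Real.sqrt_mul (by positivity), Real.sqrt_sq (by positivity),
    Real.sqrt_div hb.le, show 2 * (1 / (1 + (c * cos ψ) ^ 2) * (c * -sin ψ)) =
      -(2 * (c * sin ψ) / (1 + (c * cos ψ) ^ 2)) by ring, abs_neg, abs_of_pos (by positivity)]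
  have p1 := Real.sqrt_pos.2 hb
  have p2 := Real.sqrt_pos.2 hr
  generalize √(1 - (3 / 4 + r / (16 * (1 + r) ^ 2)) * sin ψ ^ 2) = A at *
  field_simp
  norm_num

lemma lintegral_modulus :
    ∫⁻ r in Set.Ioi (0 : ℝ), ENNReal.ofReal (1 / (2 * r * (1 + r)) *
      (√r / 2 * ellK (3 / 4 + r / (16 * (1 + r) ^ 2)))) =
    ENNReal.ofReal (1 / 4 * ∫ ω in (0 : ℝ)..π, ellK (97 / 128 - cos ω / 128)) := by
  have hc : Continuous fun ω => ellK (97 / 128 - cos ω / 128) := by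
    rw [← continuousOn_univ]
    refine ellK_continuousOn.comp (by fun_prop) fun ω _ => ?_
    change 97 / 128 - cos ω / 128 < 1
    linarith [neg_one_le_cos ω]
  have himg : (fun χ => tan χ ^ 2) '' Set.Ioo 0 (π / 2) = Set.Ioi 0 := by
    have : (fun x : ℝ => x ^ 2) '' Set.Ioi 0 = Set.Ioi 0 := by
      ext x
      constructor
      · rintro ⟨y, hy, rfl⟩
        exact pow_pos (show 0 < y from hy) 2
      · intro hx
        exact ⟨√x, Real.sqrt_pos.2 hx, Real.sq_sqrt (le_of_lt hx)⟩
    rw [← this, ← tan_image_Ioo, Set.image_image]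
  have htan : ∀ χ ∈ Set.Ioo 0 (π / 2), 0 < tan χ := fun χ hχ =>
    tan_pos_of_pos_of_lt_pi_div_two hχ.1 hχ.2
  have hinj : Set.InjOn (fun χ => tan χ ^ 2) (Set.Ioo 0 (π / 2)) := by
    intro x hx y hy hxy
    have := (pow_left_inj₀ (htan x hx).le (htan y hy).le two_ne_zero).1 hxy
    exact injOn_tan ⟨by linarith [hx.1, pi_pos], hx.2⟩ ⟨by linarith [hy.1, pi_pos], hy.2⟩ this
  have hder : ∀ χ ∈ Set.Ioo 0 (π / 2), HasDerivWithinAt (fun χ => tan χ ^ 2)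
      (2 * tan χ * (1 / cos χ ^ 2)) (Set.Ioo 0 (π / 2)) χ := fun χ hχ => by
    refine (((hasDerivAt_tan (cos_pos_of_mem_Ioo_zero hχ).ne').pow 2).congr_deriv
      ?_).hasDerivWithinAt
    norm_num
  have hlast : 1 / 4 * ∫ ω in (0 : ℝ)..π, ellK (97 / 128 - cos ω / 128) =
      ∫ χ in (0 : ℝ)..(π / 2), 1 / 2 * ellK (97 / 128 - cos (4 * χ) / 128) := by
    rw [intervalIntegral.integral_const_mul, intervalIntegral.integral_comp_mul_left
      (fun ω => ellK (97 / 128 - cos ω / 128)) (by norm_num), mul_zero,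
      show 4 * (π / 2) = 2 * π by ring,
      ← intervalIntegral.integral_add_adjacent_intervals (hc.intervalIntegrable 0 π)
        (hc.intervalIntegrable π (2 * π))]
    have := intervalIntegral.integral_comp_sub_left (a := 0) (b := π)
      (fun ω => ellK (97 / 128 - cos ω / 128)) (2 * π)
    simp only [cos_two_pi_sub, sub_zero, show 2 * π - π = π by ring] at this
    rw [← this, smul_eq_mul]
    ring
  have hc4 : Continuous fun χ => 1 / 2 * ellK (97 / 128 - cos (4 * χ) / 128) :=
    (hc.comp (by fun_prop : Continuous fun χ : ℝ => 4 * χ)).const_mul _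
  rw [hlast, intervalIntegral.integral_of_le (by positivity), integral_Ioc_eq_integral_Ioo,
    ofReal_integral_eq_lintegral_ofReal, ← himg,
    lintegral_image_eq_lintegral_abs_deriv_mul measurableSet_Ioo hder hinj]
  · refine setLIntegral_congr_fun measurableSet_Ioo fun χ hχ => ?_
    have ht := htan χ hχ
    have hcp := cos_pos_of_mem_Ioo_zero hχ
    rw [← ENNReal.ofReal_mul (abs_nonneg _)]
    congr 1
    have h1 : 1 + tan χ ^ 2 = 1 / cos χ ^ 2 := by
      rw [tan_eq_sin_div_cos]
      field_simp
      linarith [sin_sq_add_cos_sq χ]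
    have e : 3 / 4 + tan χ ^ 2 / (16 * (1 + tan χ ^ 2) ^ 2) = 97 / 128 - cos (4 * χ) / 128 := by
      have h2 : tan χ ^ 2 / (16 * (1 + tan χ ^ 2) ^ 2) = (sin χ * cos χ) ^ 2 / 16 := by
        rw [h1, tan_eq_sin_div_cos]
        field_simp
      rw [h2, show 4 * χ = 2 * (2 * χ) by ring, cos_two_mul, cos_two_mul, mul_pow, sin_sq]
      ring
    rw [e, abs_of_pos (by positivity), Real.sqrt_sq ht.le, h1]
    field_simp
  · exact (hc4.integrableOn_Icc (a := 0) (b := π / 2)).mono_set Set.Ioo_subset_Icc_self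
  · refine Eventually.of_forall fun χ => ?_
    have := ellK_pos (m := 97 / 128 - cos (4 * χ) / 128) (by linarith [neg_one_le_cos (4 * χ)])
    positivity

/-- The double integral of the discriminant. -/
theorem lintegral_quadDisc :
    ∫⁻ u in Set.Ioi (0 : ℝ), ∫⁻ φ in Set.Ioo 0 π,
      ENNReal.ofReal (1 / √(quadDisc (2 + 2 * cos φ) (4 * sinh u ^ 2))) =
    ENNReal.ofReal (1 / 4 * ∫ ω in (0 : ℝ)..π, ellK (97 / 128 - cos ω / 128)) := by
  rw [lintegral_lintegral_swap (by
    unfold quadDisc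
    exact Measurable.aemeasurable (by fun_prop))]
  let T : ℝ → ℝ → ENNReal := fun φ r => Set.indicator
    {p : ℝ × ℝ | 1 < (1 + p.2) * (2 + 2 * cos p.1)} (fun p => ENNReal.ofReal (1 / (2 * p.2 * (1 + p.2)) *
        (1 / √((2 + 2 * cos p.1 - 1 / (1 + p.2)) * (2 + 2 * cos p.1 - 1 / (1 + p.2) + 4 / p.2)))))
        (φ, r)
  have hset : MeasurableSet {p : ℝ × ℝ | 1 < (1 + p.2) * (2 + 2 * cos p.1)} :=
    measurableSet_lt measurable_const (by fun_prop)
  have hT : Measurable (Function.uncurry T) :=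
    Measurable.indicator (by fun_prop) hset
  have h1 : ∀ φ ∈ Set.Ioo 0 π, ∫⁻ u in Set.Ioi (0 : ℝ),
      ENNReal.ofReal (1 / √(quadDisc (2 + 2 * cos φ) (4 * sinh u ^ 2))) =
      ∫⁻ r in Set.Ioi 0, T φ r := fun φ hφ => by
    have hm : 0 < 2 + 2 * cos φ := by
      have := cos_lt_cos_of_nonneg_of_le_pi hφ.1.le le_rfl hφ.2
      rw [cos_pi] at this
      linarith
    rw [lintegral_sinh_substitution hm]
    have hs2 : MeasurableSet {r : ℝ | 1 < (1 + r) * (2 + 2 * cos φ)} :=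
      measurableSet_lt measurable_const (by fun_prop)
    have : {r : ℝ | 0 < r ∧ 1 < (1 + r) * (2 + 2 * cos φ)} =
        {r : ℝ | 1 < (1 + r) * (2 + 2 * cos φ)} ∩ Set.Ioi 0 := by
      ext r; simp [and_comm]
    rw [this, ← Measure.restrict_restrict hs2, ← lintegral_indicator hs2]
    rfl
  rw [setLIntegral_congr_fun measurableSet_Ioo h1, lintegral_lintegral_swap hT.aemeasurable,
    ← lintegral_modulus]
  refine setLIntegral_congr_fun measurableSet_Ioi fun r hr => ?_
  have hr0 : 0 < r := hr
  have hs2 : MeasurableSet {φ : ℝ | 1 < (1 + r) * (2 + 2 * cos φ)} :=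
    measurableSet_lt measurable_const (by fun_prop)
  rw [ENNReal.ofReal_mul (by positivity), ← lintegral_angle_substitution hr0]
  have : {φ : ℝ | φ ∈ Set.Ioo 0 π ∧ 1 < (1 + r) * (2 + 2 * cos φ)} =
      {φ : ℝ | 1 < (1 + r) * (2 + 2 * cos φ)} ∩ Set.Ioo 0 π := by
    ext φ; simp [and_comm]
  rw [this, ← Measure.restrict_restrict hs2, ← lintegral_const_mul' _ _ ENNReal.ofReal_ne_top,
    ← lintegral_indicator hs2]
  refine lintegral_congr fun φ => ?_
  simp only [T, Set.indicator_apply, Set.mem_ofPred_eq]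
  split_ifs
  · rw [← ENNReal.ofReal_mul (by positivity)]
  · rfl

/-- The modified Bessel function `I₀`. -/
noncomputable def besselI (z : ℂ) : ℂ :=
  1 / (2 * π) * ∫ θ in (-π)..π, Complex.exp (z * (cos θ : ℝ))

/-- `I₀` on the real line, as a real number. -/
noncomputable def besselIR (x : ℝ) : ℝ := 1 / (2 * π) * ∫ θ in (-π)..π, exp (x * cos θ)

/-- The Bessel function `J₀`. -/
noncomputable def besselJ (x : ℝ) : ℝ := 1 / (2 * π) * ∫ θ in (-π)..π, cos (x * cos θ)

lemma besselI_ofReal (x : ℝ) : besselI x = besselIR x := by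
  unfold besselI besselIR
  push_cast
  rw [← intervalIntegral.integral_ofReal]
  push_cast
  rfl

lemma besselI_I_mul (x : ℝ) : besselI (Complex.I * x) = besselJ x := by
  have hs : ∫ θ in (-π)..π, sin (x * cos θ) = 0 := by
    have h1 : ∫ θ in (-π)..0, sin (x * cos θ) = - ∫ θ in (0 : ℝ)..π, sin (x * cos θ) := by
      have := intervalIntegral.integral_comp_sub_right (fun θ => sin (x * cos θ)) π (a := 0) (b := π)
      rw [sub_self, zero_sub] at this
      rw [← this, ← intervalIntegral.integral_neg]
      simp [cos_sub_pi]
    rw [← intervalIntegral.integral_add_adjacent_intervals (b := 0)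
      (Continuous.intervalIntegrable (by fun_prop) _ _)
      (Continuous.intervalIntegrable (by fun_prop) _ _), h1]
    ring
  have h : ∫ θ in (-π)..π, Complex.exp (Complex.I * x * (cos θ : ℝ)) =
      ((∫ θ in (-π)..π, cos (x * cos θ) : ℝ) : ℂ) +
        ((∫ θ in (-π)..π, sin (x * cos θ) : ℝ) : ℂ) * Complex.I := by
    rw [← intervalIntegral.integral_ofReal, ← intervalIntegral.integral_ofReal,
      ← intervalIntegral.integral_mul_const, ← intervalIntegral.integral_add
      (Continuous.intervalIntegrable (by fun_prop) _ _)
      (Continuous.intervalIntegrable (by fun_prop) _ _)]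
    congr 1
    ext θ
    rw [show Complex.I * x * (cos θ : ℝ) = ((x * cos θ : ℝ) : ℂ) * Complex.I by push_cast; ring,
      Complex.exp_mul_I, ← Complex.ofReal_cos, ← Complex.ofReal_sin]
  rw [besselI, h, hs, besselJ]
  push_cast
  ring

lemma norm_besselI_le (z : ℂ) : ‖besselI z‖ ≤ exp |z.re| := by
  have h : ‖∫ θ in (-π)..π, Complex.exp (z * (cos θ : ℝ))‖ ≤ exp |z.re| * |π - -π| := by
    refine intervalIntegral.norm_integral_le_of_norm_le_const fun θ _ => ?_
    rw [Complex.norm_exp, Complex.re_mul_ofReal]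
    refine exp_le_exp.2 ((le_abs_self _).trans ?_)
    rw [abs_mul]
    exact mul_le_of_le_one_right (abs_nonneg _) (abs_cos_le_one θ)
  rw [besselI, norm_mul]
  have h2 : ‖(1 / (2 * π) : ℂ)‖ = 1 / (2 * π) := by
    rw [show (1 / (2 * π) : ℂ) = ((1 / (2 * π) : ℝ) : ℂ) by push_cast; rfl, Complex.norm_real,
      norm_of_nonneg (by positivity)]
  rw [h2]
  rw [show |π - -π| = 2 * π by rw [abs_of_pos] <;> linarith [pi_pos]] at h
  calc _ ≤ 1 / (2 * π) * (exp |z.re| * (2 * π)) := by gcongr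
    _ = _ := by field_simp

lemma abs_besselJ_le (x : ℝ) : |besselJ x| ≤ 1 := by
  have := norm_besselI_le (Complex.I * x)
  rw [besselI_I_mul, Complex.norm_real] at this
  simpa using this

lemma differentiable_besselI : Differentiable ℂ besselI := by
  intro z
  unfold besselI
  refine DifferentiableAt.const_mul ?_ _
  refine ((intervalIntegral.hasDerivAt_integral_of_dominated_loc_of_deriv_le
    (F := fun z θ => Complex.exp (z * (cos θ : ℝ)))
    (F' := fun z θ => Complex.exp (z * (cos θ : ℝ)) * (cos θ : ℝ)) (x₀ := z)
    (bound := fun _ => exp (‖z‖ + 1)) (Metric.ball_mem_nhds z one_pos)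
    ?_ ?_ ?_ ?_ ?_ ?_).2).differentiableAt
  · exact Eventually.of_forall fun w => Continuous.aestronglyMeasurable (by fun_prop)
  · exact Continuous.intervalIntegrable (by fun_prop) _ _
  · exact Continuous.aestronglyMeasurable (by fun_prop)
  · refine Eventually.of_forall fun θ _ w hw => ?_
    rw [norm_mul, Complex.norm_exp, Complex.re_mul_ofReal, Complex.norm_real]
    have h1 : w.re * cos θ ≤ ‖z‖ + 1 := by
      refine (le_abs_self _).trans ?_
      rw [abs_mul]
      refine (mul_le_of_le_one_right (abs_nonneg _) (abs_cos_le_one θ)).trans ?_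
      refine (Complex.abs_re_le_norm w).trans ?_
      have : ‖w - z‖ < 1 := by simpa [dist_eq_norm] using hw
      have := norm_sub_norm_le w z
      linarith
    calc _ ≤ exp (‖z‖ + 1) * 1 := by
          gcongr
          exact abs_cos_le_one θ
      _ = _ := mul_one _
  · exact intervalIntegrable_const
  · refine Eventually.of_forall fun θ _ w _ => ?_
    have := ((hasDerivAt_id w).mul_const ((cos θ : ℝ) : ℂ)).cexp
    simpa using this

lemma besselIR_pos (x : ℝ) : 0 < besselIR x := by
  refine mul_pos (by positivity) ?_
  exact intervalIntegral.intervalIntegral_pos_of_pos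
    (Continuous.intervalIntegrable (by fun_prop) _ _) (fun _ => exp_pos _) (by linarith [pi_pos])

lemma continuous_besselIR : Continuous besselIR := by
  have : Continuous fun x : ℝ => (besselI x).re :=
    Complex.continuous_re.comp (differentiable_besselI.continuous.comp Complex.continuous_ofReal)
  simpa [besselI_ofReal] using this

lemma continuous_besselJ : Continuous besselJ := by
  have : Continuous fun x : ℝ => (besselI (Complex.I * x)).re :=
    Complex.continuous_re.comp (differentiable_besselI.continuous.comp (by fun_prop))
  simpa [besselI_I_mul] using this

lemma integrable_mul_exp_quadratic {p : ℝ} (hp : 0 < p) (c : ℝ) :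
    Integrable (fun t : ℝ => t * exp (-p * t ^ 2 + c * t)) := by
  have h (d : ℝ) : Integrable (fun t : ℝ => exp (-p * t ^ 2 + d * t)) := by
    have := (GaussianFourier.integrable_cexp_neg_mul_sq_norm_add (V := ℝ) (b := p) (by simpa using hp) d 1).norm
    refine this.congr (Eventually.of_forall fun t => ?_)
    simp only [Complex.norm_exp]
    congr 1
    simp [← Complex.ofReal_pow]
  refine ((h (c + 1)).add (h (c - 1))).mono' (Continuous.aestronglyMeasurable (by fun_prop))
    (Eventually.of_forall fun t => ?_)
  rw [norm_mul, norm_eq_abs, norm_of_nonneg (exp_pos _).le, Pi.add_apply,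
    show -p * t ^ 2 + (c + 1) * t = (-p * t ^ 2 + c * t) + t by ring,
    show -p * t ^ 2 + (c - 1) * t = (-p * t ^ 2 + c * t) + -t by ring, exp_add _ t, exp_add _ (-t)]
  have h1 := add_one_le_exp t
  have h2 := add_one_le_exp (-t)
  have h3 := exp_pos t
  have h4 := exp_pos (-t)
  have h5 : |t| ≤ exp t + exp (-t) := abs_le.2 ⟨by linarith, by linarith⟩
  nlinarith [exp_pos (-p * t ^ 2 + c * t)]

theorem integral_mul_besselI_mul_exp {p : ℝ} (hp : 0 < p) (c : ℂ) :
    ∫ t in Set.Ioi (0 : ℝ), t * besselI (c * t) * Complex.exp (-p * t ^ 2) =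
      Complex.exp (c ^ 2 / (4 * p)) / (2 * p) := by
  have h := GaussianFourier.integral_cexp_neg_mul_sq_norm_add (V := ℂ) (b := p)
    (by simpa using hp) c 1
  rw [← Complex.integral_comp_polarCoord_symm, polarCoord_target, Measure.volume_eq_prod,
    setIntegral_prod] at h
  · have h2 : ∀ t ∈ Set.Ioi (0 : ℝ), ∫ θ in Set.Ioo (-π) π, t •
        Complex.exp (-p * ‖Complex.polarCoord.symm (t, θ)‖ ^ 2 +
          c * (inner ℝ (1 : ℂ) (Complex.polarCoord.symm (t, θ)) : ℝ)) =
        2 * π * (t * besselI (c * t) * Complex.exp (-p * t ^ 2)) := by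
      intro t ht
      rw [besselI, ← integral_Ioc_eq_integral_Ioo,
        ← intervalIntegral.integral_of_le (by linarith [pi_pos]), intervalIntegral.integral_smul]
      have : ∀ θ : ℝ, Complex.exp (-p * ‖Complex.polarCoord.symm (t, θ)‖ ^ 2 +
          c * (inner ℝ (1 : ℂ) (Complex.polarCoord.symm (t, θ)) : ℝ)) =
          Complex.exp (-p * t ^ 2) * Complex.exp (c * t * (cos θ : ℝ)) := by
        intro θ
        rw [Complex.norm_polarCoord_symm, ← Complex.exp_add, abs_of_pos ht]
        congr 2
        simp [Complex.inner, Complex.cos_ofReal_re, mul_assoc]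
      simp_rw [this, intervalIntegral.integral_const_mul]
      have : (π : ℂ) ≠ 0 := by exact_mod_cast pi_pos.ne'
      rw [Complex.real_smul]
      field_simp
    rw [setIntegral_congr_fun measurableSet_Ioi h2, integral_const_mul] at h
    have hπ : (π : ℂ) ≠ 0 := by exact_mod_cast pi_pos.ne'
    have hp' : (p : ℂ) ≠ 0 := by exact_mod_cast hp.ne'
    have h3 : (Module.finrank ℝ ℂ / 2 : ℂ) = 1 := by simp
    rw [h3, Complex.cpow_one] at h
    simp only [norm_one, Complex.ofReal_one, one_pow, mul_one] at h
    generalize (∫ t in Set.Ioi (0 : ℝ), t * besselI (c * t) * Complex.exp (-p * t ^ 2)) = J at h ⊢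
    field_simp at h ⊢
    linear_combination h
  · have h1 : IntegrableOn (fun z : ℝ × ℝ => (z.1 * exp (-p * z.1 ^ 2 + ‖c‖ * z.1)) * 1)
        (Set.Ioi 0 ×ˢ Set.Ioo (-π) π) (volume.prod volume) := by
      rw [IntegrableOn, ← Measure.prod_restrict]
      refine Integrable.mul_prod (f := fun t : ℝ => t * exp (-p * t ^ 2 + ‖c‖ * t))
        (g := fun _ => (1 : ℝ)) (integrable_mul_exp_quadratic hp _).integrableOn ?_
      simp
    refine Integrable.mono' h1 ?_ ?_
    · refine Continuous.aestronglyMeasurable ?_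
      simp only [Complex.polarCoord_symm_apply]
      fun_prop
    · refine (ae_restrict_iff' (measurableSet_Ioi.prod measurableSet_Ioo)).2
        (Eventually.of_forall fun z hz => ?_)
      have hz1 : 0 < z.1 := hz.1
      rw [norm_smul, norm_of_nonneg hz1.le, Complex.norm_exp, mul_one]
      refine mul_le_mul_of_nonneg_left (exp_le_exp.2 ?_) hz1.le
      rw [Complex.norm_polarCoord_symm, abs_of_pos hz1, Complex.add_re, Complex.re_mul_ofReal,
        ← Complex.ofReal_pow, Complex.re_mul_ofReal]
      simp only [Complex.neg_re, Complex.ofReal_re]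
      refine add_le_add le_rfl ((le_abs_self _).trans ?_)
      rw [abs_mul]
      refine mul_le_mul (Complex.abs_re_le_norm c) ?_ (abs_nonneg _) (norm_nonneg _)
      rw [← norm_eq_abs]
      refine (norm_inner_le_norm _ _).trans ?_
      rw [Complex.norm_polarCoord_symm, abs_of_pos hz1]
      simp

lemma lintegral_Ioi_eq_lintegral_exp (f : ℝ → ENNReal) :
    ∫⁻ x in Set.Ioi 0, f x = ∫⁻ u, ENNReal.ofReal (exp u) * f (exp u) := by
  have := lintegral_image_eq_lintegral_abs_deriv_mul MeasurableSet.univ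
    (fun x _ => (hasDerivAt_exp x).hasDerivWithinAt) exp_injective.injOn f
  rw [Set.image_univ, range_exp, Measure.restrict_univ] at this
  simpa [abs_of_pos (exp_pos _)] using this

/-- The two-sided exponential integral `∫ exp (-(p eᵘ + q e⁻ᵘ)) du`. -/
noncomputable def besselKE (p q : ℝ) : ENNReal :=
  ∫⁻ u : ℝ, ENNReal.ofReal (exp (-(p * exp u + q * exp (-u))))

/-- The modified Bessel function `K₀` on the positive real line. -/
noncomputable def besselK (x : ℝ) : ℝ := ∫ u in Set.Ioi (0 : ℝ), exp (-x * cosh u)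

lemma besselKE_shift (p q s : ℝ) : besselKE (p * exp s) (q * exp (-s)) = besselKE p q := by
  rw [besselKE, besselKE, ← lintegral_add_right_eq_self
    (fun u => ENNReal.ofReal (exp (-(p * exp u + q * exp (-u))))) s]
  simp_rw [neg_add, exp_add]
  congr 1
  ext u
  congr 3 <;> ring

lemma measurable_besselKE : Measurable fun z : ℝ × ℝ => besselKE z.1 z.2 := by
  unfold besselKE
  refine Measurable.lintegral_prod_right' (f := fun w : (ℝ × ℝ) × ℝ =>
    ENNReal.ofReal (exp (-(w.1.1 * exp w.2 + w.1.2 * exp (-w.2))))) ?_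
  exact ENNReal.measurable_ofReal.comp (Continuous.measurable (by fun_prop))

lemma besselKE_eq {p q : ℝ} (hp : 0 < p) (r : ℝ) (hr : 0 < r) (hq : 0 < q) :
    besselKE p q = besselKE r (p * q / r) := by
  rw [← besselKE_shift r (p * q / r) (log (p / r)), exp_neg, exp_log (by positivity)]
  congr 1 <;> field_simp

lemma exp_neg_le_rpow {x : ℝ} (hx : 0 < x) : exp (-x) ≤ x ^ (-(1 / 4) : ℝ) := by
  rw [rpow_neg hx.le, exp_neg]
  refine inv_anti₀ (by positivity) ?_
  have h := add_one_le_exp (4 * x)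
  calc x ^ (1 / 4 : ℝ) ≤ exp (4 * x) ^ (1 / 4 : ℝ) :=
        rpow_le_rpow hx.le (by linarith) (by norm_num)
    _ = exp x := by rw [← exp_mul]; congr 1; ring

lemma exp_neg_mul_cosh_le {x : ℝ} (hx : 0 < x) (u : ℝ) :
    exp (-x * cosh u) ≤ exp (-x / 2) * (x / 4) ^ (-(1 / 4) : ℝ) * exp (-(1 / 4) * u) := by
  have h1 : exp (-x * cosh u) = exp (-(x / 2) * cosh u) * exp (-(x / 2 * cosh u)) := by
    rw [← exp_add]; congr 1; ring
  have h2 : exp (-(x / 2) * cosh u) ≤ exp (-x / 2) :=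
    exp_le_exp.2 (by nlinarith [one_le_cosh u])
  have h3 : exp (-(x / 2 * cosh u)) ≤ (x / 4) ^ (-(1 / 4) : ℝ) * exp (-(1 / 4) * u) := by
    refine (exp_neg_le_rpow (mul_pos (by positivity) (cosh_pos u))).trans ?_
    rw [show -(1 / 4) * u = u * (-(1 / 4)) by ring, exp_mul, ← mul_rpow (by positivity)
      (exp_pos u).le]
    refine rpow_le_rpow_of_nonpos (by positivity) ?_ (by norm_num)
    rw [cosh_eq]
    nlinarith [exp_pos u, exp_pos (-u)]
  rw [h1, mul_assoc]
  gcongr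

lemma integrableOn_exp_neg_mul_cosh {x : ℝ} (hx : 0 < x) :
    IntegrableOn (fun u => exp (-x * cosh u)) (Set.Ioi 0) := by
  refine Integrable.mono' ((exp_neg_integrableOn_Ioi 0 (b := 1 / 4) (by norm_num)).const_mul
    (exp (-x / 2) * (x / 4) ^ (-(1 / 4) : ℝ))) (Continuous.aestronglyMeasurable (by fun_prop))
    (Eventually.of_forall fun u => ?_)
  rw [norm_of_nonneg (exp_pos _).le]
  exact exp_neg_mul_cosh_le hx u

lemma besselK_nonneg (x : ℝ) : 0 ≤ besselK x :=
  integral_nonneg fun _ => (exp_pos _).le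

lemma besselK_le {x : ℝ} (hx : 0 < x) :
    besselK x ≤ 4 * exp (-x / 2) * (x / 4) ^ (-(1 / 4) : ℝ) := by
  have h : besselK x ≤ ∫ u in Set.Ioi (0 : ℝ),
      exp (-x / 2) * (x / 4) ^ (-(1 / 4) : ℝ) * exp (-(1 / 4) * u) :=
    setIntegral_mono (integrableOn_exp_neg_mul_cosh hx)
      ((exp_neg_integrableOn_Ioi 0 (b := 1 / 4) (by norm_num)).const_mul _)
      (fun u => exp_neg_mul_cosh_le hx u)
  rw [integral_const_mul, integral_exp_mul_Ioi (by norm_num)] at h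
  norm_num at h ⊢
  linarith

lemma besselK_pow_four_le {x : ℝ} (hx : 0 < x) : besselK x ^ 4 ≤ 1024 * exp (-2 * x) / x := by
  have h := pow_le_pow_left₀ (besselK_nonneg x) (besselK_le hx) 4
  refine h.trans (le_of_eq ?_)
  rw [mul_pow, mul_pow, ← exp_nat_mul, ← rpow_mul_natCast (by positivity)]
  norm_num
  rw [rpow_neg_one]
  rw [show 4 * (-x / 2) = -(2 * x) by ring]
  field_simp
  norm_num

lemma besselKE_self {x : ℝ} (hx : 0 < x) :
    besselKE (x / 2) (x / 2) = ENNReal.ofReal (2 * besselK x) := by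
  have h1 : ∀ u, -(x / 2 * exp u + x / 2 * exp (-u)) = -x * cosh u := fun u => by
    rw [cosh_eq]; ring
  have he : ∀ u, exp (-x * cosh (-u)) = exp (-x * cosh u) := fun u => by rw [cosh_neg]
  have hi : Integrable fun u => exp (-x * cosh u) := by
    rw [← integrableOn_univ, ← Set.Iic_union_Ioi (a := 0), integrableOn_union]
    refine ⟨?_, integrableOn_exp_neg_mul_cosh hx⟩
    rw [integrableOn_Iic_iff_integrableOn_Iio]
    have := (integrableOn_exp_neg_mul_cosh hx).comp_neg
    simpa [he] using this
  unfold besselKE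
  simp_rw [h1]
  rw [← ofReal_integral_eq_lintegral_ofReal hi (Eventually.of_forall fun _ => (exp_pos _).le),
    integral_univ_eq_two_mul_of_even he]
  rfl

lemma integral_mul_besselIR_mul_exp {p : ℝ} (hp : 0 < p) (b : ℝ) :
    ∫ t in Set.Ioi (0 : ℝ), t * besselIR (b * t) * exp (-p * t ^ 2) =
      exp (b ^ 2 / (4 * p)) / (2 * p) := by
  have h := integral_mul_besselI_mul_exp hp b
  have h2 : ∀ t : ℝ, (t : ℂ) * besselI (b * t) * Complex.exp (-p * t ^ 2) =
      ((t * besselIR (b * t) * exp (-p * t ^ 2) : ℝ) : ℂ) := fun t => by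
    rw [← Complex.ofReal_mul b t, besselI_ofReal]; push_cast; rfl
  simp_rw [h2] at h
  rw [integral_complex_ofReal] at h
  exact_mod_cast h

lemma lintegral_mul_besselIR_mul_exp {p : ℝ} (hp : 0 < p) (b : ℝ) :
    ∫⁻ t in Set.Ioi (0 : ℝ), ENNReal.ofReal (t * besselIR (b * t)) *
      ENNReal.ofReal (exp (-p * t ^ 2)) = ENNReal.ofReal (exp (b ^ 2 / (4 * p)) / (2 * p)) := by
  have h := integral_mul_besselIR_mul_exp hp b
  rw [← h, ofReal_integral_eq_lintegral_ofReal]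
  · simp_rw [ENNReal.ofReal_mul' (exp_pos _).le]
  · by_contra hc
    rw [integral_undef hc] at h
    have : 0 < exp (b ^ 2 / (4 * p)) / (2 * p) := by positivity
    linarith
  · refine (ae_restrict_iff' measurableSet_Ioi).2 (Eventually.of_forall fun t ht => ?_)
    have := besselIR_pos (b * t)
    have ht' : 0 < t := ht
    change 0 ≤ _
    positivity

lemma lintegral_exp_neg_mul_exp_div {a : ℝ} (ha : 0 < a) :
    ∫⁻ u : ℝ, ENNReal.ofReal (exp (-(a * exp (-u))) * exp (-u)) = ENNReal.ofReal (1 / a) := by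
  have h1 : ∫⁻ u : ℝ, ENNReal.ofReal (exp (-(a * exp (-u))) * exp (-u)) =
      ∫⁻ u : ℝ, ENNReal.ofReal (exp u) * ENNReal.ofReal (exp (-a * exp u)) := by
    rw [← lintegral_neg_eq_self]
    refine lintegral_congr fun u => ?_
    rw [← ENNReal.ofReal_mul (exp_pos _).le, neg_neg]
    congr 1
    rw [neg_mul]
    ring
  rw [h1, ← lintegral_Ioi_eq_lintegral_exp (fun x => ENNReal.ofReal (exp (-a * x))),
    ← ofReal_integral_eq_lintegral_ofReal (exp_neg_integrableOn_Ioi 0 ha)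
      (Eventually.of_forall fun _ => (exp_pos _).le), integral_exp_mul_Ioi (by linarith)]
  simp [neg_div_neg_eq]

theorem lintegral_besselIR_mul_besselKE {U V b : ℝ} (hU : 0 < U) (hV : 0 < V)
    (hb : b ^ 2 < U * V) :
    ∫⁻ t in Set.Ioi (0 : ℝ), ENNReal.ofReal (t * besselIR (b * t)) *
      besselKE (t / 2 * U) (t / 2 * V) = ENNReal.ofReal (2 / (U * V - b ^ 2)) := by
  calc _ = ∫⁻ t in Set.Ioi (0 : ℝ), ∫⁻ u : ℝ, ENNReal.ofReal (t * besselIR (b * t)) *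
      ENNReal.ofReal (exp (-(t ^ 2 * exp u + U * V / 4 * exp (-u)))) := by
        refine setLIntegral_congr_fun measurableSet_Ioi fun t ht => ?_
        have ht' : 0 < t := ht
        rw [besselKE_eq (by positivity) (t ^ 2) (by positivity) (by positivity),
          show t / 2 * U * (t / 2 * V) / t ^ 2 = U * V / 4 by field_simp; ring, besselKE,
          lintegral_const_mul' _ _ ENNReal.ofReal_ne_top]
    _ = ∫⁻ u : ℝ, ∫⁻ t in Set.Ioi (0 : ℝ), ENNReal.ofReal (t * besselIR (b * t)) *
      ENNReal.ofReal (exp (-(t ^ 2 * exp u + U * V / 4 * exp (-u)))) := by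
        refine lintegral_lintegral_swap (Measurable.aemeasurable ?_)
        have := continuous_besselIR
        exact (ENNReal.measurable_ofReal.comp (Continuous.measurable (by fun_prop))).mul
          (ENNReal.measurable_ofReal.comp (Continuous.measurable (by fun_prop)))
    _ = ∫⁻ u : ℝ, ENNReal.ofReal (1 / 2) *
        ENNReal.ofReal (exp (-((U * V - b ^ 2) / 4 * exp (-u))) * exp (-u)) := by
        refine lintegral_congr fun u => ?_
        have : ∀ t : ℝ, ENNReal.ofReal (t * besselIR (b * t)) *
            ENNReal.ofReal (exp (-(t ^ 2 * exp u + U * V / 4 * exp (-u)))) =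
            ENNReal.ofReal (exp (-(U * V / 4 * exp (-u)))) * (ENNReal.ofReal (t * besselIR (b * t)) *
            ENNReal.ofReal (exp (-exp u * t ^ 2))) := fun t => by
          rw [mul_left_comm, ← ENNReal.ofReal_mul (exp_pos _).le, ← exp_add]
          congr 3
          ring
        simp_rw [this]
        rw [lintegral_const_mul' _ _ ENNReal.ofReal_ne_top,
          lintegral_mul_besselIR_mul_exp (exp_pos u), ← ENNReal.ofReal_mul (exp_pos _).le,
          ← ENNReal.ofReal_mul (by norm_num)]
        congr 1
        have hh : exp (-((U * V - b ^ 2) / 4 * exp (-u))) =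
            exp (-(U * V / 4 * exp (-u))) * exp (b ^ 2 / (4 * exp u)) := by
          rw [← exp_add, exp_neg u]
          congr 1
          field_simp
          ring
        rw [hh, exp_neg u]
        field_simp
    _ = _ := by
        rw [lintegral_const_mul' _ _ ENNReal.ofReal_ne_top,
          lintegral_exp_neg_mul_exp_div (by linarith), ← ENNReal.ofReal_mul (by norm_num)]
        congr 1
        have : U * V - b ^ 2 ≠ 0 := by linarith
        field_simp
        norm_num

lemma lintegral_Ioi_inv_mul_exp (s : ℝ) (u : ℝ) :
    ∫⁻ x in Set.Ioi (0 : ℝ), ENNReal.ofReal x⁻¹ *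
      ENNReal.ofReal (exp (-(s * (x * exp u + x⁻¹ * exp (-u))))) = besselKE s s := by
  rw [lintegral_Ioi_eq_lintegral_exp, ← besselKE_shift s s u, besselKE]
  refine lintegral_congr fun v => ?_
  rw [← mul_assoc, ← ENNReal.ofReal_mul (exp_pos _).le, mul_inv_cancel₀ (exp_pos _).ne',
    ENNReal.ofReal_one, one_mul, ← exp_neg]
  congr 2
  ring

lemma lintegral_besselKE_cube (s : ℝ) :
    ∫⁻ z : ℝ × ℝ × ℝ in Set.Ioi 0 ×ˢ (Set.Ioi 0 ×ˢ Set.Ioi 0),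
      ENNReal.ofReal z.1⁻¹ * (ENNReal.ofReal z.2.1⁻¹ * ENNReal.ofReal z.2.2⁻¹) *
        besselKE (s * (1 + z.1 + z.2.1 + z.2.2)) (s * (1 + z.1⁻¹ + z.2.1⁻¹ + z.2.2⁻¹)) =
      besselKE s s ^ 4 := by
  set h : ℝ → ℝ → ENNReal := fun u x => ENNReal.ofReal x⁻¹ *
      ENNReal.ofReal (exp (-(s * (x * exp u + x⁻¹ * exp (-u))))) with hh
  have hm : Measurable (Function.uncurry h) := by
    refine (ENNReal.measurable_ofReal.comp measurable_snd.inv).mul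
      (ENNReal.measurable_ofReal.comp (measurable_exp.comp (Measurable.neg (.const_mul ?_ _))))
    exact (measurable_snd.mul (measurable_exp.comp measurable_fst)).add
      (measurable_snd.inv.mul (measurable_exp.comp measurable_fst.neg))
  have hmu (u : ℝ) : Measurable (h u) := hm.comp (measurable_const.prodMk measurable_id)
  have key : ∀ z : ℝ × ℝ × ℝ,
      ENNReal.ofReal z.1⁻¹ * (ENNReal.ofReal z.2.1⁻¹ * ENNReal.ofReal z.2.2⁻¹) *
        besselKE (s * (1 + z.1 + z.2.1 + z.2.2)) (s * (1 + z.1⁻¹ + z.2.1⁻¹ + z.2.2⁻¹)) =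
      ∫⁻ u, ENNReal.ofReal (exp (-(s * exp u + s * exp (-u)))) *
        (h u z.1 * (h u z.2.1 * h u z.2.2)) := by
    intro z
    rw [besselKE, ← lintegral_const_mul' _ _ (by
      refine ENNReal.mul_ne_top ENNReal.ofReal_ne_top (ENNReal.mul_ne_top ?_ ?_) <;>
        exact ENNReal.ofReal_ne_top)]
    refine lintegral_congr fun u => ?_
    have : exp (-(s * (1 + z.1 + z.2.1 + z.2.2) * exp u +
        s * (1 + z.1⁻¹ + z.2.1⁻¹ + z.2.2⁻¹) * exp (-u))) =
        exp (-(s * exp u + s * exp (-u))) * (exp (-(s * (z.1 * exp u + z.1⁻¹ * exp (-u)))) *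
        (exp (-(s * (z.2.1 * exp u + z.2.1⁻¹ * exp (-u)))) *
        exp (-(s * (z.2.2 * exp u + z.2.2⁻¹ * exp (-u)))))) := by
      rw [← exp_add, ← exp_add, ← exp_add]
      congr 1
      ring
    rw [this, ENNReal.ofReal_mul (exp_pos _).le, ENNReal.ofReal_mul (exp_pos _).le,
      ENNReal.ofReal_mul (exp_pos _).le]
    simp only [hh]
    ring
  simp_rw [key]
  rw [lintegral_lintegral_swap]
  · have : ∀ u, ∫⁻ z : ℝ × ℝ × ℝ in Set.Ioi 0 ×ˢ (Set.Ioi 0 ×ˢ Set.Ioi 0),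
        ENNReal.ofReal (exp (-(s * exp u + s * exp (-u)))) *
        (h u z.1 * (h u z.2.1 * h u z.2.2)) =
        ENNReal.ofReal (exp (-(s * exp u + s * exp (-u)))) * besselKE s s ^ 3 := by
      intro u
      rw [lintegral_const_mul' _ _ ENNReal.ofReal_ne_top, Measure.volume_eq_prod,
        Measure.volume_eq_prod, ← Measure.prod_restrict, ← Measure.prod_restrict,
        lintegral_prod_mul (f := h u) (g := fun w : ℝ × ℝ => h u w.1 * h u w.2)
          (hmu u).aemeasurable
          (((hmu u).comp measurable_fst).mul ((hmu u).comp measurable_snd)).aemeasurable,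
        lintegral_prod_mul (hmu u).aemeasurable (hmu u).aemeasurable,
        lintegral_Ioi_inv_mul_exp]
      ring
    simp_rw [this]
    rw [lintegral_mul_const _ (by fun_prop)]
    change besselKE s s * _ = _
    ring
  · have h0 : Measurable fun w : (ℝ × ℝ × ℝ) × ℝ =>
        ENNReal.ofReal (exp (-(s * exp w.2 + s * exp (-w.2)))) := by fun_prop
    have h1 : Measurable fun w : (ℝ × ℝ × ℝ) × ℝ => h w.2 w.1.1 :=
      hm.comp (measurable_snd.prodMk measurable_fst.fst)
    have h2 : Measurable fun w : (ℝ × ℝ × ℝ) × ℝ => h w.2 w.1.2.1 :=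
      hm.comp (measurable_snd.prodMk measurable_fst.snd.fst)
    have h3 : Measurable fun w : (ℝ × ℝ × ℝ) × ℝ => h w.2 w.1.2.2 :=
      hm.comp (measurable_snd.prodMk measurable_fst.snd.snd)
    exact (h0.mul (h1.mul (h2.mul h3))).aemeasurable

lemma one_lt_mul_sum_inv {x y z : ℝ} (hx : 0 < x) (hy : 0 < y) (hz : 0 < z) :
    1 < (1 + x + y + z) * (1 + x⁻¹ + y⁻¹ + z⁻¹) := by
  have h1 := inv_pos.2 hx
  have h2 := inv_pos.2 hy
  have h3 := inv_pos.2 hz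
  nlinarith

lemma lintegral_feynman :
    ∫⁻ z : ℝ × ℝ × ℝ in Set.Ioi 0 ×ˢ (Set.Ioi 0 ×ˢ Set.Ioi 0),
      ENNReal.ofReal (((1 + z.1 + z.2.1 + z.2.2) * (1 + z.1⁻¹ + z.2.1⁻¹ + z.2.2⁻¹) - 1)⁻¹ /
        (z.1 * z.2.1 * z.2.2)) =
    ∫⁻ t in Set.Ioi (0 : ℝ), ENNReal.ofReal (8 * (t * besselIR t * besselK t ^ 4)) := by
  have hS : MeasurableSet (Set.Ioi (0 : ℝ) ×ˢ (Set.Ioi (0 : ℝ) ×ˢ Set.Ioi (0 : ℝ))) :=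
    measurableSet_Ioi.prod (measurableSet_Ioi.prod measurableSet_Ioi)
  calc _ = ∫⁻ z : ℝ × ℝ × ℝ in Set.Ioi 0 ×ˢ (Set.Ioi 0 ×ˢ Set.Ioi 0),
        ∫⁻ t in Set.Ioi (0 : ℝ), ENNReal.ofReal (1 / 2) * (ENNReal.ofReal (t * besselIR (1 * t)) *
        (ENNReal.ofReal z.1⁻¹ * (ENNReal.ofReal z.2.1⁻¹ * ENNReal.ofReal z.2.2⁻¹) *
        besselKE (t / 2 * (1 + z.1 + z.2.1 + z.2.2))
          (t / 2 * (1 + z.1⁻¹ + z.2.1⁻¹ + z.2.2⁻¹)))) := by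
        refine setLIntegral_congr_fun hS fun z hz => ?_
        have h1 : 0 < z.1 := hz.1
        have h2 : 0 < z.2.1 := hz.2.1
        have h3 : 0 < z.2.2 := hz.2.2
        have := one_lt_mul_sum_inv h1 h2 h3
        simp_rw [mul_left_comm (ENNReal.ofReal (_ * _)) (_ * _)]
        rw [lintegral_const_mul' _ _ ENNReal.ofReal_ne_top, lintegral_const_mul' _ _ (by
          refine ENNReal.mul_ne_top ENNReal.ofReal_ne_top (ENNReal.mul_ne_top ?_ ?_) <;>
          exact ENNReal.ofReal_ne_top), lintegral_besselIR_mul_besselKE (by positivity)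
          (by positivity) (by linarith), ← ENNReal.ofReal_mul (by positivity),
          ← ENNReal.ofReal_mul (by positivity), ← ENNReal.ofReal_mul (by positivity),
          ← ENNReal.ofReal_mul (by positivity)]
        congr 1
        have : (1 + z.1 + z.2.1 + z.2.2) * (1 + z.1⁻¹ + z.2.1⁻¹ + z.2.2⁻¹) - 1 ≠ 0 := by linarith
        rw [one_pow]
        generalize (1 + z.1 + z.2.1 + z.2.2) * (1 + z.1⁻¹ + z.2.1⁻¹ + z.2.2⁻¹) - 1 = w at this ⊢
        field_simp
    _ = ∫⁻ t in Set.Ioi (0 : ℝ), ∫⁻ z : ℝ × ℝ × ℝ in Set.Ioi 0 ×ˢ (Set.Ioi 0 ×ˢ Set.Ioi 0),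
        ENNReal.ofReal (1 / 2) * (ENNReal.ofReal (t * besselIR (1 * t)) *
        (ENNReal.ofReal z.1⁻¹ * (ENNReal.ofReal z.2.1⁻¹ * ENNReal.ofReal z.2.2⁻¹) *
        besselKE (t / 2 * (1 + z.1 + z.2.1 + z.2.2))
          (t / 2 * (1 + z.1⁻¹ + z.2.1⁻¹ + z.2.2⁻¹)))) := by
        refine lintegral_lintegral_swap (Measurable.aemeasurable ?_)
        have hb := continuous_besselIR
        refine measurable_const.mul (Measurable.mul ?_ (Measurable.mul ?_ ?_))
        · exact ENNReal.measurable_ofReal.comp (Continuous.measurable (by fun_prop))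
        · exact (ENNReal.measurable_ofReal.comp (by fun_prop)).mul
            ((ENNReal.measurable_ofReal.comp (by fun_prop)).mul
              (ENNReal.measurable_ofReal.comp (by fun_prop)))
        · exact measurable_besselKE.comp (Measurable.prodMk (by fun_prop) (by fun_prop))
    _ = _ := by
        refine setLIntegral_congr_fun measurableSet_Ioi fun t ht => ?_
        have ht' : 0 < t := ht
        have hI := besselIR_pos t
        rw [lintegral_const_mul' _ _ ENNReal.ofReal_ne_top, one_mul,
          lintegral_const_mul' _ _ ENNReal.ofReal_ne_top, lintegral_besselKE_cube,
          besselKE_self ht', ← ENNReal.ofReal_pow (by have := besselK_nonneg t; positivity),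
          ← ENNReal.ofReal_mul (by positivity), ← ENNReal.ofReal_mul (by positivity)]
        congr 1
        ring

lemma besselIR_le {t : ℝ} (ht : 0 ≤ t) : besselIR t ≤ exp t := by
  have := norm_besselI_le t
  rw [besselI_ofReal, Complex.norm_real, Complex.ofReal_re, abs_of_nonneg ht] at this
  exact (le_abs_self _).trans this

lemma measurable_besselK : Measurable besselK := by
  unfold besselK
  refine (StronglyMeasurable.integral_prod_right' (f := fun z : ℝ × ℝ => exp (-z.1 * cosh z.2))
    ?_).measurable
  exact Continuous.stronglyMeasurable (by fun_prop)

lemma integrableOn_besselIR_mul_besselK :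
    IntegrableOn (fun t => t * besselIR t * besselK t ^ 4) (Set.Ioi 0) := by
  refine Integrable.mono' ((exp_neg_integrableOn_Ioi 0 one_pos).const_mul 1024) ?_ ?_
  · exact ((measurable_id.mul continuous_besselIR.measurable).mul
      (measurable_besselK.pow_const 4)).aestronglyMeasurable
  · refine (ae_restrict_iff' measurableSet_Ioi).2 (Eventually.of_forall fun t ht => ?_)
    have ht' : 0 < t := ht
    have hI := besselIR_pos t
    have hK := besselK_nonneg t
    rw [norm_of_nonneg (by positivity)]
    calc t * besselIR t * besselK t ^ 4 ≤ t * exp t * (1024 * exp (-2 * t) / t) := by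
          gcongr
          · exact besselIR_le ht'.le
          · exact besselK_pow_four_le ht'
      _ = 1024 * (exp t * exp (-2 * t)) := by field_simp
      _ = _ := by rw [← exp_add]; ring_nf

theorem integral_feynman :
    ∫ x₁ in Set.Ioi (0 : ℝ), ∫ x₂ in Set.Ioi (0 : ℝ), ∫ x₃ in Set.Ioi (0 : ℝ),
      ((1 + x₁ + x₂ + x₃) * (1 + x₁⁻¹ + x₂⁻¹ + x₃⁻¹) - 1)⁻¹ / (x₁ * x₂ * x₃) =
    8 * ∫ t in Set.Ioi (0 : ℝ), t * besselIR t * besselK t ^ 4 := by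
  have hS : MeasurableSet (Set.Ioi (0 : ℝ) ×ˢ (Set.Ioi (0 : ℝ) ×ˢ Set.Ioi (0 : ℝ))) :=
    measurableSet_Ioi.prod (measurableSet_Ioi.prod measurableSet_Ioi)
  set G : ℝ × ℝ × ℝ → ℝ := fun z =>
    ((1 + z.1 + z.2.1 + z.2.2) * (1 + z.1⁻¹ + z.2.1⁻¹ + z.2.2⁻¹) - 1)⁻¹ / (z.1 * z.2.1 * z.2.2)
    with hG
  have hGm : Measurable G := by fun_prop
  have hG0 : 0 ≤ᵐ[volume.restrict (Set.Ioi (0 : ℝ) ×ˢ (Set.Ioi (0 : ℝ) ×ˢ Set.Ioi (0 : ℝ)))] G := by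
    refine (ae_restrict_iff' hS).2 (Eventually.of_forall fun z hz => ?_)
    have h1 : 0 < z.1 := hz.1
    have h2 : 0 < z.2.1 := hz.2.1
    have h3 : 0 < z.2.2 := hz.2.2
    have := one_lt_mul_sum_inv h1 h2 h3
    exact div_nonneg (inv_nonneg.2 (by linarith)) (by positivity)
  have hnn : 0 ≤ᵐ[volume.restrict (Set.Ioi (0 : ℝ))]
      fun t => 8 * (t * besselIR t * besselK t ^ 4) := by
    refine (ae_restrict_iff' measurableSet_Ioi).2 (Eventually.of_forall fun t ht => ?_)
    have ht' : 0 < t := ht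
    have hI := besselIR_pos t
    have hK := besselK_nonneg t
    change 0 ≤ _
    positivity
  have hl := lintegral_feynman
  rw [← ofReal_integral_eq_lintegral_ofReal (integrableOn_besselIR_mul_besselK.const_mul 8) hnn]
    at hl
  have hGi : IntegrableOn G (Set.Ioi 0 ×ˢ (Set.Ioi 0 ×ˢ Set.Ioi 0)) := by
    refine ⟨hGm.aestronglyMeasurable, ?_⟩
    rw [hasFiniteIntegral_iff_ofReal hG0, hl]
    exact ENNReal.ofReal_lt_top
  rw [← ofReal_integral_eq_lintegral_ofReal hGi hG0, ENNReal.ofReal_eq_ofReal_iff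
    (integral_nonneg_of_ae hG0) (integral_nonneg_of_ae hnn), integral_const_mul] at hl
  rw [← hl]
  rw [IntegrableOn, Measure.volume_eq_prod, Measure.volume_eq_prod, ← Measure.prod_restrict,
    ← Measure.prod_restrict] at hGi
  rw [Measure.volume_eq_prod, Measure.volume_eq_prod, ← Measure.prod_restrict,
    ← Measure.prod_restrict, integral_prod _ hGi]
  refine integral_congr_ae ?_
  filter_upwards [hGi.prod_right_ae] with x hx
  rw [integral_prod _ hx]

/-- The weight `e⁻ʷ w^(-1/2)` in the Laplace representation of `K₀`. -/
noncomputable def laplaceWeight (w : ℝ) : ℝ := exp (-w) * w ^ (-(1 / 2) : ℝ)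

/-- The scaled modified Bessel function `eᶻ K₀(z)`. -/
noncomputable def besselKScaled (z : ℂ) : ℂ :=
  ∫ w in Set.Ioi (0 : ℝ), (laplaceWeight w : ℂ) * (w + 2 * z) ^ ((-(1 / 2) : ℝ) : ℂ)

/-- The modified Bessel function `K₀` on the right half plane and its boundary. -/
noncomputable def besselKC (z : ℂ) : ℂ := Complex.exp (-z) * besselKScaled z

lemma integrableOn_exp_mul_rpow {s : ℝ} (hs : -1 < s) :
    IntegrableOn (fun w : ℝ => exp (-w) * w ^ s) (Set.Ioi 0) := by
  have := Real.GammaIntegral_convergent (s := s + 1) (by linarith)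
  simpa using this

lemma integrableOn_laplaceWeight : IntegrableOn laplaceWeight (Set.Ioi 0) :=
  integrableOn_exp_mul_rpow (by norm_num)

lemma laplaceWeight_nonneg {w : ℝ} (hw : 0 < w) : 0 ≤ laplaceWeight w := by
  unfold laplaceWeight
  positivity

lemma two_mul_norm_le {z : ℂ} (hz : 0 ≤ z.re) {w : ℝ} (hw : 0 < w) :
    2 * ‖z‖ ≤ ‖(w + 2 * z : ℂ)‖ := by
  rw [← abs_of_nonneg (norm_nonneg (w + 2 * z : ℂ)), ← abs_of_nonneg (by positivity : 0 ≤ 2 * ‖z‖),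
    ← sq_le_sq, mul_pow, ← Complex.normSq_eq_norm_sq, ← Complex.normSq_eq_norm_sq,
    Complex.normSq_apply, Complex.normSq_apply]
  simp
  nlinarith [mul_nonneg hw.le hz]

lemma le_norm_add {z : ℂ} (hz : 0 ≤ z.re) {w : ℝ} : w ≤ ‖(w + 2 * z : ℂ)‖ := by
  refine le_trans ?_ (Complex.re_le_norm _)
  simp
  linarith

lemma measurable_besselKScaled_integrand (z : ℂ) (s : ℝ) :
    Measurable fun w : ℝ => (laplaceWeight w : ℂ) * (w + 2 * z) ^ ((s : ℝ) : ℂ) := by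
  unfold laplaceWeight
  fun_prop

lemma norm_besselKScaled_le {z : ℂ} (hz : 0 ≤ z.re) (hz0 : z ≠ 0) {s : ℝ} (hs : 0 ≤ s)
    (hs' : s ≤ 3 / 8) :
    ‖besselKScaled z‖ ≤ (∫ w in Set.Ioi (0 : ℝ), exp (-w) * w ^ (-(1 / 2) - s : ℝ)) *
      (2 * ‖z‖) ^ (s - 1 / 2) := by
  have hn : 0 < ‖z‖ := norm_pos_iff.2 hz0
  rw [← integral_mul_const]
  refine norm_integral_le_of_norm_le ((integrableOn_exp_mul_rpow (by linarith)).mul_const _)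
    ((ae_restrict_iff' measurableSet_Ioi).2 (Eventually.of_forall fun w hw => ?_))
  have hw' : 0 < w := hw
  rw [norm_mul, Complex.norm_real, norm_of_nonneg (laplaceWeight_nonneg hw'),
    Complex.norm_cpow_real, laplaceWeight, mul_assoc, mul_assoc]
  refine mul_le_mul_of_nonneg_left ?_ (exp_pos _).le
  rw [show (-(1 / 2) : ℝ) - s = -(1 / 2) + -s by ring, rpow_add hw', mul_assoc]
  refine mul_le_mul_of_nonneg_left ?_ (by positivity)
  have hp : 0 < ‖(w + 2 * z : ℂ)‖ := hw'.trans_le (le_norm_add hz)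
  rw [show (-(1 / 2) : ℝ) = -s + (s - 1 / 2) by ring, rpow_add hp]
  exact mul_le_mul (rpow_le_rpow_of_nonpos hw' (le_norm_add hz) (by linarith))
    (rpow_le_rpow_of_nonpos (by positivity) (two_mul_norm_le hz hw') (by linarith))
    (by positivity) (by positivity)

lemma exists_norm_besselKC_le (s : ℝ) (hs : 0 ≤ s) (hs' : s ≤ 3 / 8) :
    ∃ C : ℝ, 0 < C ∧ ∀ z : ℂ, 0 ≤ z.re → z ≠ 0 →
      ‖besselKC z‖ ≤ C * ‖z‖ ^ (s - 1 / 2) * exp (-z.re) := by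
  refine ⟨(∫ w in Set.Ioi (0 : ℝ), exp (-w) * w ^ (-(1 / 2) - s : ℝ)) * 2 ^ (s - 1 / 2) + 1,
    ?_, fun z hz hz0 => ?_⟩
  · have : 0 ≤ ∫ w in Set.Ioi (0 : ℝ), exp (-w) * w ^ (-(1 / 2) - s : ℝ) :=
      setIntegral_nonneg measurableSet_Ioi fun w hw => by
        have hw' : 0 < w := hw
        positivity
    positivity
  · rw [besselKC, norm_mul, Complex.norm_exp, mul_comm, Complex.neg_re]
    gcongr
    refine (norm_besselKScaled_le hz hz0 hs hs').trans ?_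
    rw [mul_rpow (by norm_num) (norm_nonneg _), add_mul, mul_assoc]
    have : 0 ≤ 1 * ‖z‖ ^ (s - 1 / 2) := by positivity
    linarith

lemma hasDerivAt_cpow_integrand {z : ℂ} (hz : 0 < z.re ∨ 0 < z.im) {w : ℝ} (hw : 0 < w) :
    HasDerivAt (fun z : ℂ => (laplaceWeight w : ℂ) * (w + 2 * z) ^ ((-(1 / 2) : ℝ) : ℂ))
      (-((laplaceWeight w : ℂ) * (w + 2 * z) ^ ((-(3 / 2) : ℝ) : ℂ))) z := by
  have h1 : HasDerivAt (fun z : ℂ => (w : ℂ) + 2 * z) 2 z := by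
    simpa using ((hasDerivAt_id z).const_mul (2 : ℂ)).const_add (w : ℂ)
  have hs : (w + 2 * z : ℂ) ∈ Complex.slitPlane := by
    rw [Complex.mem_slitPlane_iff]
    rcases hz with h | h
    · left; simp; positivity
    · right; simp; exact h.ne'
  have := (h1.cpow_const (c := ((-(1 / 2) : ℝ) : ℂ)) hs).const_mul (laplaceWeight w : ℂ)
  convert! this using 1
  rw [show ((-(1 / 2) : ℝ) : ℂ) - 1 = ((-(3 / 2) : ℝ) : ℂ) by push_cast; ring]
  push_cast
  ring

lemma differentiableAt_besselKC {z : ℂ} (hz : 0 ≤ z.re) (hz' : 0 < z.re ∨ 0 < z.im) :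
    DifferentiableAt ℂ besselKC z := by
  refine DifferentiableAt.mul (by fun_prop) ?_
  set m := max z.re z.im with hm
  have hm0 : 0 < m := by rcases hz' with h | h <;> simp [hm, h]
  have hball : ∀ x ∈ Metric.ball z (m / 2), m / 2 < x.re ∨ m / 2 < x.im := by
    intro x hx
    have hx' : ‖x - z‖ < m / 2 := by simpa [dist_eq_norm] using hx
    have h1 := (Complex.abs_re_le_norm (x - z)).trans_lt hx'
    have h2 := (Complex.abs_im_le_norm (x - z)).trans_lt hx'
    rw [Complex.sub_re, abs_lt] at h1
    rw [Complex.sub_im, abs_lt] at h2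
    rcases max_choice z.re z.im with h | h
    · left; rw [← hm] at h; linarith
    · right; rw [← hm] at h; linarith
  have hz0 : z ≠ 0 := by
    rintro rfl
    simp at hz'
  have hn : 0 < ‖z‖ := norm_pos_iff.2 hz0
  refine (hasDerivAt_integral_of_dominated_loc_of_deriv_le
    (F := fun (z : ℂ) (w : ℝ) => (laplaceWeight w : ℂ) * (w + 2 * z) ^ ((-(1 / 2) : ℝ) : ℂ))
    (F' := fun (z : ℂ) (w : ℝ) => -((laplaceWeight w : ℂ) * (w + 2 * z) ^ ((-(3 / 2) : ℝ) : ℂ)))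
    (bound := fun w => laplaceWeight w * m ^ (-(3 / 2) : ℝ))
    (Metric.ball_mem_nhds z (half_pos hm0)) ?_ ?_ ?_ ?_ ?_ ?_).2.differentiableAt
  · exact Eventually.of_forall fun x => (measurable_besselKScaled_integrand x _).aestronglyMeasurable
  · refine Integrable.mono' (integrableOn_laplaceWeight.mul_const ((2 * ‖z‖) ^ (-(1 / 2) : ℝ)))
      (measurable_besselKScaled_integrand z _).aestronglyMeasurable
      ((ae_restrict_iff' measurableSet_Ioi).2 (Eventually.of_forall fun w hw => ?_))
    rw [norm_mul, Complex.norm_real, norm_of_nonneg (laplaceWeight_nonneg hw),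
      Complex.norm_cpow_real]
    exact mul_le_mul_of_nonneg_left (rpow_le_rpow_of_nonpos (by positivity)
      (two_mul_norm_le hz hw) (by norm_num)) (laplaceWeight_nonneg hw)
  · exact (measurable_besselKScaled_integrand z _).neg.aestronglyMeasurable
  · refine (ae_restrict_iff' measurableSet_Ioi).2 (Eventually.of_forall fun w hw x hx => ?_)
    have hw' : 0 < w := hw
    rw [norm_neg, norm_mul, Complex.norm_real, norm_of_nonneg (laplaceWeight_nonneg hw),
      Complex.norm_cpow_real]
    refine mul_le_mul_of_nonneg_left (rpow_le_rpow_of_nonpos hm0 ?_ (by norm_num))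
      (laplaceWeight_nonneg hw)
    rcases hball x hx with h | h
    · refine le_trans ?_ (Complex.re_le_norm _)
      simp
      linarith
    · refine le_trans ?_ (Complex.im_le_norm _)
      simp
      linarith
  · exact integrableOn_laplaceWeight.mul_const _
  · refine (ae_restrict_iff' measurableSet_Ioi).2 (Eventually.of_forall fun w hw x hx => ?_)
    exact hasDerivAt_cpow_integrand ((hball x hx).imp (fun h => by linarith)
      (fun h => by linarith)) hw

lemma image_cosh_sub_one {x : ℝ} (hx : 0 < x) :
    (fun u => x * (cosh u - 1)) '' Set.Ioi 0 = Set.Ioi 0 := by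
  ext w
  constructor
  · rintro ⟨u, hu, rfl⟩
    have : 1 < cosh u := one_lt_cosh.2 (ne_of_gt hu)
    exact mul_pos hx (by linarith)
  · intro hw
    have hw' : 0 < w := hw
    have h1 : 1 ≤ w / x + 1 := by
      have : 0 < w / x := by positivity
      linarith
    refine ⟨arcosh (w / x + 1), ?_, ?_⟩
    · exact arcosh_pos (by have : 0 < w / x := by positivity
                           linarith)
    · simp only [cosh_arcosh h1]
      field_simp
      ring

lemma besselKC_ofReal {x : ℝ} (hx : 0 < x) : besselKC x = besselK x := by
  have hd : ∀ u ∈ Set.Ioi (0 : ℝ),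
      HasDerivWithinAt (fun u => x * (cosh u - 1)) (x * sinh u) (Set.Ioi 0) u := fun u _ =>
    (((hasDerivAt_cosh u).sub_const 1).const_mul x).hasDerivWithinAt
  have hinj : Set.InjOn (fun u => x * (cosh u - 1)) (Set.Ioi 0) := by
    intro u hu v hv h
    have h2 : cosh u = cosh v := by
      have := mul_left_cancel₀ hx.ne' h
      linarith
    exact cosh_injOn (Set.Ioi_subset_Ici_self hu) (Set.Ioi_subset_Ici_self hv) h2
  have h := integral_image_eq_integral_abs_deriv_smul measurableSet_Ioi hd hinj
    (fun w : ℝ => (laplaceWeight w : ℂ) * (w + 2 * x) ^ ((-(1 / 2) : ℝ) : ℂ))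
  rw [image_cosh_sub_one hx] at h
  rw [besselKC, besselKScaled, h, besselK, ← integral_complex_ofReal, ← integral_const_mul]
  refine setIntegral_congr_fun measurableSet_Ioi fun u hu => ?_
  have hu' : 0 < u := hu
  have hs : 0 < sinh u := sinh_pos_iff.2 hu'
  have hc : 1 < cosh u := one_lt_cosh.2 hu'.ne'
  have hcs := cosh_sq u
  have e1 : ((x * (cosh u - 1) : ℝ) : ℂ) + 2 * x = ((x * (cosh u + 1) : ℝ) : ℂ) := by
    push_cast; ring
  have hw : 0 < x * (cosh u - 1) := mul_pos hx (by linarith)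
  simp only [e1]
  rw [← Complex.ofReal_cpow (by positivity), Complex.real_smul, abs_of_pos (by positivity),
    laplaceWeight]
  have e2 : exp (-(x * (cosh u - 1))) * (x * (cosh u - 1)) ^ (-(1 / 2) : ℝ) *
      (x * (cosh u + 1)) ^ (-(1 / 2) : ℝ) = exp (-(x * (cosh u - 1))) * (x * sinh u)⁻¹ := by
    rw [mul_assoc, ← mul_rpow hw.le (by positivity),
      show x * (cosh u - 1) * (x * (cosh u + 1)) = (x * sinh u) ^ 2 by
        linear_combination (x ^ 2) * hcs,
      ← rpow_natCast, ← rpow_mul (by positivity)]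
    norm_num
    rw [rpow_neg_one, mul_inv]
    ring
  rw [← Complex.ofReal_mul, e2, show Complex.exp (-(x : ℂ)) = ((exp (-x) : ℝ) : ℂ) by push_cast; rfl,
    ← Complex.ofReal_mul, ← Complex.ofReal_mul]
  congr 1
  rw [show -x * cosh u = -x + -(x * (cosh u - 1)) by ring, exp_add]
  field_simp

lemma norm_exp_neg_mul_cosh {z : ℂ} (u : ℝ) :
    ‖Complex.exp (-z * (cosh u : ℝ))‖ = exp (-z.re * cosh u) := by
  rw [Complex.norm_exp, Complex.re_mul_ofReal, Complex.neg_re]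

lemma differentiableAt_integral_exp_neg_mul_cosh {z : ℂ} (hz : 0 < z.re) :
    DifferentiableAt ℂ (fun z => ∫ u in Set.Ioi (0 : ℝ), Complex.exp (-z * (cosh u : ℝ))) z := by
  refine (hasDerivAt_integral_of_dominated_loc_of_deriv_le
    (F := fun (z : ℂ) (u : ℝ) => Complex.exp (-z * (cosh u : ℝ)))
    (F' := fun (z : ℂ) (u : ℝ) => Complex.exp (-z * (cosh u : ℝ)) * -(cosh u : ℝ))
    (bound := fun u => (4 / z.re) * exp (-(z.re / 4) * cosh u))
    (Metric.ball_mem_nhds z (half_pos hz)) ?_ ?_ ?_ ?_ ?_ ?_).2.differentiableAt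
  · exact Eventually.of_forall fun x => Continuous.aestronglyMeasurable (by fun_prop)
  · refine Integrable.mono' (integrableOn_exp_neg_mul_cosh hz)
      (Continuous.aestronglyMeasurable (by fun_prop)) (Eventually.of_forall fun u => ?_)
    rw [norm_exp_neg_mul_cosh]
  · exact Continuous.aestronglyMeasurable (by fun_prop)
  · refine Eventually.of_forall fun u x hx => ?_
    have hx' : ‖x - z‖ < z.re / 2 := by simpa [dist_eq_norm] using hx
    have h1 := (Complex.abs_re_le_norm (x - z)).trans_lt hx'
    rw [Complex.sub_re, abs_lt] at h1
    have hc := cosh_pos u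
    rw [norm_mul, norm_exp_neg_mul_cosh, norm_neg, Complex.norm_real, norm_of_nonneg hc.le]
    have h2 : exp (-x.re * cosh u) ≤ exp (-(z.re / 2) * cosh u) :=
      exp_le_exp.2 (mul_le_mul_of_nonneg_right (by linarith) hc.le)
    have h3 : cosh u ≤ 4 / z.re * exp (z.re / 4 * cosh u) := by
      have := add_one_le_exp (z.re / 4 * cosh u)
      rw [div_mul_eq_mul_div, le_div_iff₀ hz]
      linarith
    calc exp (-x.re * cosh u) * cosh u
        ≤ exp (-(z.re / 2) * cosh u) * (4 / z.re * exp (z.re / 4 * cosh u)) := by gcongr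
      _ = 4 / z.re * (exp (-(z.re / 2) * cosh u) * exp (z.re / 4 * cosh u)) := by ring
      _ = _ := by rw [← exp_add]; congr 2; ring
  · exact (integrableOn_exp_neg_mul_cosh (by positivity)).const_mul _
  · refine Eventually.of_forall fun u x _ => ?_
    have := ((hasDerivAt_id x).neg.mul_const ((cosh u : ℝ) : ℂ)).cexp
    simpa using this

theorem besselKC_eq_integral {z : ℂ} (hz : 0 < z.re) :
    besselKC z = ∫ u in Set.Ioi (0 : ℝ), Complex.exp (-z * (cosh u : ℝ)) := by
  have hopen : IsOpen {z : ℂ | 0 < z.re} := isOpen_lt continuous_const Complex.continuous_re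
  have h1 : AnalyticOnNhd ℂ besselKC {z : ℂ | 0 < z.re} :=
    DifferentiableOn.analyticOnNhd (fun w hw => (differentiableAt_besselKC (le_of_lt hw)
      (Or.inl hw)).differentiableWithinAt) hopen
  have h2 : AnalyticOnNhd ℂ
      (fun z => ∫ u in Set.Ioi (0 : ℝ), Complex.exp (-z * (cosh u : ℝ))) {z : ℂ | 0 < z.re} :=
    DifferentiableOn.analyticOnNhd (fun w hw => (differentiableAt_integral_exp_neg_mul_cosh
      hw).differentiableWithinAt) hopen
  refine h1.eqOn_of_preconnected_of_frequently_eq h2 (z₀ := 1)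
    (convex_halfSpace_re_gt 0).isPreconnected (by simp) ?_ hz
  have ht : Tendsto (fun x : ℝ => (x : ℂ)) (𝓝[≠] 1) (𝓝[≠] 1) := by
    refine tendsto_nhdsWithin_iff.2 ⟨?_, ?_⟩
    · have := (Complex.continuous_ofReal.tendsto 1).mono_left (nhdsWithin_le_nhds (s := {(1 : ℝ)}ᶜ))
      simpa using this
    · filter_upwards [self_mem_nhdsWithin] with x hx
      simpa using hx
  refine ht.frequently (Eventually.frequently ?_)
  have : ∀ᶠ x : ℝ in 𝓝[≠] 1, 0 < x := nhdsWithin_le_nhds (lt_mem_nhds one_pos)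
  filter_upwards [this] with x hx
  rw [besselKC_ofReal hx, besselK, ← integral_complex_ofReal]
  push_cast
  rfl

lemma integrableOn_cosh_mul_exp_neg_sinh {c : ℝ} (hc : 0 < c) :
    IntegrableOn (fun u => cosh u * exp (-(c * sinh u))) (Set.Ioi 0) := by
  have hd : ∀ u ∈ Set.Ici (0 : ℝ), HasDerivAt (fun u => -(exp (-(c * sinh u)) / c))
      (cosh u * exp (-(c * sinh u))) u := by
    intro u _
    have := ((((hasDerivAt_sinh u).const_mul c).fun_neg.exp).div_const c).fun_neg
    convert! this using 1
    field_simp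
  refine integrableOn_Ioi_deriv_of_nonneg' hd (fun u _ => mul_nonneg (cosh_pos u).le (exp_pos _).le)
    (l := 0) ?_
  have h : Tendsto (fun u => -(c * sinh u)) atTop atBot := by
    refine tendsto_neg_atTop_atBot.comp (Tendsto.const_mul_atTop hc ?_)
    refine tendsto_atTop_mono' _ ?_ tendsto_id
    filter_upwards [eventually_ge_atTop 0] with u hu
    exact self_le_sinh_iff.2 hu
  have := ((tendsto_exp_atBot.comp h).div_const c).neg
  simpa using this

lemma integrableOn_exp_neg_sinh {c : ℝ} (hc : 0 < c) :
    IntegrableOn (fun u => exp (-(c * sinh u))) (Set.Ioi 0) := by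
  refine Integrable.mono' (integrableOn_cosh_mul_exp_neg_sinh hc)
    (Continuous.aestronglyMeasurable (by fun_prop)) (Eventually.of_forall fun u => ?_)
  rw [norm_of_nonneg (exp_pos _).le]
  exact le_mul_of_one_le_left (exp_pos _).le (one_le_cosh u)

lemma norm_sinh_sub_le (u δ : ℝ) : ‖Complex.sinh (u - Complex.I * δ)‖ ≤ cosh u := by
  have h1 : ‖Complex.exp (u - Complex.I * δ)‖ = exp u := by
    rw [Complex.norm_exp]; simp
  have h2 : ‖Complex.exp (-(u - Complex.I * δ))‖ = exp (-u) := by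
    rw [Complex.norm_exp]; simp
  rw [Complex.sinh, norm_div, Complex.norm_ofNat, cosh_eq, ← h1, ← h2]
  exact div_le_div_of_nonneg_right (norm_sub_le _ _) (by norm_num)

theorem integral_exp_cosh_shift {z : ℂ} {a b c : ℝ} (hab : a ≤ b) (hc : 0 < c)
    (h : ∀ δ ∈ Set.Icc a b, ∀ u : ℝ, 0 < u →
      c * sinh u ≤ (z * Complex.cosh (u - Complex.I * δ)).re) :
    (∫ u in Set.Ioi (0 : ℝ), Complex.exp (-(z * Complex.cosh (u - Complex.I * b)))) -
      ∫ u in Set.Ioi (0 : ℝ), Complex.exp (-(z * Complex.cosh (u - Complex.I * a))) =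
      Complex.I * ∫ δ in a..b, Complex.exp (-(z * (cos δ : ℝ))) := by
  set g : ℝ → ℝ → ℂ := fun δ u => Complex.exp (-(z * Complex.cosh (u - Complex.I * δ))) with hg
  set G : ℝ → ℝ → ℂ := fun δ u => g δ u * (z * Complex.sinh (u - Complex.I * δ)) with hG
  have hgn : ∀ δ ∈ Set.Icc a b, ∀ u : ℝ, 0 < u → ‖g δ u‖ ≤ exp (-(c * sinh u)) := by
    intro δ hδ u hu
    rw [hg, Complex.norm_exp, Complex.neg_re]
    exact exp_le_exp.2 (neg_le_neg (h δ hδ u hu))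
  have hgi : ∀ δ ∈ Set.Icc a b, IntegrableOn (g δ) (Set.Ioi 0) := by
    intro δ hδ
    refine Integrable.mono' (integrableOn_exp_neg_sinh hc)
      (Continuous.aestronglyMeasurable (by fun_prop))
      ((ae_restrict_iff' measurableSet_Ioi).2 (Eventually.of_forall fun u hu => hgn δ hδ u hu))
  have hGn : ∀ δ ∈ Set.Icc a b, ∀ u : ℝ, 0 < u →
      ‖G δ u‖ ≤ ‖z‖ * (cosh u * exp (-(c * sinh u))) := by
    intro δ hδ u hu
    rw [hG, norm_mul, norm_mul]
    calc _ ≤ exp (-(c * sinh u)) * (‖z‖ * cosh u) := by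
          gcongr
          · exact hgn δ hδ u hu
          · exact norm_sinh_sub_le u δ
      _ = _ := by ring
  have hdu : ∀ δ u : ℝ, HasDerivAt (g δ) (-G δ u) u := by
    intro δ u
    have h1 : HasDerivAt (fun u : ℝ => (u : ℂ) - Complex.I * δ) 1 u :=
      (Complex.ofRealCLM.hasDerivAt).sub_const _
    have := (((Complex.hasDerivAt_cosh _).comp u h1).const_mul z).fun_neg.cexp
    convert! this using 1
    simp only [hG, hg, Function.comp]
    ring
  have hdδ : ∀ u δ : ℝ, HasDerivAt (fun δ => g δ u) (Complex.I * G δ u) δ := by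
    intro u δ
    have h1 : HasDerivAt (fun δ : ℝ => (u : ℂ) - Complex.I * δ) (-Complex.I) δ := by
      simpa using ((Complex.ofRealCLM.hasDerivAt (x := δ)).const_mul Complex.I).const_sub (u : ℂ)
    have := (((Complex.hasDerivAt_cosh _).comp δ h1).const_mul z).fun_neg.cexp
    convert! this using 1
    simp only [hG, hg, Function.comp]
    ring
  have hcont : Continuous (Function.uncurry G) := by
    simp only [hG, hg, Function.uncurry_def]
    fun_prop
  have hlim : ∀ δ ∈ Set.Icc a b, ∫ u in Set.Ioi (0 : ℝ), -G δ u = - g δ 0 := by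
    intro δ hδ
    have hi : IntegrableOn (fun u => -G δ u) (Set.Ioi 0) := by
      refine Integrable.mono' ((integrableOn_cosh_mul_exp_neg_sinh hc).const_mul ‖z‖)
        (Continuous.aestronglyMeasurable (by fun_prop))
        ((ae_restrict_iff' measurableSet_Ioi).2 (Eventually.of_forall fun u hu => ?_))
      rw [norm_neg]
      exact hGn δ hδ u hu
    have ht : Tendsto (g δ) atTop (𝓝 0) :=
      tendsto_zero_of_hasDerivAt_of_integrableOn_Ioi (a := 0) (fun u _ => hdu δ u) hi (hgi δ hδ)
    rw [integral_Ioi_of_hasDerivAt_of_tendsto' (fun u _ => hdu δ u) hi ht, zero_sub]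
  have hswap : ∫ u in Set.Ioi (0 : ℝ), ∫ δ in a..b, Complex.I * G δ u =
      ∫ δ in a..b, ∫ u in Set.Ioi (0 : ℝ), Complex.I * G δ u := by
    rw [intervalIntegral.integral_of_le hab]
    simp_rw [intervalIntegral.integral_of_le hab]
    refine integral_integral_swap ?_
    have hdom : Integrable (fun w : ℝ × ℝ => (‖z‖ * (cosh w.1 * exp (-(c * sinh w.1)))) * 1)
        ((volume.restrict (Set.Ioi 0)).prod (volume.restrict (Set.Ioc a b))) :=
      Integrable.mul_prod (f := fun u => ‖z‖ * (cosh u * exp (-(c * sinh u))))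
        (g := fun _ : ℝ => (1 : ℝ)) ((integrableOn_cosh_mul_exp_neg_sinh hc).const_mul ‖z‖) (by simp)
    refine hdom.mono' (Continuous.aestronglyMeasurable ?_) ?_
    · simp only [Function.uncurry_def]
      fun_prop
    · rw [Measure.prod_restrict]
      refine (ae_restrict_iff' (measurableSet_Ioi.prod measurableSet_Ioc)).2
        (Eventually.of_forall fun w hw => ?_)
      rw [Function.uncurry_def, norm_mul, Complex.norm_I, one_mul, mul_one]
      exact hGn w.2 (Set.Ioc_subset_Icc_self hw.2) w.1 hw.1
  rw [← integral_sub (hgi b ⟨hab, le_rfl⟩) (hgi a ⟨le_rfl, hab⟩)]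
  have e1 : ∀ u : ℝ, g b u - g a u = ∫ δ in a..b, Complex.I * G δ u := fun u =>
    (intervalIntegral.integral_eq_sub_of_hasDerivAt (fun δ _ => hdδ u δ)
      (Continuous.intervalIntegrable (by fun_prop) _ _)).symm
  simp_rw [e1]
  rw [hswap, ← intervalIntegral.integral_const_mul]
  refine intervalIntegral.integral_congr fun δ hδ => ?_
  rw [Set.uIcc_of_le hab] at hδ
  have h2 := hlim δ hδ
  rw [integral_neg, neg_inj] at h2
  simp only [integral_const_mul, h2]
  simp only [hg]
  congr 3
  rw [Complex.ofReal_zero, zero_sub, Complex.cosh_neg, mul_comm Complex.I, Complex.cosh_mul_I,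
    Complex.ofReal_cos]

lemma cosh_sub_I_mul (u δ : ℝ) : Complex.cosh (u - Complex.I * δ) =
    (cosh u * cos δ : ℝ) - (sinh u * sin δ : ℝ) * Complex.I := by
  rw [Complex.cosh_sub, mul_comm Complex.I, Complex.cosh_mul_I, Complex.sinh_mul_I]
  push_cast
  ring

lemma re_mul_cosh_sub (z : ℂ) (u δ : ℝ) : (z * Complex.cosh (u - Complex.I * δ)).re =
    z.re * (cosh u * cos δ) + z.im * (sinh u * sin δ) := by
  rw [cosh_sub_I_mul]
  simp only [Complex.mul_re, Complex.sub_re, Complex.sub_im, Complex.ofReal_re, Complex.ofReal_im,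
    Complex.mul_im, Complex.I_re, Complex.I_im]
  ring

lemma integral_exp_neg_real_cosh_shift {ρ δ : ℝ} (hρ : 0 < ρ) (hδ : |δ| < π / 2) :
    Integrable (fun u : ℝ => Complex.exp (-(ρ * Complex.cosh (u - Complex.I * δ)))) ∧
    ∫ u : ℝ, Complex.exp (-(ρ * Complex.cosh (u - Complex.I * δ))) = 2 * besselK ρ := by
  set g : ℝ → ℝ → ℂ := fun δ u => Complex.exp (-(ρ * Complex.cosh (u - Complex.I * δ))) with hg
  have hcos : 0 < cos δ := cos_pos_of_mem_Ioo (abs_lt.1 hδ)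
  have hre : ∀ δ u : ℝ, (ρ * Complex.cosh (u - Complex.I * δ)).re = ρ * (cosh u * cos δ) := by
    intro δ u
    rw [re_mul_cosh_sub]; simp
  have hb : ∀ δ' : ℝ, |δ'| ≤ |δ| → ∀ u : ℝ, 0 < u →
      (ρ * cos δ) * sinh u ≤ (ρ * Complex.cosh (u - Complex.I * δ')).re := by
    intro δ' hδ' u hu
    rw [hre]
    have h1 : cos δ ≤ cos δ' := by
      rw [← cos_abs δ, ← cos_abs δ']
      exact cos_le_cos_of_nonneg_of_le_pi (abs_nonneg _) (by linarith [pi_pos]) hδ'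
    have h2 : sinh u ≤ cosh u := (sinh_lt_cosh u).le
    have h3 : 0 < sinh u := sinh_pos_iff.2 hu
    calc _ = ρ * (sinh u * cos δ) := by ring
      _ ≤ _ := by gcongr
  have hneg : ∀ δ u : ℝ, g δ (-u) = g (-δ) u := by
    intro δ u
    simp only [hg]
    rw [← Complex.cosh_neg]
    rw [show (ρ * Complex.cosh (-((-u : ℝ) - Complex.I * δ)) : ℂ) =
      ρ * Complex.cosh (u - Complex.I * (-δ : ℝ)) by push_cast; ring_nf]
  have hinteg : ∀ δ', |δ'| ≤ |δ| → IntegrableOn (g δ') (Set.Ioi 0) := by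
    intro δ' hδ'
    refine Integrable.mono' (integrableOn_exp_neg_sinh (mul_pos hρ hcos))
      (Continuous.aestronglyMeasurable (by fun_prop))
      ((ae_restrict_iff' measurableSet_Ioi).2 (Eventually.of_forall fun u hu => ?_))
    simp only [hg]
    rw [Complex.norm_exp, Complex.neg_re]
    exact exp_le_exp.2 (neg_le_neg (hb δ' hδ' u hu))
  have hi2 : IntegrableOn (g δ) (Set.Iic 0) := by
    rw [integrableOn_Iic_iff_integrableOn_Iio]
    have := (hinteg (-δ) (by rw [abs_neg])).comp_neg
    simp only [Set.neg_Ioi, neg_zero, hneg, neg_neg] at this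
    exact this
  have hi : Integrable (g δ) := by
    rw [← integrableOn_univ, ← Set.Iic_union_Ioi (a := 0), integrableOn_union]
    exact ⟨hi2, hinteg δ le_rfl⟩
  refine ⟨hi, ?_⟩
  have hsum : ∀ d : ℝ, 0 ≤ d → d ≤ |δ| →
      (∫ u in Set.Ioi (0 : ℝ), g d u) + ∫ u in Set.Ioi (0 : ℝ), g (-d) u = 2 * besselK ρ := by
    intro d hd hd'
    have h1 := integral_exp_cosh_shift (z := ρ) hd (mul_pos hρ hcos) fun δ' hδ' u hu =>
      hb δ' (by rw [abs_of_nonneg hδ'.1]; exact hδ'.2.trans hd') u hu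
    have h2 := integral_exp_cosh_shift (z := ρ) (a := -d) (b := 0) (by linarith)
      (mul_pos hρ hcos) fun δ' hδ' u hu =>
      hb δ' (by rw [abs_of_nonpos hδ'.2]; linarith [hδ'.1]) u hu
    have h3 : ∫ x in -d..0, Complex.exp (-(ρ * (cos x : ℝ))) =
        ∫ x in (0 : ℝ)..d, Complex.exp (-(ρ * (cos x : ℝ))) := by
      have := intervalIntegral.integral_comp_neg
        (fun x : ℝ => Complex.exp (-(ρ * (cos x : ℝ)))) (a := 0) (b := d)
      simp only [cos_neg, neg_zero] at this
      exact this.symm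
    rw [h3] at h2
    have h0 : ∫ u in Set.Ioi (0 : ℝ), Complex.exp (-(ρ * Complex.cosh (u - Complex.I * (0 : ℝ)))) =
        besselK ρ := by
      rw [besselK, ← integral_complex_ofReal]
      push_cast
      simp
    rw [h0] at h1 h2
    simp only [hg]
    linear_combination h1 - h2
  have hsplit : ∫ u, g δ u = (∫ u in Set.Ioi (0 : ℝ), g (-δ) u) + ∫ u in Set.Ioi (0 : ℝ), g δ u := by
    rw [← intervalIntegral.integral_Iic_add_Ioi hi2 (hinteg δ le_rfl)]
    congr 1
    rw [← neg_zero, ← integral_comp_neg_Ioi]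
    simp_rw [hneg, neg_zero]
  change ∫ u, g δ u = _
  rw [hsplit]
  rcases le_total 0 δ with h | h
  · rw [add_comm]
    exact hsum δ h (le_abs_self δ)
  · have := hsum (-δ) (by linarith) (neg_le_abs δ)
    rwa [neg_neg] at this

lemma besselKC_eq_sinh {z : ℂ} (hz : 0 < z.re) (hz' : 0 < z.im) :
    besselKC z = (∫ u in Set.Ioi (0 : ℝ), Complex.exp (Complex.I * z * (sinh u : ℝ))) -
      Complex.I * ∫ φ in (0 : ℝ)..(π / 2), Complex.exp (-(z * (cos φ : ℝ))) := by
  have h := integral_exp_cosh_shift (z := z) (a := 0) (b := π / 2) (c := min z.re z.im)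
    (by positivity) (lt_min hz hz') fun δ hδ u hu => by
      rw [re_mul_cosh_sub]
      have hc : 0 ≤ cos δ := cos_nonneg_of_mem_Icc ⟨by linarith [hδ.1, pi_pos], hδ.2⟩
      have hs : 0 ≤ sin δ := sin_nonneg_of_nonneg_of_le_pi hδ.1 (by linarith [hδ.2, pi_pos])
      have h1 : 1 ≤ cos δ + sin δ := by
        nlinarith [cos_sq_add_sin_sq δ, cos_le_one δ, sin_le_one δ, mul_nonneg hc hs]
      have h2 : 0 < sinh u := sinh_pos_iff.2 hu
      have h3 := min_le_left z.re z.im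
      have h4 := min_le_right z.re z.im
      have hm := lt_min hz hz'
      calc min z.re z.im * sinh u ≤ min z.re z.im * sinh u * (cos δ + sin δ) :=
            le_mul_of_one_le_right (by positivity) h1
        _ = min z.re z.im * (sinh u * cos δ) + min z.re z.im * (sinh u * sin δ) := by ring
        _ ≤ _ := by
            gcongr
            exact (sinh_lt_cosh u).le
  have e0 : ∫ u in Set.Ioi (0 : ℝ), Complex.exp (-(z * Complex.cosh (u - Complex.I * (0 : ℝ)))) =
      besselKC z := by
    rw [besselKC_eq_integral hz]
    simp
  have e1 : ∀ u : ℝ, -(z * Complex.cosh (u - Complex.I * (π / 2 : ℝ))) =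
      Complex.I * z * (sinh u : ℝ) := fun u => by
    rw [cosh_sub_I_mul, cos_pi_div_two, sin_pi_div_two]
    push_cast
    ring
  simp_rw [e1] at h
  rw [e0] at h
  linear_combination -h

lemma tendsto_vertical (t : ℝ) :
    Tendsto (fun ε : ℝ => (ε : ℂ) + Complex.I * t) (𝓝[>] 0) (𝓝 (Complex.I * t)) := by
  have : Continuous fun ε : ℝ => (ε : ℂ) + Complex.I * t := by fun_prop
  have h := (this.tendsto 0).mono_left (nhdsWithin_le_nhds (s := Set.Ioi 0))
  simpa using h

lemma tendsto_besselKC_vertical {t : ℝ} (ht : 0 < t) :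
    Tendsto (fun ε : ℝ => besselKC (ε + Complex.I * t)) (𝓝[>] 0) (𝓝 (besselKC (Complex.I * t))) :=
  ((differentiableAt_besselKC (z := Complex.I * t) (by simp)
    (Or.inr (by simpa using ht))).continuousAt.tendsto).comp (tendsto_vertical t)

lemma besselKC_I_mul {t : ℝ} (ht : 0 < t) :
    besselKC (Complex.I * t) = (∫ u in Set.Ioi (0 : ℝ), exp (-(t * sinh u)) : ℝ) -
      Complex.I * ∫ φ in (0 : ℝ)..(π / 2), Complex.exp (-(Complex.I * t * (cos φ : ℝ))) := by
  refine tendsto_nhds_unique (tendsto_besselKC_vertical ht) ?_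
  have hev : (fun ε : ℝ => (∫ u in Set.Ioi (0 : ℝ),
      Complex.exp (Complex.I * (ε + Complex.I * t) * (sinh u : ℝ))) -
      Complex.I * ∫ φ in (0 : ℝ)..(π / 2), Complex.exp (-((ε + Complex.I * t) * (cos φ : ℝ))))
      =ᶠ[𝓝[>] 0] fun ε : ℝ => besselKC (ε + Complex.I * t) := by
    filter_upwards [self_mem_nhdsWithin] with ε hε
    rw [besselKC_eq_sinh (by simpa using hε) (by simpa using ht)]
  refine Tendsto.congr' hev (Tendsto.sub ?_ (Tendsto.const_mul _ ?_))
  · rw [← integral_complex_ofReal]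
    refine tendsto_integral_filter_of_dominated_convergence (fun u => exp (-(t * sinh u))) ?_ ?_
      (integrableOn_exp_neg_sinh ht) ?_
    · exact Eventually.of_forall fun ε => Continuous.aestronglyMeasurable (by fun_prop)
    · refine Eventually.of_forall fun ε => Eventually.of_forall fun u => ?_
      rw [Complex.norm_exp, Complex.re_mul_ofReal]
      simp
    · refine Eventually.of_forall fun u => ?_
      have : Continuous fun z : ℂ => Complex.exp (Complex.I * z * (sinh u : ℝ)) := by fun_prop
      have h := (this.tendsto _).comp (tendsto_vertical t)
      convert! h using 2
      push_cast
      congr 1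
      linear_combination (-(t : ℂ) * Complex.sinh u) * Complex.I_sq
  · have : Continuous fun z : ℂ => ∫ φ in (0 : ℝ)..(π / 2), Complex.exp (-(z * (cos φ : ℝ))) :=
      intervalIntegral.continuous_parametric_intervalIntegral_of_continuous' (by fun_prop) _ _
    exact (this.tendsto _).comp (tendsto_vertical t)

lemma besselJ_eq (t : ℝ) : besselJ t = 2 / π * ∫ φ in (0 : ℝ)..(π / 2), cos (t * cos φ) := by
  have hI : ∀ a b : ℝ, IntervalIntegrable (fun φ => cos (t * cos φ)) volume a b :=
    fun a b => Continuous.intervalIntegrable (by fun_prop) _ _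
  have h1 : ∫ φ in (-π)..0, cos (t * cos φ) = ∫ φ in (0 : ℝ)..π, cos (t * cos φ) := by
    have := intervalIntegral.integral_comp_neg (fun φ => cos (t * cos φ)) (a := 0) (b := π)
    simp only [cos_neg, neg_zero] at this
    exact this.symm
  have h2 : ∫ φ in (π / 2)..π, cos (t * cos φ) = ∫ φ in (0 : ℝ)..(π / 2), cos (t * cos φ) := by
    have := intervalIntegral.integral_comp_sub_left (fun φ => cos (t * cos φ)) π
      (a := 0) (b := π / 2)
    rw [sub_zero, show π - π / 2 = π / 2 by ring] at this
    rw [← this]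
    simp [cos_pi_sub]
  rw [besselJ, ← intervalIntegral.integral_add_adjacent_intervals (hI (-π) 0) (hI 0 π), h1,
    ← intervalIntegral.integral_add_adjacent_intervals (hI 0 (π / 2)) (hI (π / 2) π), h2]
  field_simp
  ring

lemma besselKC_I_mul_im {t : ℝ} (ht : 0 < t) :
    (besselKC (Complex.I * t)).im = -(π / 2 * besselJ t) := by
  have h : ∫ φ in (0 : ℝ)..(π / 2), Complex.exp (-(Complex.I * t * (cos φ : ℝ))) =
      (∫ φ in (0 : ℝ)..(π / 2), cos (t * cos φ) : ℝ) -
        (∫ φ in (0 : ℝ)..(π / 2), sin (t * cos φ) : ℝ) * Complex.I := by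
    rw [← intervalIntegral.integral_ofReal, ← intervalIntegral.integral_ofReal,
      ← intervalIntegral.integral_mul_const, ← intervalIntegral.integral_sub
      (Continuous.intervalIntegrable (by fun_prop) _ _)
      (Continuous.intervalIntegrable (by fun_prop) _ _)]
    congr 1
    ext φ
    rw [show -(Complex.I * t * (cos φ : ℝ)) = ((-(t * cos φ) : ℝ) : ℂ) * Complex.I by
      push_cast; ring, Complex.exp_mul_I, ← Complex.ofReal_cos, ← Complex.ofReal_sin, cos_neg,
      sin_neg]
    push_cast
    ring
  rw [besselKC_I_mul ht, h, besselJ_eq]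
  simp
  field_simp

lemma integrable_exp_neg_mul_cosh_univ {z : ℂ} (hz : 0 < z.re) :
    Integrable fun u : ℝ => Complex.exp (-(z * (cosh u : ℝ))) := by
  have h := (integral_exp_neg_real_cosh_shift (ρ := z.re) (δ := 0) hz
    (by rw [abs_zero]; positivity)).1
  refine h.mono (Continuous.aestronglyMeasurable (by fun_prop)) (Eventually.of_forall fun u => ?_)
  rw [Complex.norm_exp, Complex.norm_exp]
  simp

lemma integral_exp_neg_mul_cosh_univ {z : ℂ} (hz : 0 < z.re) :
    ∫ u : ℝ, Complex.exp (-(z * (cosh u : ℝ))) = 2 * besselKC z := by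
  have hi := integrable_exp_neg_mul_cosh_univ hz
  rw [← intervalIntegral.integral_Iic_add_Ioi (b := 0) hi.integrableOn hi.integrableOn,
    ← neg_zero, ← integral_comp_neg_Ioi, besselKC_eq_integral hz]
  simp only [cosh_neg, neg_mul, neg_zero]
  ring

/-- The modulus of `K₀` as an integral of `K₀` over the positive axis. -/
theorem norm_besselKC_sq {ε t : ℝ} (hε : 0 < ε) :
    ‖besselKC (ε + Complex.I * t)‖ ^ 2 =
      ∫ p : ℝ, besselK (2 * ‖((ε * cosh p : ℝ) + (t * sinh p : ℝ) * Complex.I : ℂ)‖) := by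
  set z : ℂ := ε + Complex.I * t with hzdef
  have hz : 0 < z.re := by simpa [hzdef] using hε
  have hzc : 0 < ((starRingEnd ℂ) z).re := by simpa using hz
  set H : ℝ → ℝ → ℂ := fun u v => Complex.exp (-(z * (cosh u : ℝ))) *
    Complex.exp (-((starRingEnd ℂ) z * (cosh v : ℝ))) with hH
  have hHi : Integrable (Function.uncurry H) (volume.prod volume) :=
    (integrable_exp_neg_mul_cosh_univ hz).mul_prod (integrable_exp_neg_mul_cosh_univ hzc)
  have hconj : (starRingEnd ℂ) (2 * besselKC z) =
      ∫ u : ℝ, Complex.exp (-((starRingEnd ℂ) z * (cosh u : ℝ))) := by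
    rw [← integral_exp_neg_mul_cosh_univ hz, ← integral_conj]
    congr 1
    ext u
    rw [← Complex.exp_conj, map_neg, map_mul, Complex.conj_ofReal]
  have h0 : ∫ u, ∫ v, H u v = 4 * ((‖besselKC z‖ ^ 2 : ℝ) : ℂ) := by
    simp only [hH, integral_const_mul]
    rw [← hconj, integral_mul_const, integral_exp_neg_mul_cosh_univ hz, Complex.mul_conj,
      Complex.normSq_eq_norm_sq, norm_mul]
    push_cast
    norm_num
    ring
  have h1 : ∫ u, ∫ v, H u v = ∫ w, ∫ u, H u (u + w) := by
    rw [← integral_integral_swap (f := fun u w => H u (u + w))]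
    · congr 1
      ext u
      rw [integral_add_left_eq_self (fun v => H u v)]
    · exact (measurePreserving_prod_add (volume : Measure ℝ)
        (volume : Measure ℝ)).integrable_comp_of_integrable (g := Function.uncurry H) hHi
  have h2 : ∫ w, ∫ u, H u (u + w) = ∫ w, ∫ p, H (p - w / 2) (p + w / 2) := by
    congr 1
    ext w
    rw [← integral_sub_right_eq_self (fun u => H u (u + w)) (w / 2)]
    congr 1
    ext p
    congr 1
    ring
  have hnorm : ∀ p w : ℝ, ‖H (p - w) (p + w)‖ = exp (-(2 * ε * cosh p * cosh w)) := by
    intro p w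
    simp only [hH]
    rw [norm_mul, Complex.norm_exp, Complex.norm_exp, ← exp_add]
    congr 1
    rw [Complex.neg_re, Complex.neg_re, Complex.re_mul_ofReal, Complex.re_mul_ofReal,
      Complex.conj_re, cosh_sub, cosh_add]
    simp only [hzdef, Complex.add_re, Complex.ofReal_re, Complex.mul_re, Complex.I_re,
      Complex.I_im, Complex.ofReal_im]
    ring
  have hreal : ∀ c : ℝ, 0 < c → Integrable fun u : ℝ => exp (-(c * cosh u)) := by
    intro c hc
    have := (integrable_exp_neg_mul_cosh_univ (z := c) (by simpa using hc)).norm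
    simpa only [Complex.norm_exp, Complex.neg_re, Complex.re_ofReal_mul, Complex.ofReal_re] using this
  have h3 : ∫ w, ∫ p, H (p - w / 2) (p + w / 2) = ∫ p, ∫ w, H (p - w / 2) (p + w / 2) := by
    refine integral_integral_swap ?_
    have hd : Integrable (fun x : ℝ × ℝ => exp (-(ε * cosh (x.1 / 2))) * exp (-(ε * cosh x.2)))
        (volume.prod volume) :=
      ((hreal ε hε).comp_div (R := 2) (by norm_num)).mul_prod (hreal ε hε)
    refine hd.mono' (Continuous.aestronglyMeasurable ?_) (Eventually.of_forall fun x => ?_)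
    · simp only [hH, Function.uncurry_def]
      fun_prop
    · simp only [Function.uncurry_def]
      rw [hnorm, ← exp_add]
      refine exp_le_exp.2 ?_
      have e : ε * cosh (x.1 / 2) + ε * cosh x.2 = ε * (cosh (x.1 / 2) + cosh x.2) := by ring
      have e2 : 2 * ε * cosh x.2 * cosh (x.1 / 2) = ε * (2 * (cosh x.2 * cosh (x.1 / 2))) := by ring
      have : cosh (x.1 / 2) + cosh x.2 ≤ 2 * (cosh x.2 * cosh (x.1 / 2)) := by
        nlinarith [one_le_cosh (x.1 / 2), one_le_cosh x.2]
      have := mul_le_mul_of_nonneg_left this hε.le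
      linarith
  have h4 : ∀ p, ∫ w, H (p - w / 2) (p + w / 2) = 2 * ∫ q, H (p - q) (p + q) := by
    intro p
    rw [Measure.integral_comp_div (fun q => H (p - q) (p + q)) 2]
    simp
  have h5 : ∀ p, ∫ q, H (p - q) (p + q) =
      2 * ((besselK (2 * ‖((ε * cosh p : ℝ) + (t * sinh p : ℝ) * Complex.I : ℂ)‖) : ℝ) : ℂ) := by
    intro p
    set w : ℂ := ((ε * cosh p : ℝ) + (t * sinh p : ℝ) * Complex.I : ℂ) with hw
    have hwre : w.re = ε * cosh p := by
      rw [hw, Complex.add_re, Complex.ofReal_re, Complex.re_ofReal_mul, Complex.I_re]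
      ring
    have hwim : w.im = t * sinh p := by
      rw [hw, Complex.add_im, Complex.ofReal_im, Complex.im_ofReal_mul, Complex.I_im]
      ring
    have hwpos : 0 < w.re := by rw [hwre]; exact mul_pos hε (cosh_pos p)
    have hw0 : 0 < ‖w‖ := norm_pos_iff.2 fun h => by rw [h] at hwpos; simp at hwpos
    have harg : |w.arg| < π / 2 := Complex.abs_arg_lt_pi_div_two_iff.2 (Or.inl hwpos)
    rw [← (integral_exp_neg_real_cosh_shift (ρ := 2 * ‖w‖) (by positivity) harg).2]
    congr 1
    ext q
    simp only [hH]
    rw [← Complex.exp_add, cosh_sub_I_mul, cosh_sub, cosh_add]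
    congr 1
    have e1 : ‖w‖ * cos w.arg = ε * cosh p := by rw [Complex.norm_mul_cos_arg, hwre]
    have e2 : ‖w‖ * sin w.arg = t * sinh p := by rw [Complex.norm_mul_sin_arg, hwim]
    have e1' : (‖w‖ : ℂ) * (cos w.arg : ℝ) = ε * (cosh p : ℝ) := by exact_mod_cast e1
    have e2' : (‖w‖ : ℂ) * (sin w.arg : ℝ) = t * (sinh p : ℝ) := by exact_mod_cast e2
    have hcz : (starRingEnd ℂ) z = ε - Complex.I * t := by
      simp [hzdef, Complex.conj_ofReal, sub_eq_add_neg]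
    rw [hcz, hzdef]
    push_cast at e1' e2' ⊢
    linear_combination (-2) * (-(Complex.cosh q)) * e1' + (-2) * Complex.I * Complex.sinh q * e2'
  rw [h1, h2, h3] at h0
  simp_rw [h4, h5] at h0
  rw [integral_const_mul, integral_const_mul, integral_complex_ofReal] at h0
  have : (4 : ℂ) * ((‖besselKC z‖ ^ 2 : ℝ) : ℂ) = 4 * ((∫ p : ℝ, besselK (2 *
      ‖((ε * cosh p : ℝ) + (t * sinh p : ℝ) * Complex.I : ℂ)‖) : ℝ) : ℂ) := by
    rw [← h0]; ring
  exact_mod_cast mul_left_cancel₀ (by norm_num) this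

lemma besselK_antitone {x y : ℝ} (hx : 0 < x) (hxy : x ≤ y) : besselK y ≤ besselK x :=
  setIntegral_mono (integrableOn_exp_neg_mul_cosh (hx.trans_le hxy))
    (integrableOn_exp_neg_mul_cosh hx) fun u => exp_le_exp.2 (by nlinarith [cosh_pos u])

lemma continuousAt_besselK {x : ℝ} (hx : 0 < x) : ContinuousAt besselK x := by
  have h : ContinuousAt (fun y : ℝ => (besselKC y).re) x :=
    Complex.continuous_re.continuousAt.comp (ContinuousAt.comp
      (differentiableAt_besselKC (z := x) (by simpa using hx.le)
        (Or.inl (by simpa using hx))).continuousAt Complex.continuous_ofReal.continuousAt)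
  refine h.congr ?_
  filter_upwards [lt_mem_nhds hx] with y hy
  rw [besselKC_ofReal hy, Complex.ofReal_re]

lemma integrableOn_besselK_sinh {t : ℝ} (ht : 0 < t) :
    IntegrableOn (fun p => besselK (2 * (t * sinh p))) (Set.Ioi 0) := by
  have h := (integrableOn_Ioi_comp_mul_left_iff
    (fun w : ℝ => exp (-w) * w ^ (-(1 / 4) : ℝ)) 0 ht).2
    (by simpa using integrableOn_exp_mul_rpow (s := -(1 / 4)) (by norm_num))
  refine Integrable.mono' (h.const_mul (4 * (1 / 2 : ℝ) ^ (-(1 / 4) : ℝ)))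
    (measurable_besselK.comp (by fun_prop)).aestronglyMeasurable
    ((ae_restrict_iff' measurableSet_Ioi).2 (Eventually.of_forall fun u hu => ?_))
  have hu' : (0 : ℝ) < u := hu
  have h1 : u ≤ sinh u := self_le_sinh_iff.2 hu'.le
  rw [norm_of_nonneg (besselK_nonneg _)]
  refine (besselK_antitone (x := 2 * (t * u)) (by positivity) (by gcongr)).trans
    ((besselK_le (by positivity)).trans (le_of_eq ?_))
  rw [show 2 * (t * u) / 4 = 1 / 2 * (t * u) by ring, mul_rpow (by norm_num) (by positivity),
    show -(2 * (t * u)) / 2 = -(t * u) by ring]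
  ring

/-- Nicholson's integral at order zero. -/
theorem norm_besselKC_I_mul_sq {t : ℝ} (ht : 0 < t) :
    ‖besselKC (Complex.I * t)‖ ^ 2 = 2 * ∫ p in Set.Ioi 0, besselK (2 * (t * sinh p)) := by
  have h1 : Tendsto (fun ε : ℝ => ‖besselKC (ε + Complex.I * t)‖ ^ 2) (𝓝[>] 0)
      (𝓝 (‖besselKC (Complex.I * t)‖ ^ 2)) := (tendsto_besselKC_vertical ht).norm.pow 2
  have hs : ∀ ε : ℝ, 0 < ε → ∀ p : ℝ, 0 < p →
      t * sinh p ≤ ‖((ε * cosh p : ℝ) + (t * sinh p : ℝ) * Complex.I : ℂ)‖ := by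
    intro ε hε p hp
    refine le_trans (le_of_eq ?_) ((le_abs_self _).trans (Complex.abs_im_le_norm _))
    rw [Complex.add_im, Complex.ofReal_im, Complex.im_ofReal_mul, Complex.I_im]
    ring
  have h2 : Tendsto (fun ε : ℝ => 2 * ∫ p in Set.Ioi (0 : ℝ), besselK
      (2 * ‖((ε * cosh p : ℝ) + (t * sinh p : ℝ) * Complex.I : ℂ)‖)) (𝓝[>] 0)
      (𝓝 (2 * ∫ p in Set.Ioi 0, besselK (2 * (t * sinh p)))) := by
    refine Tendsto.const_mul _ (tendsto_integral_filter_of_dominated_convergence _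
      ?_ ?_ (integrableOn_besselK_sinh ht) ?_)
    · exact Eventually.of_forall fun ε => (measurable_besselK.comp
        (Continuous.measurable (by fun_prop))).aestronglyMeasurable
    · filter_upwards [self_mem_nhdsWithin] with ε hε
      refine (ae_restrict_iff' measurableSet_Ioi).2 (Eventually.of_forall fun p hp => ?_)
      have := sinh_pos_iff.2 hp
      rw [norm_of_nonneg (besselK_nonneg _)]
      exact besselK_antitone (by positivity) (mul_le_mul_of_nonneg_left (hs ε hε p hp) (by norm_num))
    · refine (ae_restrict_iff' measurableSet_Ioi).2 (Eventually.of_forall fun p hp => ?_)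
      have := sinh_pos_iff.2 hp
      refine (continuousAt_besselK (by positivity)).tendsto.comp ?_
      have hc : Continuous fun ε : ℝ =>
          2 * ‖((ε * cosh p : ℝ) + (t * sinh p : ℝ) * Complex.I : ℂ)‖ := by fun_prop
      have := (hc.tendsto 0).mono_left (nhdsWithin_le_nhds (s := Set.Ioi 0))
      convert! this using 3
      rw [Complex.norm_add_mul_I, zero_mul, zero_pow two_ne_zero, zero_add,
        sqrt_sq (by positivity)]
  refine tendsto_nhds_unique h1 (h2.congr' ?_)
  filter_upwards [self_mem_nhdsWithin] with ε hε
  rw [norm_besselKC_sq hε, integral_univ_eq_two_mul_of_even]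
  intro p
  rw [cosh_neg, sinh_neg]
  rw [Complex.norm_add_mul_I, Complex.norm_add_mul_I, mul_neg, neg_sq]

/-- The combination of Bessel functions whose real part links the integrals along the two axes. -/
noncomputable def besselContour (z : ℂ) : ℂ :=
  z * besselKC z ^ 3 * (besselI z * besselKC z - 2 * Complex.I / (5 * π) * besselKC z ^ 2 +
    3 * π * Complex.I / 5 * besselI z ^ 2)

lemma norm_besselContour_le (z : ℂ) : ‖besselContour z‖ ≤ ‖z‖ * ‖besselKC z‖ ^ 3 *
    (‖besselI z‖ * ‖besselKC z‖ + ‖besselKC z‖ ^ 2 + 2 * ‖besselI z‖ ^ 2) := by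
  rw [besselContour, norm_mul, norm_mul, norm_pow]
  have h1 : ‖(2 * Complex.I / (5 * π) : ℂ)‖ ≤ 1 := by
    rw [norm_div, norm_mul, norm_mul, Complex.norm_I, Complex.norm_real, norm_of_nonneg pi_pos.le]
    norm_num
    rw [div_le_one (by positivity)]
    linarith [pi_gt_three]
  have h2 : ‖(3 * π * Complex.I / 5 : ℂ)‖ ≤ 2 := by
    rw [norm_div, norm_mul, norm_mul, Complex.norm_I, Complex.norm_real, norm_of_nonneg pi_pos.le]
    norm_num
    linarith [pi_lt_d2]
  gcongr
  refine (norm_add_le _ _).trans (add_le_add ((norm_sub_le _ _).trans (add_le_add ?_ ?_)) ?_)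
  · rw [norm_mul]
  · rw [norm_mul, norm_pow]
    exact mul_le_of_le_one_left (by positivity) h1
  · rw [norm_mul, norm_pow]
    gcongr

lemma exists_norm_besselContour_le_near : ∃ M : ℝ, ∀ z : ℂ, 0 ≤ z.re → ‖z‖ ≤ 1 →
    ‖besselContour z‖ ≤ M * ‖z‖ ^ (3 / 8 : ℝ) := by
  obtain ⟨C, hC, hK⟩ := exists_norm_besselKC_le (3 / 8) (by norm_num) le_rfl
  refine ⟨C ^ 3 * (3 * C + C ^ 2 + 18), fun z hz hz1 => ?_⟩
  rcases eq_or_ne z 0 with rfl | hz0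
  · rw [besselContour]
    simp
  have ha : 0 < ‖z‖ := norm_pos_iff.2 hz0
  have hk := hK z hz hz0
  have hb1 : 1 ≤ ‖z‖ ^ (3 / 8 - 1 / 2 : ℝ) :=
    one_le_rpow_of_pos_of_le_one_of_nonpos ha hz1 (by norm_num)
  have hab : ‖z‖ * (‖z‖ ^ (3 / 8 - 1 / 2 : ℝ)) ^ 5 = ‖z‖ ^ (3 / 8 : ℝ) := by
    rw [← rpow_mul_natCast ha.le, ← rpow_one_add' ha.le (by norm_num)]
    norm_num
  have hi : ‖besselI z‖ ≤ 3 := by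
    refine (norm_besselI_le z).trans ((exp_le_exp.2 ((Complex.abs_re_le_norm z).trans hz1)).trans ?_)
    linarith [exp_one_lt_d9]
  set b := ‖z‖ ^ (3 / 8 - 1 / 2 : ℝ)
  have hk' : ‖besselKC z‖ ≤ C * b :=
    hk.trans (mul_le_of_le_one_right (by positivity) (exp_le_one_iff.2 (by linarith)))
  calc ‖besselContour z‖ ≤ _ := norm_besselContour_le z
    _ ≤ ‖z‖ * (C * b) ^ 3 * (3 * (C * b) + (C * b) ^ 2 + 2 * 3 ^ 2) := by gcongr
    _ ≤ ‖z‖ * (C * b) ^ 3 * (b ^ 2 * (3 * C + C ^ 2 + 18)) := by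
        gcongr
        nlinarith [mul_nonneg hC.le (mul_nonneg (zero_le_one.trans hb1) (sub_nonneg.2 hb1))]
    _ = _ := by rw [← hab]; ring

lemma exists_norm_besselContour_le_far : ∃ M : ℝ, 0 < M ∧ ∀ z : ℂ, 0 ≤ z.re → 1 ≤ ‖z‖ →
    ‖besselContour z‖ ≤ M * ‖z‖ ^ (-(1 / 2) : ℝ) * exp (-z.re) := by
  obtain ⟨C, hC, hK⟩ := exists_norm_besselKC_le 0 le_rfl (by norm_num)
  refine ⟨C ^ 3 * (C + C ^ 2 + 2), by positivity, fun z hz hz1 => ?_⟩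
  have ha : 0 < ‖z‖ := by linarith
  have hk := hK z hz (norm_pos_iff.1 ha)
  have hb1 : ‖z‖ ^ (0 - 1 / 2 : ℝ) ≤ 1 := rpow_le_one_of_one_le_of_nonpos hz1 (by norm_num)
  have hab : ‖z‖ * (‖z‖ ^ (0 - 1 / 2 : ℝ)) ^ 3 = ‖z‖ ^ (-(1 / 2) : ℝ) := by
    rw [← rpow_mul_natCast ha.le, ← rpow_one_add' ha.le (by norm_num)]
    norm_num
  have hi : ‖besselI z‖ ≤ exp z.re := by
    simpa [abs_of_nonneg hz] using norm_besselI_le z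
  have he : exp (-z.re) * exp z.re = 1 := by rw [← exp_add]; simp
  have he1 : exp (-z.re) ≤ 1 := exp_le_one_iff.2 (by linarith)
  have he0 := exp_pos (-z.re)
  have hb0 : 0 < ‖z‖ ^ (0 - 1 / 2 : ℝ) := by positivity
  set b := ‖z‖ ^ (0 - 1 / 2 : ℝ)
  set e := exp (-z.re)
  calc ‖besselContour z‖ ≤ _ := norm_besselContour_le z
    _ ≤ ‖z‖ * (C * b * e) ^ 3 *
          (exp z.re * (C * b * e) + (C * b * e) ^ 2 + 2 * exp z.re ^ 2) := by gcongr
    _ = ‖z‖ * b ^ 3 * C ^ 3 * e * (C * b * e ^ 2 * (e * exp z.re) + C ^ 2 * (b ^ 2 * e ^ 4) +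
          2 * (e * exp z.re) ^ 2) := by ring
    _ = ‖z‖ * b ^ 3 * C ^ 3 * e * (C * (b * e ^ 2) + C ^ 2 * (b ^ 2 * e ^ 4) + 2) := by
        rw [he]; ring
    _ ≤ ‖z‖ * b ^ 3 * C ^ 3 * e * (C * 1 + C ^ 2 * 1 + 2) := by
        gcongr
        · exact mul_le_one₀ hb1 (by positivity) (pow_le_one₀ he0.le he1)
        · exact mul_le_one₀ (pow_le_one₀ hb0.le hb1) (by positivity) (pow_le_one₀ he0.le he1)
    _ = _ := by rw [hab]; ring

lemma differentiableAt_besselContour {z : ℂ} (hz : 0 ≤ z.re) (hz' : 0 < z.re ∨ 0 < z.im) :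
    DifferentiableAt ℂ besselContour z := by
  have h1 := differentiableAt_besselKC hz hz'
  have h2 := differentiable_besselI z
  unfold besselContour
  fun_prop

lemma continuousOn_besselContour :
    ContinuousOn besselContour {z : ℂ | 0 ≤ z.re ∧ 0 ≤ z.im} := by
  intro z ⟨hz, hz'⟩
  by_cases h : 0 < z.re ∨ 0 < z.im
  · exact (differentiableAt_besselContour hz h).continuousAt.continuousWithinAt
  push Not at h
  have h0 : z = 0 := Complex.ext (le_antisymm h.1 hz) (le_antisymm h.2 hz')
  obtain ⟨M, hM⟩ := exists_norm_besselContour_le_near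
  have hf0 : besselContour 0 = 0 := by simp [besselContour]
  rw [h0, ContinuousWithinAt, hf0]
  refine squeeze_zero_norm' (a := fun z => M * ‖z‖ ^ (3 / 8 : ℝ)) ?_ ?_
  · have : ∀ᶠ z : ℂ in 𝓝 0, ‖z‖ < 1 := by
      have := Metric.ball_mem_nhds (0 : ℂ) one_pos
      filter_upwards [this] with z hz
      simpa using hz
    filter_upwards [self_mem_nhdsWithin, nhdsWithin_le_nhds this] with z hz h1
    exact hM z hz.1 h1.le
  · have : Continuous fun z : ℂ => M * ‖z‖ ^ (3 / 8 : ℝ) :=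
      continuous_const.mul (continuous_norm.rpow_const fun _ => Or.inr (by norm_num))
    have h := (this.tendsto 0).mono_left
      (nhdsWithin_le_nhds (s := {z : ℂ | 0 ≤ z.re ∧ 0 ≤ z.im}))
    simpa [zero_rpow] using h

lemma besselContour_ofReal_re {x : ℝ} (hx : 0 < x) :
    (besselContour x).re = x * besselIR x * besselK x ^ 4 := by
  have : besselContour x = (x * besselIR x * besselK x ^ 4 : ℝ) +
      (x * besselK x ^ 3 * (-(2 / (5 * π) * besselK x ^ 2) + 3 * π / 5 * besselIR x ^ 2) : ℝ) *
        Complex.I := by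
    rw [besselContour, besselI_ofReal, besselKC_ofReal hx]
    push_cast
    ring
  rw [this]
  rw [Complex.add_re, Complex.ofReal_re, Complex.re_ofReal_mul, Complex.I_re]
  ring

lemma besselContour_I_mul_re {t : ℝ} (ht : 0 < t) :
    (besselContour (Complex.I * t) * Complex.I).re =
      π ^ 2 / 10 * (t * besselJ t ^ 3 * ‖besselKC (Complex.I * t)‖ ^ 2) := by
  rw [besselContour, besselI_I_mul, ← Complex.normSq_eq_norm_sq, Complex.normSq_apply]
  have him := besselKC_I_mul_im ht
  set p := (besselKC (Complex.I * t)).re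
  have hk : besselKC (Complex.I * t) = (p : ℂ) - (π / 2 * besselJ t : ℝ) * Complex.I := by
    apply Complex.ext <;> simp [p, him]
  rw [him, hk]
  set J := besselJ t
  have hpi : (π : ℂ) ≠ 0 := by exact_mod_cast pi_ne_zero
  have key : ∀ (P p J t : ℝ), P ≠ 0 → ∃ y : ℝ, (Complex.I * t * ((p : ℂ) - (P / 2 * J : ℝ) * Complex.I) ^ 3 *
      (J * ((p : ℂ) - (P / 2 * J : ℝ) * Complex.I) -
        2 * Complex.I / (5 * P) * ((p : ℂ) - (P / 2 * J : ℝ) * Complex.I) ^ 2 +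
        3 * P * Complex.I / 5 * J ^ 2) * Complex.I) =
      ((P ^ 2 / 10 * (t * J ^ 3 * (p * p + -(P / 2 * J) * -(P / 2 * J))) : ℝ) : ℂ) +
        (y : ℂ) * Complex.I := by
    intro P p J t hP
    have hP' : (P : ℂ) ≠ 0 := by exact_mod_cast hP
    refine ⟨2 * t / P * ((3 * p ^ 2 * (P / 2 * J) - (P / 2 * J) ^ 3) * (3 / 5 * (p * (P / 2 * J)))
      - (p ^ 3 - 3 * p * (P / 2 * J) ^ 2) * (2 / 5 * (P / 2 * J) ^ 2 - p ^ 2 / 5)), ?_⟩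
    have h2 := Complex.I_sq
    push_cast
    field_simp
    have h3 : Complex.I ^ 3 = -Complex.I := by rw [pow_succ, h2]; ring
    have h4 : Complex.I ^ 4 = 1 := Complex.I_pow_four
    have h5 : Complex.I ^ 5 = Complex.I := by rw [pow_succ, h4]; ring
    have h6 : Complex.I ^ 6 = -1 := by rw [pow_succ, h5, ← sq, h2]
    have h7 : Complex.I ^ 7 = -Complex.I := by rw [pow_succ, h6]; ring
    have h8 : Complex.I ^ 8 = 1 := by rw [pow_succ, h7]; linear_combination -h2
    ring_nf
    simp only [h2, h3, h4, h5, h6, h7, h8]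
    ring
  obtain ⟨y, hy⟩ := key π p J t pi_ne_zero
  rw [hy, Complex.add_re, Complex.ofReal_re, Complex.re_ofReal_mul, Complex.I_re]
  ring

lemma abs_besselJ_le_norm_besselKC {t : ℝ} (ht : 0 < t) :
    |besselJ t| ≤ ‖besselKC (Complex.I * t)‖ := by
  have h := Complex.abs_im_le_norm (besselKC (Complex.I * t))
  rw [besselKC_I_mul_im ht, abs_neg, abs_mul, abs_of_pos (by positivity)] at h
  refine le_trans ?_ h
  exact le_mul_of_one_le_left (abs_nonneg _) (by linarith [pi_gt_three])

lemma continuousOn_besselKC_I_mul :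
    ContinuousOn (fun t : ℝ => besselKC (Complex.I * t)) (Set.Ioi 0) := fun t ht =>
  (ContinuousAt.comp (f := fun t : ℝ => Complex.I * (t : ℂ)) (differentiableAt_besselKC
    (z := Complex.I * t) (by simp) (Or.inr (by simpa using ht))).continuousAt
    (by fun_prop)).continuousWithinAt

lemma integrableOn_abs_besselJ_pow_mul_norm_besselKC :
    IntegrableOn (fun t => t * |besselJ t| ^ 3 * ‖besselKC (Complex.I * t)‖ ^ 2) (Set.Ioi 0) := by
  have hcont : ContinuousOn (fun t => t * |besselJ t| ^ 3 * ‖besselKC (Complex.I * t)‖ ^ 2)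
      (Set.Ioi 0) := by
    have h1 := continuousOn_besselKC_I_mul.norm
    have h2 : ContinuousOn besselJ (Set.Ioi 0) := continuous_besselJ.continuousOn
    exact (continuousOn_id.mul (h2.abs.pow 3)).mul (h1.pow 2)
  have hbd : ∀ t : ℝ, 0 < t → t * |besselJ t| ^ 3 * ‖besselKC (Complex.I * t)‖ ^ 2 ≤
      t * ‖besselKC (Complex.I * t)‖ ^ 5 := fun t ht => by
    calc _ ≤ t * ‖besselKC (Complex.I * t)‖ ^ 3 * ‖besselKC (Complex.I * t)‖ ^ 2 := by
          gcongr
          exact abs_besselJ_le_norm_besselKC ht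
      _ = _ := by ring
  have hnorm : ∀ (s C : ℝ), (∀ z : ℂ, 0 ≤ z.re → z ≠ 0 →
      ‖besselKC z‖ ≤ C * ‖z‖ ^ (s - 1 / 2) * exp (-z.re)) → ∀ t : ℝ, 0 < t →
      t * ‖besselKC (Complex.I * t)‖ ^ 5 ≤ C ^ 5 * t ^ (1 + (s - 1 / 2) * (5 : ℕ)) := by
    intro s C h t ht
    have := h (Complex.I * t) (by simp) (by simp [ht.ne'])
    rw [norm_mul, Complex.norm_I, one_mul, Complex.norm_real, norm_of_nonneg ht.le] at this
    have h2 := pow_le_pow_left₀ (norm_nonneg _) this 5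
    refine (mul_le_mul_of_nonneg_left h2 ht.le).trans (le_of_eq ?_)
    rw [mul_pow, mul_pow, ← rpow_mul_natCast ht.le, rpow_add ht, rpow_one]
    simp
    ring
  rw [← Set.Ioc_union_Ioi_eq_Ioi zero_le_one]
  refine IntegrableOn.union ?_ ?_
  · obtain ⟨C, hC, hK⟩ := exists_norm_besselKC_le (3 / 8) (by norm_num) le_rfl
    have hi : IntegrableOn (fun t : ℝ => C ^ 5 * t ^ (1 + (3 / 8 - 1 / 2) * (5 : ℕ) : ℝ))
        (Set.Ioc 0 1) := by
      rw [← intervalIntegrable_iff_integrableOn_Ioc_of_le zero_le_one]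
      exact (intervalIntegral.intervalIntegrable_rpow' (by norm_num)).const_mul _
    refine Integrable.mono' hi ((hcont.mono fun x hx => hx.1).aestronglyMeasurable
      measurableSet_Ioc) ((ae_restrict_iff' measurableSet_Ioc).2
        (Eventually.of_forall fun t ht => ?_))
    have ht' : 0 < t := ht.1
    rw [norm_of_nonneg (by positivity)]
    exact (hbd t ht').trans (hnorm _ C hK t ht')
  · obtain ⟨C, hC, hK⟩ := exists_norm_besselKC_le 0 le_rfl (by norm_num)
    have hi : IntegrableOn (fun t : ℝ => C ^ 5 * t ^ (1 + (0 - 1 / 2) * (5 : ℕ) : ℝ))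
        (Set.Ioi 1) :=
      (integrableOn_Ioi_rpow_of_lt (by norm_num) zero_lt_one).const_mul _
    refine Integrable.mono' hi ((hcont.mono fun x hx =>
      zero_lt_one.trans (show (1 : ℝ) < x from hx)).aestronglyMeasurable
      measurableSet_Ioi) ((ae_restrict_iff' measurableSet_Ioi).2
        (Eventually.of_forall fun t ht => ?_))
    have ht' : 0 < t := zero_lt_one.trans (show (1 : ℝ) < t from ht)
    rw [norm_of_nonneg (by positivity)]
    exact (hbd t ht').trans (hnorm _ C hK t ht')

lemma integrableOn_besselJ_pow_mul_norm_besselKC :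
    IntegrableOn (fun t => t * besselJ t ^ 3 * ‖besselKC (Complex.I * t)‖ ^ 2) (Set.Ioi 0) := by
  refine Integrable.mono integrableOn_abs_besselJ_pow_mul_norm_besselKC ?_
    (Eventually.of_forall fun t => ?_)
  · have h1 := continuousOn_besselKC_I_mul.norm
    have h2 : ContinuousOn besselJ (Set.Ioi 0) := continuous_besselJ.continuousOn
    exact ((continuousOn_id.mul (h2.pow 3)).mul (h1.pow 2)).aestronglyMeasurable measurableSet_Ioi
  · simp

lemma besselContour_boundary {R : ℝ} (hR : 0 < R) :
    (∫ x in (0 : ℝ)..R, besselContour x) - (∫ x in (0 : ℝ)..R, besselContour (x + Complex.I * R)) +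
      (∫ y in (0 : ℝ)..R, besselContour (R + Complex.I * y) * Complex.I) -
      ∫ y in (0 : ℝ)..R, besselContour (Complex.I * y) * Complex.I = 0 := by
  have h := Complex.integral_boundary_rect_eq_zero_of_continuousOn_of_differentiableOn
    besselContour 0 (R + R * Complex.I) ?_ ?_
  · simp only [Complex.zero_re, Complex.zero_im, Complex.add_re, Complex.add_im, Complex.ofReal_re,
      Complex.ofReal_im, Complex.mul_re, Complex.mul_im, Complex.I_re, Complex.I_im, mul_zero,
      zero_mul, sub_zero, add_zero, zero_add, Complex.ofReal_zero, smul_eq_mul,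
      mul_comm _ Complex.I, one_mul] at h
    simp only [intervalIntegral.integral_mul_const]
    linear_combination h
  · refine continuousOn_besselContour.mono fun z hz => ?_
    rw [Complex.mem_reProdIm] at hz
    simp [Set.uIcc_of_le hR.le] at hz
    exact ⟨hz.1.1, hz.2.1⟩
  · intro z hz
    rw [Complex.mem_reProdIm] at hz
    simp [min_eq_left hR.le, max_eq_right hR.le] at hz
    exact (differentiableAt_besselContour hz.1.1.le (Or.inl hz.1.1)).differentiableWithinAt

lemma tendsto_besselContour_top : Tendsto
    (fun R : ℝ => ∫ x in (0 : ℝ)..R, besselContour (x + Complex.I * R)) atTop (𝓝 0) := by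
  obtain ⟨M, hM0, hM⟩ := exists_norm_besselContour_le_far
  have h0 : Tendsto (fun R : ℝ => M * R ^ (-(1 / 2) : ℝ)) atTop (𝓝 0) := by
    simpa using (tendsto_rpow_neg_atTop (y := 1 / 2) (by norm_num)).const_mul M
  refine squeeze_zero_norm' ?_ h0
  filter_upwards [eventually_ge_atTop 1] with R hR
  have hR0 : (0 : ℝ) < R := by linarith
  have hb : ∀ x ∈ Set.Ioc 0 R, ‖besselContour (x + Complex.I * R)‖ ≤
      M * R ^ (-(1 / 2) : ℝ) * exp (-x) := by
    intro x hx
    have hn : R ≤ ‖(x + Complex.I * R : ℂ)‖ := by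
      have := (le_abs_self _).trans (Complex.abs_im_le_norm (x + Complex.I * R))
      simpa using this
    refine (hM _ (by simpa using hx.1.le) (hR.trans hn)).trans ?_
    have e : (x + Complex.I * R : ℂ).re = x := by simp
    rw [e]
    have := rpow_le_rpow_of_nonpos (z := -(1 / 2)) hR0 hn (by norm_num)
    gcongr
  have he : IntegrableOn (fun x : ℝ => exp (-x)) (Set.Ioi 0) := integrableOn_exp_neg_Ioi 0
  rw [intervalIntegral.integral_of_le hR0.le]
  refine (norm_integral_le_of_norm_le (g := fun x => M * R ^ (-(1 / 2) : ℝ) * exp (-x))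
    ((he.mono_set Set.Ioc_subset_Ioi_self).const_mul _)
    ((ae_restrict_iff' measurableSet_Ioc).2 (Eventually.of_forall hb))).trans ?_
  rw [integral_const_mul]
  refine mul_le_of_le_one_right (by positivity) ?_
  calc _ ≤ ∫ x in Set.Ioi (0 : ℝ), exp (-x) :=
        setIntegral_mono_set he (Eventually.of_forall fun x => (exp_pos _).le)
          (Set.Ioc_subset_Ioi_self).eventuallyLE
    _ = 1 := by rw [integral_exp_neg_Ioi]; simp

lemma tendsto_besselContour_right : Tendsto
    (fun R : ℝ => ∫ y in (0 : ℝ)..R, besselContour (R + Complex.I * y) * Complex.I)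
    atTop (𝓝 0) := by
  obtain ⟨M, hM0, hM⟩ := exists_norm_besselContour_le_far
  have h0 : Tendsto (fun R : ℝ => M * (R ^ 1 * exp (-R))) atTop (𝓝 0) := by
    simpa using (tendsto_pow_mul_exp_neg_atTop_nhds_zero 1).const_mul M
  refine squeeze_zero_norm' ?_ h0
  filter_upwards [eventually_ge_atTop 1] with R hR
  have hR0 : (0 : ℝ) < R := by linarith
  have := intervalIntegral.norm_integral_le_of_norm_le_const (a := 0) (b := R)
    (f := fun y : ℝ => besselContour (R + Complex.I * y) * Complex.I) (C := M * exp (-R)) ?_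
  · rw [sub_zero, abs_of_pos hR0] at this
    linarith
  intro y hy
  have e : (R + Complex.I * y : ℂ).re = R := by simp
  have hn : R ≤ ‖(R + Complex.I * y : ℂ)‖ := by
    have := (le_abs_self _).trans (Complex.abs_re_le_norm (R + Complex.I * y))
    rwa [e] at this
  rw [norm_mul, Complex.norm_I, mul_one]
  refine (hM _ (by rw [e]; exact hR0.le) (hR.trans hn)).trans ?_
  rw [e, mul_assoc]
  gcongr
  exact mul_le_of_le_one_left (exp_pos _).le
    (rpow_le_one_of_one_le_of_nonpos (hR.trans hn) (by norm_num))

/-- Contour rotation of the Bessel moment to the imaginary axis. -/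
theorem integral_besselIR_mul_besselK_pow :
    ∫ t in Set.Ioi (0 : ℝ), t * besselIR t * besselK t ^ 4 = π ^ 2 / 10 *
      ∫ t in Set.Ioi (0 : ℝ), t * besselJ t ^ 3 * ‖besselKC (Complex.I * t)‖ ^ 2 := by
  have h1 := intervalIntegral_tendsto_integral_Ioi 0 integrableOn_besselIR_mul_besselK tendsto_id
  have h2 := intervalIntegral_tendsto_integral_Ioi 0 integrableOn_besselJ_pow_mul_norm_besselKC
    tendsto_id
  have h3 := (Complex.continuous_re.tendsto _).comp
    (tendsto_besselContour_top.sub tendsto_besselContour_right)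
  rw [sub_zero, Complex.zero_re] at h3
  refine tendsto_nhds_unique h1 ?_
  have h4 := (h2.const_mul (π ^ 2 / 10)).add h3
  rw [add_zero] at h4
  refine h4.congr' ?_
  filter_upwards [eventually_gt_atTop 0] with R hR
  have hre : ∀ g : ℝ → ℂ, ContinuousOn g (Set.Icc 0 R) →
      (∫ x in (0 : ℝ)..R, g x).re = ∫ x in (0 : ℝ)..R, (g x).re := by
    intro g hg
    have hgi : IntervalIntegrable g volume 0 R :=
      (by rwa [Set.uIcc_of_le hR.le] : ContinuousOn g (Set.uIcc 0 R)).intervalIntegrable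
    exact (Complex.reCLM.intervalIntegral_comp_comm hgi).symm
  have hc1 : ContinuousOn (fun x : ℝ => besselContour x) (Set.Icc 0 R) :=
    continuousOn_besselContour.comp Complex.continuous_ofReal.continuousOn
      fun x hx => by simpa using hx.1
  have hc2 : ContinuousOn (fun y : ℝ => besselContour (Complex.I * y) * Complex.I)
      (Set.Icc 0 R) :=
    (continuousOn_besselContour.comp (f := fun y : ℝ => Complex.I * (y : ℂ))
      (by fun_prop : Continuous fun y : ℝ => Complex.I * (y : ℂ)).continuousOn
      fun x hx => by simpa using hx.1).mul_const _
  have hb := congrArg Complex.re (besselContour_boundary hR)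
  simp only [Complex.add_re, Complex.sub_re, Complex.zero_re] at hb
  rw [hre _ hc1, hre _ hc2] at hb
  have e1 : ∫ x in (0 : ℝ)..R, (besselContour x).re =
      ∫ x in (0 : ℝ)..R, x * besselIR x * besselK x ^ 4 := by
    refine intervalIntegral.integral_congr_ae (Eventually.of_forall fun x hx => ?_)
    rw [Set.uIoc_of_le hR.le] at hx
    exact besselContour_ofReal_re hx.1
  have e2 : ∫ x in (0 : ℝ)..R, (besselContour (Complex.I * x) * Complex.I).re = π ^ 2 / 10 *
      ∫ x in (0 : ℝ)..R, x * besselJ x ^ 3 * ‖besselKC (Complex.I * x)‖ ^ 2 := by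
    rw [← intervalIntegral.integral_const_mul]
    refine intervalIntegral.integral_congr_ae (Eventually.of_forall fun x hx => ?_)
    rw [Set.uIoc_of_le hR.le] at hx
    exact besselContour_I_mul_re hx.1
  rw [e1, e2] at hb
  simp only [Function.comp, id, Complex.sub_re]
  linarith

lemma integral_comp_add_of_periodic {f : ℝ → ℝ} (hf : Function.Periodic f (2 * π)) (α : ℝ) :
    ∫ θ in (-π)..π, f (α + θ) = ∫ θ in (-π)..π, f θ := by
  rw [intervalIntegral.integral_comp_add_left (fun θ => f θ)]
  have := hf.intervalIntegral_add_eq (α + -π) (-π)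
  rwa [show α + -π + 2 * π = α + π by ring, show -π + 2 * π = π by ring] at this

lemma besselJ_sqrt (A B : ℝ) :
    besselJ (√(A ^ 2 + B ^ 2)) = 1 / (2 * π) * ∫ θ in (-π)..π, cos (A * cos θ - B * sin θ) := by
  set w : ℂ := A + B * Complex.I
  have hn : ‖w‖ = √(A ^ 2 + B ^ 2) := Complex.norm_add_mul_I A B
  have hA : ‖w‖ * cos w.arg = A := by rw [Complex.norm_mul_cos_arg]; simp [w]
  have hB : ‖w‖ * sin w.arg = B := by rw [Complex.norm_mul_sin_arg]; simp [w]
  rw [← hn, besselJ, ← integral_comp_add_of_periodic (f := fun θ => cos (‖w‖ * cos θ)) _ w.arg]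
  · congr 2
    ext θ
    rw [cos_add]
    congr 1
    rw [← hA, ← hB]
    ring_nf
  · intro θ
    simp only [cos_add_two_pi]

lemma integral_sin_mul_cos (b : ℝ) : ∫ θ in (-π)..π, sin (b * cos θ) = 0 := by
  have h := integral_comp_add_of_periodic (f := fun θ => sin (b * cos θ))
    (fun θ => by simp only [cos_add_two_pi]) π
  have e : ∀ θ, sin (b * cos (π + θ)) = -sin (b * cos θ) := fun θ => by
    rw [add_comm, cos_add_pi, mul_neg, sin_neg]
  simp only [e] at h
  rw [intervalIntegral.integral_neg] at h
  linarith

lemma integral_eq_two_mul_of_even {f : ℝ → ℝ} (hf : ∀ x, f (-x) = f x) (hc : Continuous f) (a : ℝ) :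
    ∫ θ in (-a)..a, f θ = 2 * ∫ θ in (0 : ℝ)..a, f θ := by
  rw [← intervalIntegral.integral_add_adjacent_intervals (hc.intervalIntegrable (-a) 0)
    (hc.intervalIntegrable 0 a)]
  have := intervalIntegral.integral_comp_neg f (a := 0) (b := a)
  simp only [hf, neg_zero] at this
  rw [← this]
  ring

/-- The product formula for `J₀`. -/
lemma besselJ_mul_besselJ (a b : ℝ) : besselJ a * besselJ b =
    1 / π * ∫ φ in (0 : ℝ)..π, besselJ (√(a ^ 2 + b ^ 2 + 2 * a * b * cos φ)) := by
  have hJ := continuous_besselJ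
  have h1 : 2 * ∫ φ in (0 : ℝ)..π, besselJ (√(a ^ 2 + b ^ 2 + 2 * a * b * cos φ)) =
      ∫ φ in (-π)..π, besselJ (√(a ^ 2 + b ^ 2 + 2 * a * b * cos φ)) := by
    rw [integral_eq_two_mul_of_even (fun x => by rw [cos_neg]) (by fun_prop)]
  have h2 : ∀ φ, besselJ (√(a ^ 2 + b ^ 2 + 2 * a * b * cos φ)) =
      1 / (2 * π) * ∫ θ in (-π)..π, cos (a * cos θ + b * cos (θ + φ)) := by
    intro φ
    rw [show a ^ 2 + b ^ 2 + 2 * a * b * cos φ = (a + b * cos φ) ^ 2 + (b * sin φ) ^ 2 by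
      linear_combination (-b ^ 2) * sin_sq_add_cos_sq φ, besselJ_sqrt]
    congr 2
    ext θ
    rw [cos_add θ φ]
    ring_nf
  have h3 : ∫ φ in (-π)..π, ∫ θ in (-π)..π, cos (a * cos θ + b * cos (θ + φ)) =
      ∫ θ in (-π)..π, ∫ φ in (-π)..π, cos (a * cos θ + b * cos (θ + φ)) := by
    refine intervalIntegral_intervalIntegral_swap ?_
    rw [Set.uIoc_of_le (by linarith [pi_pos])]
    exact ((Continuous.continuousOn (by simp only [Function.uncurry_def]; fun_prop)).integrableOn_compact
      (isCompact_Icc.prod isCompact_Icc)).mono_set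
      (Set.prod_mono Set.Ioc_subset_Icc_self Set.Ioc_subset_Icc_self)
  have h4 : ∀ θ, ∫ φ in (-π)..π, cos (a * cos θ + b * cos (θ + φ)) =
      cos (a * cos θ) * (2 * π * besselJ b) := by
    intro θ
    rw [integral_comp_add_of_periodic (f := fun φ => cos (a * cos θ + b * cos φ))
      (fun θ => by simp only [cos_add_two_pi])]
    simp only [cos_add]
    rw [intervalIntegral.integral_sub (Continuous.intervalIntegrable (by fun_prop) _ _)
      (Continuous.intervalIntegrable (by fun_prop) _ _), intervalIntegral.integral_const_mul,
      intervalIntegral.integral_const_mul, integral_sin_mul_cos, besselJ]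
    field_simp
    ring
  simp only [h2] at h1
  rw [intervalIntegral.integral_const_mul (1 / (2 * π)), intervalIntegral.integral_const_mul,
    h3] at h1
  simp only [h4] at h1
  rw [intervalIntegral.integral_mul_const] at h1
  simp only [h2]
  rw [intervalIntegral.integral_const_mul]
  have ha : ∫ θ in (-π)..π, cos (a * cos θ) = 2 * π * besselJ a := by
    rw [besselJ]; field_simp
  rw [ha] at h1
  generalize (∫ φ in (0 : ℝ)..π, ∫ θ in (-π)..π, cos (a * cos θ + b * cos (θ + φ))) = Q at *
  have := pi_ne_zero
  field_simp at h1 ⊢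
  linarith

lemma integral_mul_besselJ_mul_exp {p : ℝ} (hp : 0 < p) (b : ℝ) :
    ∫ t in Set.Ioi (0 : ℝ), t * besselJ (b * t) * exp (-p * t ^ 2) =
      exp (-(b ^ 2 / (4 * p))) / (2 * p) := by
  have h := integral_mul_besselI_mul_exp hp (Complex.I * b)
  have h2 : ∀ t : ℝ, (t : ℂ) * besselI (Complex.I * b * t) * Complex.exp (-p * t ^ 2) =
      ((t * besselJ (b * t) * exp (-p * t ^ 2) : ℝ) : ℂ) := fun t => by
    rw [mul_assoc Complex.I, ← Complex.ofReal_mul b t, besselI_I_mul]; push_cast; rfl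
  simp_rw [h2] at h
  rw [integral_complex_ofReal, mul_pow, Complex.I_sq, neg_one_mul, neg_div] at h
  exact_mod_cast h

lemma besselK_eq_integral {c t : ℝ} (hc : 0 < c) (ht : 0 < t) :
    ∫ u : ℝ, exp (-(t ^ 2 * exp u + c ^ 2 / 4 * exp (-u))) = 2 * besselK (c * t) := by
  rw [integral_eq_lintegral_of_nonneg_ae (Eventually.of_forall fun u => (exp_pos _).le)
    (Continuous.aestronglyMeasurable (by fun_prop))]
  change (besselKE (t ^ 2) (c ^ 2 / 4)).toReal = _
  have hK := besselKE_self (x := c * t) (by positivity)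
  rw [besselKE_eq (by positivity) (t ^ 2) (by positivity) (by positivity),
    show c * t / 2 * (c * t / 2) / t ^ 2 = c ^ 2 / 4 by field_simp; ring] at hK
  rw [hK, ENNReal.toReal_ofReal (mul_nonneg zero_le_two (besselK_nonneg _))]

lemma integrable_exp_neg_mul_exp_div {a : ℝ} (ha : 0 < a) :
    Integrable fun u : ℝ => exp (-(a * exp (-u))) * exp (-u) := by
  refine ⟨Continuous.aestronglyMeasurable (by fun_prop), ?_⟩
  rw [hasFiniteIntegral_iff_ofReal (Eventually.of_forall fun u => by positivity),
    lintegral_exp_neg_mul_exp_div ha]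
  exact ENNReal.ofReal_lt_top

lemma integral_exp_neg_mul_exp_div {a : ℝ} (ha : 0 < a) :
    ∫ u : ℝ, exp (-(a * exp (-u))) * exp (-u) = 1 / a := by
  rw [integral_eq_lintegral_of_nonneg_ae (Eventually.of_forall fun u => by positivity)
    (Continuous.aestronglyMeasurable (by fun_prop)), lintegral_exp_neg_mul_exp_div ha,
    ENNReal.toReal_ofReal (by positivity)]

lemma integral_mul_exp_quadratic {p : ℝ} (hp : 0 < p) :
    ∫ t in Set.Ioi (0 : ℝ), t * exp (-p * t ^ 2) = 1 / (2 * p) := by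
  have h := integral_mul_cexp_neg_mul_sq (b := p) (by simpa using hp)
  have h2 : ∀ t : ℝ, (t : ℂ) * Complex.exp (-p * t ^ 2) =
      ((t * exp (-p * t ^ 2) : ℝ) : ℂ) := fun t => by push_cast; rfl
  simp_rw [h2] at h
  rw [integral_complex_ofReal] at h
  rw [one_div]
  exact_mod_cast h

lemma integrable_gaussian_kernel {c : ℝ} (hc : 0 < c) :
    Integrable (fun x : ℝ × ℝ => x.1 * exp (-(x.1 ^ 2 * exp x.2 + c ^ 2 / 4 * exp (-x.2))))
      ((volume.restrict (Set.Ioi 0)).prod volume) := by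
  have hsplit : ∀ t u : ℝ, t * exp (-(t ^ 2 * exp u + c ^ 2 / 4 * exp (-u))) =
      exp (-(c ^ 2 / 4 * exp (-u))) * (t * exp (-exp u * t ^ 2)) := by
    intro t u
    rw [mul_left_comm, ← exp_add]
    congr 2
    ring
  refine (integrable_prod_iff' (Continuous.aestronglyMeasurable (by fun_prop))).2 ⟨?_, ?_⟩
  · refine Eventually.of_forall fun u => ?_
    simp only [hsplit]
    exact ((integrable_mul_exp_neg_mul_sq (exp_pos u)).integrableOn).const_mul _
  · have : ∀ u : ℝ, ∫ t in Set.Ioi (0 : ℝ),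
        ‖t * exp (-(t ^ 2 * exp u + c ^ 2 / 4 * exp (-u)))‖ =
        1 / 2 * (exp (-(c ^ 2 / 4 * exp (-u))) * exp (-u)) := by
      intro u
      have : ∫ t in Set.Ioi (0 : ℝ), ‖t * exp (-(t ^ 2 * exp u + c ^ 2 / 4 * exp (-u)))‖ =
          ∫ t in Set.Ioi (0 : ℝ), exp (-(c ^ 2 / 4 * exp (-u))) * (t * exp (-exp u * t ^ 2)) := by
        refine setIntegral_congr_fun measurableSet_Ioi fun t ht => ?_
        have ht' : (0 : ℝ) < t := ht
        rw [norm_of_nonneg (by positivity), hsplit]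
      rw [this, integral_const_mul, integral_mul_exp_quadratic (exp_pos u), exp_neg u]
      field_simp
    simp only [this]
    exact (integrable_exp_neg_mul_exp_div (by positivity)).const_mul _

lemma integral_mul_besselJ_mul_besselK {c : ℝ} (hc : 0 < c) (b : ℝ) :
    ∫ t in Set.Ioi (0 : ℝ), t * besselJ (b * t) * besselK (c * t) = 1 / (b ^ 2 + c ^ 2) := by
  have hJ := continuous_besselJ
  have hF : Integrable (Function.uncurry fun t u : ℝ => besselJ (b * t) *
      (t * exp (-(t ^ 2 * exp u + c ^ 2 / 4 * exp (-u)))))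
      ((volume.restrict (Set.Ioi 0)).prod volume) := by
    refine (integrable_gaussian_kernel hc).mono (Continuous.aestronglyMeasurable
      (by simp only [Function.uncurry_def]; fun_prop)) (Eventually.of_forall fun x => ?_)
    simp only [Function.uncurry_def]
    rw [norm_mul]
    exact mul_le_of_le_one_left (norm_nonneg _) (abs_besselJ_le _)
  have h1 : 2 * ∫ t in Set.Ioi (0 : ℝ), t * besselJ (b * t) * besselK (c * t) =
      ∫ t in Set.Ioi (0 : ℝ), ∫ u : ℝ, besselJ (b * t) *
      (t * exp (-(t ^ 2 * exp u + c ^ 2 / 4 * exp (-u)))) := by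
    rw [← integral_const_mul]
    refine setIntegral_congr_fun measurableSet_Ioi fun t ht => ?_
    rw [integral_const_mul, integral_const_mul, besselK_eq_integral hc ht]
    ring
  have h2 : ∀ u : ℝ, ∫ t in Set.Ioi (0 : ℝ), besselJ (b * t) *
      (t * exp (-(t ^ 2 * exp u + c ^ 2 / 4 * exp (-u)))) =
      1 / 2 * (exp (-((b ^ 2 + c ^ 2) / 4 * exp (-u))) * exp (-u)) := by
    intro u
    have e : ∀ t : ℝ, besselJ (b * t) * (t * exp (-(t ^ 2 * exp u + c ^ 2 / 4 * exp (-u)))) =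
        exp (-(c ^ 2 / 4 * exp (-u))) * (t * besselJ (b * t) * exp (-exp u * t ^ 2)) := by
      intro t
      rw [show -(t ^ 2 * exp u + c ^ 2 / 4 * exp (-u)) =
        -(c ^ 2 / 4 * exp (-u)) + -exp u * t ^ 2 by ring, exp_add]
      ring
    simp only [e]
    rw [integral_const_mul, integral_mul_besselJ_mul_exp (exp_pos u),
      show -((b ^ 2 + c ^ 2) / 4 * exp (-u)) =
        -(c ^ 2 / 4 * exp (-u)) + -(b ^ 2 / (4 * exp u)) by
          rw [exp_neg]; field_simp; ring, exp_add, exp_neg u]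
    field_simp
  rw [integral_integral_swap hF] at h1
  simp only [h2] at h1
  rw [integral_const_mul, integral_exp_neg_mul_exp_div (by positivity)] at h1
  have : (0 : ℝ) < b ^ 2 + c ^ 2 := by positivity
  generalize (∫ t in Set.Ioi (0 : ℝ), t * besselJ (b * t) * besselK (c * t)) = Q at h1 ⊢
  field_simp at h1 ⊢
  linarith

lemma integral_Ioi_inv_add_mul_sq {P Q : ℝ} (hP : 0 < P) (hQ : 0 < Q) :
    ∫ x in Set.Ioi (0 : ℝ), 1 / (P + Q * x ^ 2) = π / (2 * √(P * Q)) := by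
  have h := integral_comp_mul_left_Ioi (fun y : ℝ => (1 + y ^ 2)⁻¹) 0 (b := √(Q / P)) (by positivity)
  rw [mul_zero, integral_Ioi_inv_one_add_sq, arctan_zero, sub_zero, smul_eq_mul] at h
  have e : ∀ x : ℝ, 1 / (P + Q * x ^ 2) = P⁻¹ * (1 + (√(Q / P) * x) ^ 2)⁻¹ := by
    intro x
    rw [mul_pow, sq_sqrt (by positivity), ← mul_inv, one_div]
    congr 1
    field_simp
  simp only [e]
  have hs : √(P * Q) = P * √(Q / P) := by
    rw [show P * Q = P ^ 2 * (Q / P) by field_simp, sqrt_mul (by positivity), sqrt_sq hP.le]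
  rw [integral_const_mul, h, hs]
  have : 0 < √(Q / P) := by positivity
  field_simp

lemma integral_inv_add_mul_cos {A B : ℝ} (h1 : 0 < A + B) (h2 : 0 < A - B) :
    ∫ ψ in (0 : ℝ)..π, 1 / (A + B * cos ψ) = π / √((A + B) * (A - B)) := by
  have h := intervalIntegral.integral_comp_mul_left (a := 0) (b := π / 2)
    (fun ψ => 1 / (A + B * cos ψ)) (c := 2) two_ne_zero
  rw [mul_zero, show 2 * (π / 2) = π by ring, smul_eq_mul] at h
  have h3 := integral_Ioi_inv_add_mul_sq h1 h2
  rw [integral_Ioi_eq_integral_tan] at h3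
  have h4 : ∫ θ in (0 : ℝ)..(π / 2), 1 / (A + B * cos (2 * θ)) =
      ∫ θ in (0 : ℝ)..(π / 2), 1 / (A + B + (A - B) * tan θ ^ 2) / cos θ ^ 2 := by
    rw [intervalIntegral.integral_of_le (by positivity),
      intervalIntegral.integral_of_le (by positivity), integral_Ioc_eq_integral_Ioo,
      integral_Ioc_eq_integral_Ioo]
    refine setIntegral_congr_fun measurableSet_Ioo fun θ hθ => ?_
    have hc := cos_pos_of_mem_Ioo_zero hθ
    rw [div_div, tan_eq_sin_div_cos, cos_two_mul, div_pow, sin_sq]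
    congr 1
    field_simp
    ring
  rw [h4, h3] at h
  generalize (∫ ψ in (0 : ℝ)..π, 1 / (A + B * cos ψ)) = W at h ⊢
  have : 0 < √((A + B) * (A - B)) := by positivity
  field_simp at h ⊢
  linarith

lemma besselJ_zero : besselJ 0 = 1 := by
  simp only [besselJ, zero_mul, cos_zero, intervalIntegral.integral_const]
  have := pi_pos
  simp only [smul_eq_mul]
  field_simp
  ring

lemma integrableOn_mul_besselK {c : ℝ} (hc : 0 < c) :
    IntegrableOn (fun t => t * besselK (c * t)) (Set.Ioi 0) := by
  have h := integral_mul_besselJ_mul_besselK hc 0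
  simp only [zero_mul, besselJ_zero, mul_one] at h
  by_contra hn
  rw [integral_undef hn] at h
  have : (0 : ℝ) < 1 / (0 ^ 2 + c ^ 2) := by positivity
  linarith

/-- Exchange of a bounded angular average with the Bessel weight. -/
lemma integral_mul_integral_besselK {c : ℝ} (hc : 0 < c) {F : ℝ → ℝ → ℝ}
    (hF : Continuous (Function.uncurry F)) (hb : ∀ t φ, |F t φ| ≤ 1) :
    ∫ t in Set.Ioi (0 : ℝ), t * (∫ φ in (0 : ℝ)..π, F t φ) * besselK (c * t) =
      ∫ φ in (0 : ℝ)..π, ∫ t in Set.Ioi (0 : ℝ), t * F t φ * besselK (c * t) := by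
  have hK := measurable_besselK
  have hFm := hF.measurable
  have hI : Integrable (Function.uncurry fun t φ : ℝ => t * F t φ * besselK (c * t))
      ((volume.restrict (Set.Ioi 0)).prod (volume.restrict (Set.Ioc 0 π))) := by
    have h1 : Integrable (fun _ : ℝ => (1 : ℝ)) (volume.restrict (Set.Ioc 0 π)) :=
      integrable_const _
    have h0 : Integrable (fun t => t * besselK (c * t)) (volume.restrict (Set.Ioi 0)) :=
      integrableOn_mul_besselK hc
    have h2 := Integrable.mul_prod h0 h1
    refine h2.mono (Measurable.aestronglyMeasurable ?_) (Eventually.of_forall fun x => ?_)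
    · refine Measurable.mul (Measurable.mul measurable_fst hFm) (hK.comp (by fun_prop))
    · simp only [Function.uncurry_def, mul_one, norm_mul]
      refine mul_le_mul_of_nonneg_right (mul_le_of_le_one_right (norm_nonneg _) (hb _ _))
        (norm_nonneg _)
  have := integral_integral_swap hI
  rw [intervalIntegral.integral_of_le pi_pos.le, ← this]
  refine setIntegral_congr_fun measurableSet_Ioi fun t _ => ?_
  rw [intervalIntegral.integral_of_le pi_pos.le, ← integral_const_mul, ← integral_mul_const]

lemma integral_mul_besselJ_mul_besselJ_mul_besselK {c : ℝ} (hc : 0 < c) (b : ℝ) :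
    ∫ t in Set.Ioi (0 : ℝ), t * (besselJ t * besselJ (b * t)) * besselK (c * t) =
      1 / √(quadDisc (b ^ 2) (c ^ 2)) := by
  have hJ := continuous_besselJ
  have e : ∀ t : ℝ, t * (besselJ t * besselJ (b * t)) * besselK (c * t) =
      1 / π * (t * (∫ ψ in (0 : ℝ)..π, besselJ (√(1 + b ^ 2 + 2 * b * cos ψ) * |t|)) *
        besselK (c * t)) := by
    intro t
    rw [besselJ_mul_besselJ]
    have : ∀ ψ, √(t ^ 2 + (b * t) ^ 2 + 2 * t * (b * t) * cos ψ) =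
        √(1 + b ^ 2 + 2 * b * cos ψ) * |t| := by
      intro ψ
      rw [← sqrt_sq_eq_abs, ← sqrt_mul' _ (sq_nonneg t)]
      congr 1
      ring
    simp only [this]
    ring
  simp only [e]
  rw [integral_const_mul, integral_mul_integral_besselK hc
    (by simp only [Function.uncurry_def]; fun_prop) (fun t φ => abs_besselJ_le _)]
  have h1 : ∀ ψ, ∫ t in Set.Ioi (0 : ℝ), t * besselJ (√(1 + b ^ 2 + 2 * b * cos ψ) * |t|) *
      besselK (c * t) = 1 / ((1 + b ^ 2 + c ^ 2) + 2 * b * cos ψ) := by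
    intro ψ
    have h0 : 0 ≤ 1 + b ^ 2 + 2 * b * cos ψ := by
      nlinarith [sq_nonneg (b + cos ψ), sin_sq_add_cos_sq ψ, sq_nonneg (sin ψ)]
    rw [show 1 + b ^ 2 + c ^ 2 + 2 * b * cos ψ = √(1 + b ^ 2 + 2 * b * cos ψ) ^ 2 + c ^ 2 by
      rw [sq_sqrt h0]; ring, ← integral_mul_besselJ_mul_besselK hc]
    refine setIntegral_congr_fun measurableSet_Ioi fun t ht => ?_
    rw [abs_of_pos (show (0 : ℝ) < t from ht)]
  simp only [h1]
  rw [integral_inv_add_mul_cos (by nlinarith [sq_nonneg (1 + b)]) (by nlinarith [sq_nonneg (1 - b)])]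
  rw [show (1 + b ^ 2 + c ^ 2 + 2 * b) * (1 + b ^ 2 + c ^ 2 - 2 * b) = quadDisc (b ^ 2) (c ^ 2) by
    unfold quadDisc; ring]
  have := pi_pos
  field_simp

lemma integral_mul_besselJ_cube_mul_besselK {c : ℝ} (hc : 0 < c) :
    ∫ t in Set.Ioi (0 : ℝ), t * besselJ t ^ 3 * besselK (c * t) =
      1 / π * ∫ φ in (0 : ℝ)..π, 1 / √(quadDisc (2 + 2 * cos φ) (c ^ 2)) := by
  have hJ := continuous_besselJ
  have e : ∀ t : ℝ, t * besselJ t ^ 3 * besselK (c * t) =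
      1 / π * (t * (∫ φ in (0 : ℝ)..π, besselJ t * besselJ (√(2 + 2 * cos φ) * |t|)) *
        besselK (c * t)) := by
    intro t
    have h := besselJ_mul_besselJ t t
    have : ∀ φ, √(t ^ 2 + t ^ 2 + 2 * t * t * cos φ) = √(2 + 2 * cos φ) * |t| := by
      intro φ
      rw [← sqrt_sq_eq_abs, ← sqrt_mul' _ (sq_nonneg t)]
      congr 1
      ring
    simp only [this] at h
    rw [intervalIntegral.integral_const_mul]
    linear_combination t * besselJ t * besselK (c * t) * h
  simp only [e]
  rw [integral_const_mul, integral_mul_integral_besselK hc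
    (by simp only [Function.uncurry_def]; fun_prop) (fun t φ => by
      rw [abs_mul]; exact mul_le_one₀ (abs_besselJ_le _) (abs_nonneg _) (abs_besselJ_le _))]
  congr 1
  refine intervalIntegral.integral_congr fun φ _ => ?_
  have h0 : 0 ≤ 2 + 2 * cos φ := by linarith [neg_one_le_cos φ]
  rw [show quadDisc (2 + 2 * cos φ) (c ^ 2) = quadDisc (√(2 + 2 * cos φ) ^ 2) (c ^ 2) by
    rw [sq_sqrt h0], ← integral_mul_besselJ_mul_besselJ_mul_besselK hc]
  refine setIntegral_congr_fun measurableSet_Ioi fun t ht => ?_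
  rw [abs_of_pos (show (0 : ℝ) < t from ht)]

lemma integrable_besselJ_cube_mul_besselK_sinh :
    Integrable (Function.uncurry fun t p : ℝ => t * besselJ t ^ 3 * besselK (2 * (t * sinh p)))
      ((volume.restrict (Set.Ioi 0)).prod (volume.restrict (Set.Ioi 0))) := by
  have hJ := continuous_besselJ
  refine (integrable_prod_iff (Measurable.aestronglyMeasurable ?_)).2 ⟨?_, ?_⟩
  · simp only [Function.uncurry_def]
    refine Measurable.mul (Continuous.measurable (by fun_prop)) (measurable_besselK.comp
      (Continuous.measurable (by fun_prop)))
  · refine (ae_restrict_iff' measurableSet_Ioi).2 (Eventually.of_forall fun t ht => ?_)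
    exact Integrable.const_mul (integrableOn_besselK_sinh ht) (t * besselJ t ^ 3)
  · refine Integrable.congr (integrableOn_abs_besselJ_pow_mul_norm_besselKC.const_mul (1 / 2)) ?_
    refine (ae_restrict_iff' measurableSet_Ioi).2 (Eventually.of_forall fun t ht => ?_)
    have ht' : (0 : ℝ) < t := ht
    simp only [Function.uncurry_def, norm_mul, norm_pow, norm_eq_abs, abs_of_pos ht',
      abs_of_nonneg (besselK_nonneg _)]
    rw [integral_const_mul, norm_besselKC_I_mul_sq ht']
    ring

lemma quadDisc_pos {m n : ℝ} (hn : 0 < n) : 0 < quadDisc m n := by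
  unfold quadDisc
  nlinarith [sq_nonneg (m - 1 + n), mul_pos hn hn]

theorem integral_besselJ_cube_mul_norm_besselKC :
    ∫ t in Set.Ioi (0 : ℝ), t * besselJ t ^ 3 * ‖besselKC (Complex.I * t)‖ ^ 2 =
      1 / (2 * π) * ∫ ω in (0 : ℝ)..π, ellK (97 / 128 - cos ω / 128) := by
  have h1 : ∫ t in Set.Ioi (0 : ℝ), t * besselJ t ^ 3 * ‖besselKC (Complex.I * t)‖ ^ 2 =
      2 * ∫ t in Set.Ioi (0 : ℝ), ∫ p in Set.Ioi (0 : ℝ),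
        t * besselJ t ^ 3 * besselK (2 * (t * sinh p)) := by
    rw [← integral_const_mul]
    refine setIntegral_congr_fun measurableSet_Ioi fun t ht => ?_
    rw [integral_const_mul, norm_besselKC_I_mul_sq ht]
    ring
  rw [h1, integral_integral_swap integrable_besselJ_cube_mul_besselK_sinh]
  have h2 : ∫ p in Set.Ioi (0 : ℝ), ∫ t in Set.Ioi (0 : ℝ),
        t * besselJ t ^ 3 * besselK (2 * (t * sinh p)) = ∫ p in Set.Ioi (0 : ℝ),
      1 / π * ∫ φ in (0 : ℝ)..π, 1 / √(quadDisc (2 + 2 * cos φ) (4 * sinh p ^ 2)) := by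
    refine setIntegral_congr_fun measurableSet_Ioi fun p hp => ?_
    have hs : 0 < sinh p := sinh_pos_iff.2 hp
    rw [show 4 * sinh p ^ 2 = (2 * sinh p) ^ 2 by ring,
      ← integral_mul_besselJ_cube_mul_besselK (by positivity)]
    simp only [mul_assoc, mul_comm, mul_left_comm]
  have hm : Measurable fun x : ℝ × ℝ => 1 / √(quadDisc (2 + 2 * cos x.2) (4 * sinh x.1 ^ 2)) := by
    unfold quadDisc
    fun_prop
  have h3 : ∫ p in Set.Ioi (0 : ℝ), ∫ φ in (0 : ℝ)..π,
      1 / √(quadDisc (2 + 2 * cos φ) (4 * sinh p ^ 2)) =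
      1 / 4 * ∫ ω in (0 : ℝ)..π, ellK (97 / 128 - cos ω / 128) := by
    have hpos : 0 ≤ 1 / 4 * ∫ ω in (0 : ℝ)..π, ellK (97 / 128 - cos ω / 128) := by
      refine mul_nonneg (by norm_num) (intervalIntegral.integral_nonneg pi_pos.le fun ω _ =>
        (ellK_pos ?_).le)
      linarith [neg_one_le_cos ω]
    have hin : ∀ p, ∫ φ in (0 : ℝ)..π, 1 / √(quadDisc (2 + 2 * cos φ) (4 * sinh p ^ 2)) =
        ∫ φ in Set.Ioo 0 π, 1 / √(quadDisc (2 + 2 * cos φ) (4 * sinh p ^ 2)) := fun p => by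
      rw [intervalIntegral.integral_of_le pi_pos.le, integral_Ioc_eq_integral_Ioo]
    simp only [hin]
    rw [integral_eq_lintegral_of_nonneg_ae (Eventually.of_forall fun p =>
        integral_nonneg fun φ => by positivity)
      (StronglyMeasurable.integral_prod_right (f := fun p φ : ℝ =>
        1 / √(quadDisc (2 + 2 * cos φ) (4 * sinh p ^ 2))) hm.stronglyMeasurable).aestronglyMeasurable,
      ← ENNReal.toReal_ofReal hpos, ← lintegral_quadDisc]
    congr 1
    refine setLIntegral_congr_fun measurableSet_Ioi fun p hp => ?_
    have hs : 0 < sinh p := sinh_pos_iff.2 hp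
    refine ofReal_integral_eq_lintegral_ofReal ?_ (Eventually.of_forall fun φ => by positivity)
    refine IntegrableOn.mono_set (t := Set.Icc 0 π) (Continuous.continuousOn ?_ |>.integrableOn_Icc)
      Set.Ioo_subset_Icc_self
    refine Continuous.div (by fun_prop) (by unfold quadDisc; fun_prop) fun φ => ?_
    have := quadDisc_pos (m := 2 + 2 * cos φ) (n := 4 * sinh p ^ 2)
      (by positivity)
    positivity
  rw [h2, integral_const_mul, h3]
  have := pi_pos
  field_simp
  norm_num

/-- The Feynman integral as a product of squared theta constants. -/
theorem integral_feynman_eq_theta {α β : ℝ} (hα : 0 < α) (h : α * β = 5) (hβ : β = 3 * α) :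
    ∫ x₁ in Set.Ioi (0 : ℝ), ∫ x₂ in Set.Ioi (0 : ℝ), ∫ x₃ in Set.Ioi (0 : ℝ),
      ((1 + x₁ + x₂ + x₃) * (1 + x₁⁻¹ + x₂⁻¹ + x₃⁻¹) - 1)⁻¹ / (x₁ * x₂ * x₃) =
    π ^ 3 / √15 * (t3 α ^ 2 * t3 β ^ 2) := by
  have hβ0 : 0 < β := by linarith
  obtain ⟨v1, v2, -⟩ := theta_values hα h hβ
  rw [integral_feynman, integral_besselIR_mul_besselK_pow, integral_besselJ_cube_mul_norm_besselKC,
    integral_ellK_level_fifteen, ← v1, ← v2, ellK_theta_compl hα, ellK_theta hβ0]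
  have hα15 : α * √15 = 5 := by
    have : α = √15 / 3 := by
      rw [eq_div_iff (by norm_num), eq_comm, sqrt_eq_iff_mul_self_eq (by norm_num) (by positivity)]
      subst hβ
      nlinarith
    rw [this, div_mul_eq_mul_div, mul_self_sqrt (by norm_num)]
    norm_num
  have := pi_pos
  have h15 : 0 < √15 := by positivity
  field_simp
  linear_combination (8 * t3 α ^ 2 * t3 β ^ 2) * hα15

/-- The Gaussian binomial coefficient. -/
noncomputable def gaussBinom (Q : ℂ) : ℕ → ℕ → ℂ
  | _, 0 => 1
  | 0, _ + 1 => 0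
  | N + 1, j + 1 => gaussBinom Q N j + Q ^ (j + 1) * gaussBinom Q N (j + 1)

/-- The finite `q`-Pochhammer product. -/
noncomputable def qPoch (Q : ℂ) (n : ℕ) : ℂ := ∏ i ∈ Finset.range n, (1 - Q ^ (i + 1))

lemma gaussBinom_zero_right (Q : ℂ) (N : ℕ) : gaussBinom Q N 0 = 1 := by
  cases N <;> rfl

lemma gaussBinom_succ_succ (Q : ℂ) (N j : ℕ) : gaussBinom Q (N + 1) (j + 1) =
    gaussBinom Q N j + Q ^ (j + 1) * gaussBinom Q N (j + 1) := rfl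

lemma gaussBinom_eq_zero (Q : ℂ) {N j : ℕ} (h : N < j) : gaussBinom Q N j = 0 := by
  induction N generalizing j with
  | zero => obtain ⟨j, rfl⟩ := Nat.exists_eq_succ_of_ne_zero h.ne'; rfl
  | succ N ih =>
    obtain ⟨j, rfl⟩ := Nat.exists_eq_succ_of_ne_zero (Nat.ne_zero_of_lt h)
    rw [Nat.succ_eq_add_one, gaussBinom_succ_succ, ih (by omega), ih (by omega)]
    ring

lemma prod_one_add_mul_pow (Q x : ℂ) (N : ℕ) : ∏ k ∈ Finset.range N, (1 + x * Q ^ k) =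
    ∑ j ∈ Finset.range (N + 1), Q ^ (j.choose 2) * gaussBinom Q N j * x ^ j := by
  induction N generalizing x with
  | zero => simp [gaussBinom_zero_right]
  | succ N ih =>
    have h1 : ∏ k ∈ Finset.range (N + 1), (1 + x * Q ^ k) =
        (1 + x) * ∏ k ∈ Finset.range N, (1 + x * Q * Q ^ k) := by
      rw [Finset.prod_range_succ', mul_comm]
      congr 1
      · ring
      · exact Finset.prod_congr rfl fun k _ => by ring
    have h2 : ∀ j : ℕ, (j + 1).choose 2 = j + j.choose 2 := fun j => by
      rw [Nat.choose_succ_succ' j 1, Nat.choose_one_right]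
    have h3 : ∑ j ∈ Finset.range (N + 1), Q ^ (j.choose 2) * gaussBinom Q N j * (x * Q) ^ j =
        1 + ∑ j ∈ Finset.range (N + 1),
          Q ^ ((j + 1).choose 2) * gaussBinom Q N (j + 1) * (x * Q) ^ (j + 1) := by
      have := Finset.sum_range_succ (fun j => Q ^ (j.choose 2) * gaussBinom Q N j * (x * Q) ^ j) (N + 1)
      rw [gaussBinom_eq_zero Q (Nat.lt_succ_self N), Finset.sum_range_succ'] at this
      simp only [gaussBinom_zero_right, Nat.choose_zero_succ, pow_zero] at this
      linear_combination -this
    rw [h1, ih, add_mul, one_mul, Finset.sum_range_succ' _ (N + 1)]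
    nth_rewrite 1 [h3]
    simp only [gaussBinom_zero_right, Nat.choose_zero_succ, pow_zero, gaussBinom_succ_succ]
    rw [Finset.mul_sum, add_assoc, ← Finset.sum_add_distrib, add_comm]
    congr 1
    · refine Finset.sum_congr rfl fun j _ => ?_
      rw [h2]
      ring
    · norm_num

lemma gaussBinom_mul (Q : ℂ) (a b : ℕ) :
    gaussBinom Q (a + b) a * (qPoch Q a * qPoch Q b) = qPoch Q (a + b) := by
  have hs : ∀ n, qPoch Q (n + 1) = qPoch Q n * (1 - Q ^ (n + 1)) := fun n =>
    Finset.prod_range_succ _ _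
  have h0 : qPoch Q 0 = 1 := rfl
  induction h : a + b generalizing a b with
  | zero =>
    obtain ⟨rfl, rfl⟩ : a = 0 ∧ b = 0 := by omega
    simp [h0, gaussBinom_zero_right]
  | succ N ih =>
    rcases a with _ | j
    · obtain rfl : b = N + 1 := by omega
      simp [h0, gaussBinom_zero_right]
    · have i1 := ih j b (by omega)
      rw [gaussBinom_succ_succ, hs N]
      rcases b with _ | b
      · obtain rfl : N = j := by omega
        rw [gaussBinom_eq_zero Q (Nat.lt_succ_self N), hs]
        linear_combination (1 - Q ^ (N + 1)) * i1
      · have i2 := ih (j + 1) b (by omega)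
        have : N + 1 = (j + 1) + (b + 1) := by omega
        rw [this, pow_add Q (j + 1)]
        rw [hs j, hs b] at *
        linear_combination (1 - Q ^ (j + 1)) * i1 + Q ^ (j + 1) * (1 - Q ^ (b + 1)) * i2

/-- The finite Jacobi triple product. -/
lemma finite_triple_product {q z : ℂ} (hq : q ≠ 0) (hz : z ≠ 0) (n : ℕ) :
    (∏ k ∈ Finset.range n, (1 + z * q ^ (2 * k + 1))) *
      (∏ k ∈ Finset.range n, (1 + z⁻¹ * q ^ (2 * k + 1))) =
    ∑ j ∈ Finset.range (2 * n + 1), gaussBinom (q ^ 2) (2 * n) j *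
      (q ^ (((j : ℤ) - n) ^ 2) * z ^ ((j : ℤ) - n)) := by
  have h := prod_one_add_mul_pow (q ^ 2) (z * q * q ^ (-(2 * n : ℤ))) (2 * n)
  have h1 : ∏ k ∈ Finset.range (2 * n), (1 + z * q * q ^ (-(2 * n : ℤ)) * (q ^ 2) ^ k) =
      z ^ n * q ^ (-(n : ℤ) ^ 2) * ((∏ k ∈ Finset.range n, (1 + z * q ^ (2 * k + 1))) *
      (∏ k ∈ Finset.range n, (1 + z⁻¹ * q ^ (2 * k + 1)))) := by
    rw [two_mul n, Finset.prod_range_add, mul_comm]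
    have e1 : ∏ k ∈ Finset.range n, (1 + z * q * q ^ (-(2 * n : ℤ)) * (q ^ 2) ^ (n + k)) =
        ∏ k ∈ Finset.range n, (1 + z * q ^ (2 * k + 1)) := by
      refine Finset.prod_congr rfl fun k _ => ?_
      have : q ^ (-(2 * n : ℤ)) * (q ^ 2) ^ (n + k) = q ^ (2 * k) := by
        rw [← pow_mul, ← zpow_natCast, ← zpow_add₀ hq, ← zpow_natCast]
        congr 1
        push_cast
        ring
      linear_combination (z * q) * this
    have e2 : ∀ m : ℕ, m ≤ n → ∏ k ∈ Finset.range m,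
        (1 + z * q * q ^ (-(2 * n : ℤ)) * (q ^ 2) ^ (n - 1 - k)) =
        z ^ m * q ^ (-(m : ℤ) ^ 2) * ∏ k ∈ Finset.range m, (1 + z⁻¹ * q ^ (2 * k + 1)) := by
      intro m hm
      induction m with
      | zero => simp
      | succ m ih =>
        rw [Finset.prod_range_succ, Finset.prod_range_succ, ih (by omega)]
        have e3 : q * q ^ (-(2 * n : ℤ)) * (q ^ 2) ^ (n - 1 - m) = q ^ (-(2 * m + 1 : ℤ)) := by
          rw [← pow_mul, ← zpow_natCast q (2 * _), ← zpow_one_add₀ hq, ← zpow_add₀ hq]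
          congr 1
          push_cast [show m ≤ n - 1 by omega, show 1 ≤ n by omega]
          ring
        have e4 : q ^ (-((m + 1 : ℕ) : ℤ) ^ 2) = q ^ (-(m : ℤ) ^ 2) * q ^ (-(2 * m + 1 : ℤ)) := by
          rw [← zpow_add₀ hq]
          congr 1
          push_cast
          ring
        have e5 : q ^ (-(2 * m + 1 : ℤ)) * q ^ (2 * m + 1) = 1 := by
          rw [← zpow_natCast, ← zpow_add₀ hq]
          simp
        rw [e4]
        have e6 : z * z⁻¹ = 1 := mul_inv_cancel₀ hz
        rw [show z * q * q ^ (-(2 * n : ℤ)) * (q ^ 2) ^ (n - 1 - m) =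
          z * q ^ (-(2 * m + 1 : ℤ)) by rw [← e3]; ring]
        generalize q ^ (-(2 * m + 1 : ℤ)) = A at *
        generalize q ^ (2 * m + 1) = B at *
        generalize ∏ k ∈ Finset.range m, (1 + z⁻¹ * q ^ (2 * k + 1)) = R at *
        linear_combination (-z ^ m * q ^ (-(m : ℤ) ^ 2) * R) * (e5 + A * B * e6)
    rw [e1, ← Finset.prod_range_reflect (fun k => 1 + z * q * q ^ (-(2 * n : ℤ)) * (q ^ 2) ^ k),
      e2 n le_rfl]
    ring
  rw [h1] at h
  have hne : z ^ n * q ^ (-(n : ℤ) ^ 2) ≠ 0 := mul_ne_zero (pow_ne_zero _ hz) (zpow_ne_zero _ hq)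
  refine mul_left_cancel₀ hne ?_
  rw [h, Finset.mul_sum]
  refine Finset.sum_congr rfl fun j _ => ?_
  have e1 : q ^ (-(n : ℤ) ^ 2) * q ^ (((j : ℤ) - n) ^ 2) =
      (q ^ 2) ^ (j.choose 2) * q ^ j * (q ^ (-(2 * n : ℤ))) ^ j := by
    rw [← pow_mul, ← zpow_natCast q (2 * _), ← zpow_natCast q j, ← zpow_natCast (q ^ (-(2 * n : ℤ))) j,
      ← zpow_mul, ← zpow_add₀ hq, ← zpow_add₀ hq, ← zpow_add₀ hq]
    congr 1
    have h2 : (2 * j.choose 2 : ℤ) = j * (j - 1) := by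
      rcases j with _ | j
      · simp
      · have h3 : (j + 1).choose 2 * 2 = (j + 1) * j := by
          rw [Nat.choose_two_right, Nat.add_sub_cancel]
          exact Nat.div_mul_cancel (Nat.even_mul_succ_self j |>.two_dvd.trans (by rw [mul_comm]))
        zify at h3
        push_cast
        linarith
    push_cast
    linarith
  have e2 : z ^ n * z ^ ((j : ℤ) - n) = z ^ j := by
    rw [← zpow_natCast z n, ← zpow_add₀ hz, ← zpow_natCast z j]
    congr 1
    ring
  rw [show z ^ n * q ^ (-(n : ℤ) ^ 2) * (gaussBinom (q ^ 2) (2 * n) j *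
      (q ^ (((j : ℤ) - n) ^ 2) * z ^ ((j : ℤ) - n))) = gaussBinom (q ^ 2) (2 * n) j *
      (q ^ (-(n : ℤ) ^ 2) * q ^ (((j : ℤ) - n) ^ 2)) * (z ^ n * z ^ ((j : ℤ) - n)) by ring, e1, e2]
  ring

lemma summable_norm_zpow_sq_mul_zpow {q z : ℂ} (hq0 : q ≠ 0) (hq : ‖q‖ < 1) (hz : z ≠ 0) :
    Summable fun k : ℤ => ‖q ^ (k ^ 2) * z ^ k‖ := by
  have hq' : 0 < ‖q‖ := norm_pos_iff.2 hq0
  have hz' : 0 < ‖z‖ := norm_pos_iff.2 hz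
  have h := (summable_jacobiTheta₂_term_iff (-(log ‖z‖ / (2 * π)) * Complex.I)
    (-(log ‖q‖ / π) * Complex.I)).2 (by
      have : 0 < -(log ‖q‖ / π) := by
        have := log_neg hq' hq
        rw [← neg_div]
        exact div_pos (by linarith) pi_pos
      have e : (-(log ‖q‖ / π : ℂ) * Complex.I) = ((-(log ‖q‖ / π) : ℝ) : ℂ) * Complex.I := by
        push_cast; rfl
      rw [e, Complex.im_ofReal_mul]
      simpa using this)
  refine h.norm.congr fun k => ?_
  have hp : (π : ℂ) ≠ 0 := by exact_mod_cast pi_ne_zero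
  have e : jacobiTheta₂_term k (-(log ‖z‖ / (2 * π)) * Complex.I) (-(log ‖q‖ / π) * Complex.I) =
      ((exp (k * log ‖z‖) * exp (k ^ 2 * log ‖q‖) : ℝ) : ℂ) := by
    rw [jacobiTheta₂_term, ← exp_add]
    push_cast
    congr 1
    field_simp
    linear_combination (-(k : ℂ) * log ‖z‖ - (k : ℂ) ^ 2 * log ‖q‖) * Complex.I_sq
  rw [e, Complex.norm_real, norm_of_nonneg (by positivity), norm_mul, norm_zpow, norm_zpow,
    mul_comm, ← rpow_intCast, ← rpow_intCast, rpow_def_of_pos hq', rpow_def_of_pos hz']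
  push_cast
  rw [mul_comm (log ‖q‖), mul_comm (log ‖z‖)]

lemma norm_sq_lt_one {q : ℂ} (hq : ‖q‖ < 1) : ‖q ^ 2‖ < 1 := by
  rw [norm_pow]
  exact pow_lt_one₀ (norm_nonneg _) hq two_ne_zero

lemma one_sub_pow_ne_zero {Q : ℂ} (hQ : ‖Q‖ < 1) (n : ℕ) : 1 - Q ^ (n + 1) ≠ 0 := by
  intro h
  have : ‖Q ^ (n + 1)‖ < 1 := by
    rw [norm_pow]
    exact pow_lt_one₀ (norm_nonneg _) hQ (Nat.succ_ne_zero n)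
  rw [← sub_eq_zero.1 h, norm_one] at this
  exact lt_irrefl _ this

lemma tprod_one_sub_pow_ne_zero {Q : ℂ} (hQ : ‖Q‖ < 1) : ∏' n : ℕ, (1 - Q ^ (n + 1)) ≠ 0 := by
  have := tprod_one_add_ne_zero_of_summable (f := fun n : ℕ => -Q ^ (n + 1))
    (fun i => by simpa [← sub_eq_add_neg] using one_sub_pow_ne_zero hQ i) (by
      simpa using (summable_nat_add_iff 1).mpr (summable_geometric_of_lt_one (norm_nonneg _) hQ))
  simpa [← sub_eq_add_neg] using this

lemma tendsto_qPoch {Q : ℂ} (hQ : ‖Q‖ < 1) :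
    Tendsto (qPoch Q) atTop (𝓝 (∏' n : ℕ, (1 - Q ^ (n + 1)))) :=
  (ModularForm.multipliable_one_sub_pow hQ).hasProd.tendsto_prod_nat

lemma multipliable_one_add_mul_pow {q : ℂ} (hq : ‖q‖ < 1) (z : ℂ) :
    Multipliable fun n : ℕ => 1 + z * q ^ (2 * n + 1) := by
  refine multipliable_one_add_of_summable (f := fun n : ℕ => z * q ^ (2 * n + 1)) ?_
  have : Summable fun n : ℕ => ‖z‖ * ‖q‖ * (‖q‖ ^ 2) ^ n :=
    (summable_geometric_of_lt_one (by positivity)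
      (pow_lt_one₀ (norm_nonneg _) hq two_ne_zero)).mul_left _
  refine this.congr fun n => ?_
  rw [norm_mul, norm_pow]
  ring

lemma qPoch_ne_zero {Q : ℂ} (hQ : ‖Q‖ < 1) (n : ℕ) : qPoch Q n ≠ 0 :=
  Finset.prod_ne_zero_iff.2 fun i _ => one_sub_pow_ne_zero hQ i

lemma gaussBinom_eq_div {Q : ℂ} (hQ : ‖Q‖ < 1) (a b : ℕ) :
    gaussBinom Q (a + b) a = qPoch Q (a + b) * (qPoch Q a)⁻¹ * (qPoch Q b)⁻¹ := by
  have ha := qPoch_ne_zero hQ a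
  have hb := qPoch_ne_zero hQ b
  rw [← gaussBinom_mul]
  field_simp

lemma exists_norm_gaussBinom_le {Q : ℂ} (hQ : ‖Q‖ < 1) :
    ∃ C : ℝ, ∀ N j : ℕ, ‖gaussBinom Q N j‖ ≤ C := by
  have h1 := (Metric.isBounded_range_of_tendsto _ (tendsto_qPoch hQ))
  have h2 := (Metric.isBounded_range_of_tendsto _
    ((tendsto_qPoch hQ).inv₀ (tprod_one_sub_pow_ne_zero hQ)))
  obtain ⟨A, hA⟩ := h1.exists_norm_le
  obtain ⟨B, hB⟩ := h2.exists_norm_le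
  have hA' : ∀ n, ‖qPoch Q n‖ ≤ A := fun n => hA _ ⟨n, rfl⟩
  have hB' : ∀ n, ‖(qPoch Q n)⁻¹‖ ≤ B := fun n => hB _ ⟨n, rfl⟩
  have hA0 := (norm_nonneg _).trans (hA' 0)
  have hB0 := (norm_nonneg _).trans (hB' 0)
  refine ⟨A * B * B, fun N j => ?_⟩
  rcases le_or_gt j N with h | h
  · obtain ⟨b, rfl⟩ := Nat.exists_eq_add_of_le h
    rw [gaussBinom_eq_div hQ, norm_mul, norm_mul]
    gcongr <;> [exact hA' _; exact hB' _; exact hB' _]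
  · rw [gaussBinom_eq_zero Q h, norm_zero]
    positivity

lemma sum_range_eq_tsum_int (n : ℕ) (g : ℕ → ℂ) (f : ℤ → ℂ) :
    ∑ j ∈ Finset.range (2 * n + 1), g j * f ((j : ℤ) - n) =
      ∑' k : ℤ, (if k ∈ Finset.Icc (-n : ℤ) n then g (k + n).toNat else 0) * f k := by
  rw [tsum_eq_sum (s := Finset.Icc (-n : ℤ) n) (fun k hk => by rw [if_neg hk, zero_mul])]
  refine Finset.sum_bij (fun j _ => (j : ℤ) - n) ?_ ?_ ?_ ?_
  · intro j hj
    rw [Finset.mem_range] at hj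
    rw [Finset.mem_Icc]
    omega
  · intro a _ b _ h
    simpa using h
  · intro k hk
    rw [Finset.mem_Icc] at hk
    refine ⟨(k + n).toNat, ?_, ?_⟩
    · rw [Finset.mem_range]
      omega
    · have : 0 ≤ k + n := by omega
      rw [Int.toNat_of_nonneg this]
      ring
  · intro j hj
    rw [Finset.mem_range] at hj
    rw [if_pos (by rw [Finset.mem_Icc]; omega)]
    simp

lemma tendsto_gaussBinom {Q : ℂ} (hQ : ‖Q‖ < 1) (k : ℤ) :
    Tendsto (fun n : ℕ => if k ∈ Finset.Icc (-n : ℤ) n then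
      gaussBinom Q (2 * n) (k + n).toNat else 0) atTop (𝓝 (∏' n : ℕ, (1 - Q ^ (n + 1)))⁻¹) := by
  have hP := tendsto_qPoch hQ
  have h0 := tprod_one_sub_pow_ne_zero hQ
  have h1 : Tendsto (fun n : ℕ => 2 * n) atTop atTop :=
    tendsto_atTop_mono (fun n => by simp only [id]; omega) tendsto_id
  have h2 : ∀ k : ℤ, Tendsto (fun n : ℕ => (k + n).toNat) atTop atTop := fun k => by
    refine tendsto_atTop.2 fun b => ?_
    filter_upwards [eventually_ge_atTop (b + k.natAbs)] with n hn
    omega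
  have h3 := ((hP.comp h1).mul ((hP.comp (h2 k)).inv₀ h0)).mul ((hP.comp (h2 (-k))).inv₀ h0)
  rw [mul_inv_cancel₀ h0, one_mul] at h3
  refine h3.congr' ?_
  filter_upwards [eventually_ge_atTop k.natAbs] with n hn
  rw [if_pos (by rw [Finset.mem_Icc]; omega)]
  have := gaussBinom_eq_div hQ (k + n).toNat (-k + n).toNat
  rw [show (k + n).toNat + (-k + n).toNat = 2 * n by omega] at this
  rw [this]
  rfl

/-- The Jacobi triple product identity. -/
theorem jacobi_triple_product {q z : ℂ} (hq0 : q ≠ 0) (hq : ‖q‖ < 1) (hz : z ≠ 0) :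
    ∑' k : ℤ, q ^ (k ^ 2) * z ^ k = (∏' n : ℕ, (1 - (q ^ 2) ^ (n + 1))) *
      ((∏' n : ℕ, (1 + z * q ^ (2 * n + 1))) * ∏' n : ℕ, (1 + z⁻¹ * q ^ (2 * n + 1))) := by
  have hQ := norm_sq_lt_one hq
  obtain ⟨C, hC⟩ := exists_norm_gaussBinom_le hQ
  have h1 := (multipliable_one_add_mul_pow hq z).hasProd.tendsto_prod_nat.mul
    (multipliable_one_add_mul_pow hq z⁻¹).hasProd.tendsto_prod_nat
  have h2 : Tendsto (fun n : ℕ => ∑' k : ℤ, (if k ∈ Finset.Icc (-n : ℤ) n then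
      gaussBinom (q ^ 2) (2 * n) (k + n).toNat else 0) * (q ^ (k ^ 2) * z ^ k)) atTop
      (𝓝 (∑' k : ℤ, (∏' n : ℕ, (1 - (q ^ 2) ^ (n + 1)))⁻¹ * (q ^ (k ^ 2) * z ^ k))) := by
    refine tendsto_tsum_of_dominated_convergence
      ((summable_norm_zpow_sq_mul_zpow hq0 hq hz).mul_left C)
      (fun k => (tendsto_gaussBinom hQ k).mul_const _) (Eventually.of_forall fun n k => ?_)
    rw [norm_mul]
    refine mul_le_mul_of_nonneg_right ?_ (norm_nonneg _)
    split_ifs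
    · exact hC _ _
    · rw [norm_zero]
      exact (norm_nonneg _).trans (hC 0 0)
  have h3 := tendsto_nhds_unique h1 (h2.congr fun n => by
    rw [finite_triple_product hq0 hz n]
    exact (sum_range_eq_tsum_int n (gaussBinom (q ^ 2) (2 * n)) fun k => q ^ (k ^ 2) * z ^ k).symm)
  rw [tsum_mul_left] at h3
  rw [h3, mul_inv_cancel_left₀ (tprod_one_sub_pow_ne_zero hQ)]

lemma norm_ofReal_exp_lt_one {y : ℝ} (hy : 0 < y) : ‖((exp (-π * y) : ℝ) : ℂ)‖ < 1 := by
  rw [Complex.norm_real, norm_of_nonneg (exp_pos _).le, exp_lt_one_iff]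
  nlinarith [pi_pos]

lemma ofReal_exp_zpow (y : ℝ) (k : ℤ) :
    ((exp (-π * y) : ℝ) : ℂ) ^ k = ((exp (-π * y * k) : ℝ) : ℂ) := by
  rw [← Complex.ofReal_zpow, ← rpow_intCast, ← exp_mul]

lemma dedekindEta_I_mul (y : ℝ) : dedekindEta (Complex.I * y) =
    ((exp (-π * y / 12) : ℝ) : ℂ) *
      ∏' n : ℕ, (1 - (((exp (-π * y) : ℝ) : ℂ) ^ 2) ^ (n + 1)) := by
  rw [dedekindEta]
  congr 1
  · push_cast
    congr 1
    linear_combination (π * y / 12 : ℂ) * Complex.I_sq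
  · refine tprod_congr fun n => ?_
    push_cast
    rw [← pow_mul, ← Complex.exp_nat_mul]
    congr 2
    push_cast
    linear_combination (2 * π * (n + 1) * y : ℂ) * Complex.I_sq

lemma multipliable_one_add_pow {q : ℂ} (hq : ‖q‖ < 1) : Multipliable fun n : ℕ => 1 + q ^ (n + 1) := by
  apply multipliable_one_add_of_summable (f := fun n => q ^ (n + 1))
  simpa using (summable_nat_add_iff 1).mpr (summable_geometric_of_lt_one (norm_nonneg _) hq)

lemma tprod_one_add_pow_eq {q : ℂ} (hq : ‖q‖ < 1) :
    ∏' n : ℕ, (1 + q ^ n) = 2 * ∏' n : ℕ, (1 + q ^ (n + 1)) :=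
  (tprod_eq_zero_mul' (f := fun n : ℕ => 1 + q ^ n) (multipliable_one_add_pow hq)).trans
    (by rw [pow_zero, one_add_one_eq_two])

lemma t3_eq_prod {y : ℝ} (hy : 0 < y) {q : ℂ} (hq : q = (exp (-π * y) : ℝ)) :
    (t3 y : ℂ) = (∏' n : ℕ, (1 - (q ^ 2) ^ (n + 1))) * (∏' n : ℕ, (1 + q ^ (2 * n + 1))) ^ 2 := by
  have h0 : q ≠ 0 := by rw [hq]; exact_mod_cast (exp_pos _).ne'
  have h1 : ‖q‖ < 1 := hq ▸ norm_ofReal_exp_lt_one hy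
  have h := jacobi_triple_product h0 h1 (z := 1) one_ne_zero
  simp only [one_zpow, mul_one, inv_one, one_mul] at h
  rw [← sq (∏' n : ℕ, (1 + q ^ (2 * n + 1)))] at h
  rw [← h, t3, Complex.ofReal_tsum]
  refine tsum_congr fun k => ?_
  rw [hq, ofReal_exp_zpow, gauss]
  push_cast
  rfl

lemma t4_eq_prod {y : ℝ} (hy : 0 < y) {q : ℂ} (hq : q = (exp (-π * y) : ℝ)) :
    (t4 y : ℂ) = (∏' n : ℕ, (1 - (q ^ 2) ^ (n + 1))) * (∏' n : ℕ, (1 - q ^ (2 * n + 1))) ^ 2 := by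
  have h0 : q ≠ 0 := by rw [hq]; exact_mod_cast (exp_pos _).ne'
  have h1 : ‖q‖ < 1 := hq ▸ norm_ofReal_exp_lt_one hy
  have h := jacobi_triple_product h0 h1 (z := -1) (neg_ne_zero.2 one_ne_zero)
  simp only [inv_neg, inv_one, neg_mul, one_mul, ← sub_eq_add_neg] at h
  rw [← sq (∏' n : ℕ, (1 - q ^ (2 * n + 1)))] at h
  rw [← h, t4, Complex.ofReal_tsum]
  refine tsum_congr fun k => ?_
  rw [hq, ofReal_exp_zpow, gauss, mul_comm, Complex.ofReal_mul]
  congr 1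
  · push_cast
    rfl
  · split_ifs with hk
    · rw [hk.neg_one_zpow, Complex.ofReal_one]
    · rw [(Int.not_even_iff_odd.1 hk).neg_one_zpow, Complex.ofReal_neg, Complex.ofReal_one]

lemma t2_eq_prod {y : ℝ} (hy : 0 < y) {q : ℂ} (hq : q = (exp (-π * y) : ℝ)) :
    (t2 y : ℂ) = 2 * ((exp (-π * y / 4) : ℝ) : ℂ) *
      ((∏' n : ℕ, (1 - (q ^ 2) ^ (n + 1))) * (∏' n : ℕ, (1 + (q ^ 2) ^ (n + 1))) ^ 2) := by
  have h0 : q ≠ 0 := by rw [hq]; exact_mod_cast (exp_pos _).ne'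
  have h1 : ‖q‖ < 1 := hq ▸ norm_ofReal_exp_lt_one hy
  have h := jacobi_triple_product h0 h1 (z := q) h0
  have e1 : ∀ n : ℕ, 1 + q * q ^ (2 * n + 1) = 1 + (q ^ 2) ^ (n + 1) := fun n => by ring
  have e2 : ∀ n : ℕ, 1 + q⁻¹ * q ^ (2 * n + 1) = 1 + (q ^ 2) ^ n := fun n => by
    rw [pow_succ' q, inv_mul_cancel_left₀ h0, pow_mul]
  have e3 : ∏' n : ℕ, (1 + (q ^ 2) ^ n) = 2 * ∏' n : ℕ, (1 + (q ^ 2) ^ (n + 1)) := by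
    exact tprod_one_add_pow_eq (norm_sq_lt_one h1)
  simp only [e1, e2, e3] at h
  rw [show ∀ E A K : ℂ, 2 * K * (E * A ^ 2) = K * (E * (A * (2 * A))) by intros; ring, ← h, t2,
    Complex.ofReal_tsum, ← tsum_mul_left]
  refine tsum_congr fun k => ?_
  rw [← zpow_add₀ h0, hq, ofReal_exp_zpow, gauss, ← Complex.ofReal_mul, ← exp_add]
  congr 2
  push_cast
  ring

/-- Euler's identity between the products over even and odd exponents. -/
lemma euler_prod {q : ℂ} (hq : ‖q‖ < 1) :
    (∏' n : ℕ, (1 + q ^ (2 * n + 1))) * (∏' n : ℕ, (1 - q ^ (2 * n + 1))) *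
      (∏' n : ℕ, (1 + (q ^ 2) ^ (n + 1))) = 1 := by
  have hQ := norm_sq_lt_one hq
  have m1 : Multipliable fun n : ℕ => 1 + q ^ (2 * n + 1) := by
    simpa using multipliable_one_add_mul_pow hq 1
  have m2 : Multipliable fun n : ℕ => 1 - q ^ (2 * n + 1) := by
    simpa [← sub_eq_add_neg] using multipliable_one_add_mul_pow hq (-1)
  have m3 := multipliable_one_add_pow hQ
  have m4 := ModularForm.multipliable_one_sub_pow hQ
  have e : ∀ n : ℕ, q ^ (2 * n + 1 + 1) = (q ^ 2) ^ (n + 1) := fun n => by ring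
  have h1 : (∏' n : ℕ, (1 + q ^ (2 * n + 1))) * (∏' n : ℕ, (1 + (q ^ 2) ^ (n + 1))) =
      ∏' n : ℕ, (1 + q ^ (n + 1)) := by
    have := tprod_even_mul_odd (f := fun n : ℕ => 1 + q ^ (n + 1)) m1 (by simpa only [e] using m3)
    simpa only [e] using this
  have h2 : (∏' n : ℕ, (1 - q ^ (2 * n + 1))) * (∏' n : ℕ, (1 - (q ^ 2) ^ (n + 1))) =
      ∏' n : ℕ, (1 - q ^ (n + 1)) := by
    have := tprod_even_mul_odd (f := fun n : ℕ => 1 - q ^ (n + 1)) m2 (by simpa only [e] using m4)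
    simpa only [e] using this
  have h3 : (∏' n : ℕ, (1 + q ^ (n + 1))) * (∏' n : ℕ, (1 - q ^ (n + 1))) =
      ∏' n : ℕ, (1 - (q ^ 2) ^ (n + 1)) := by
    rw [← (multipliable_one_add_pow hq).tprod_mul (ModularForm.multipliable_one_sub_pow hq)]
    exact tprod_congr fun n => by ring
  refine mul_right_cancel₀ (tprod_one_sub_pow_ne_zero hQ) ?_
  rw [← h1, ← h2] at h3
  linear_combination h3

/-- The cube of the eta function as a product of theta constants. -/
theorem dedekindEta_cube {y : ℝ} (hy : 0 < y) :
    dedekindEta (Complex.I * y) ^ 3 = ((1 / 2 * (t2 y * t3 y * t4 y) : ℝ) : ℂ) := by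
  obtain ⟨q, hq⟩ : ∃ q : ℂ, q = (exp (-π * y) : ℝ) := ⟨_, rfl⟩
  have h1 : ‖q‖ < 1 := hq ▸ norm_ofReal_exp_lt_one hy
  have he := euler_prod h1
  have h3 : ((exp (-π * y / 12) : ℝ) : ℂ) ^ 3 = ((exp (-π * y / 4) : ℝ) : ℂ) := by
    rw [← Complex.ofReal_pow, ← exp_nat_mul]
    congr 2
    push_cast
    ring
  rw [dedekindEta_I_mul, ← hq, mul_pow, h3]
  rw [Complex.ofReal_mul, Complex.ofReal_mul, Complex.ofReal_mul]
  rw [t2_eq_prod hy hq, t3_eq_prod hy hq, t4_eq_prod hy hq]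
  generalize (∏' n : ℕ, (1 + q ^ (2 * n + 1))) = A at *
  generalize (∏' n : ℕ, (1 - q ^ (2 * n + 1))) = B at *
  generalize (∏' n : ℕ, (1 + (q ^ 2) ^ (n + 1))) = C at *
  generalize (∏' n : ℕ, (1 - (q ^ 2) ^ (n + 1))) = E at *
  push_cast
  linear_combination (-(Complex.exp (-π * y / 4)) * E ^ 3 * (A * B * C + 1)) * he

/-- The odd character modulo four, with real values. -/
def chi (n : ℤ) : ℝ := if n % 4 = 1 then 1 else if n % 4 = 3 then -1 else 0

/-- The theta series of weight `3 / 2` attached to `chi`. -/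
noncomputable def thetaOdd (y : ℝ) : ℝ := ∑' n : ℤ, chi n * n * gauss y n

lemma abs_chi_le (n : ℤ) : |chi n| ≤ 1 := by
  unfold chi; split_ifs <;> simp

lemma summable_linear_gauss {y : ℝ} (hy : 0 < y) {c : ℤ → ℝ} (hc : ∀ n, |c n| ≤ 1 + |(n : ℝ)|) :
    Summable fun n : ℤ ↦ c n * gauss y n := by
  have h := (summable_gauss hy).add (by simpa using summable_pow_mul_gauss_add hy 1)
  refine Summable.of_norm_bounded h fun n ↦ ?_
  rw [norm_mul, Real.norm_of_nonneg (gauss_pos _ _).le, Real.norm_eq_abs]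
  nlinarith [hc n, gauss_pos y n]

lemma abs_chi_mul_le (n : ℤ) : |chi n * n| ≤ 1 + |(n : ℝ)| := by
  rw [abs_mul]
  nlinarith [abs_chi_le n, abs_nonneg (n : ℝ), abs_nonneg (chi n)]

lemma summable_latSum_of_le {w : ℤ × ℤ → ℝ} {C : ℝ}
    (hw : ∀ p, |w p| ≤ C * ((1 + |(p.1 : ℝ)|) ^ 2 * (1 + |(p.2 : ℝ)|) ^ 2)) {y z : ℝ} (hy : 0 < y)
    (hz : 0 < z) : Summable fun p : ℤ × ℤ ↦ w p * (gauss y p.1 * gauss z p.2) := by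
  have key : ∀ {y : ℝ}, 0 < y → Summable fun n : ℤ ↦ (1 + |(n : ℝ)|) ^ 2 * gauss y n := by
    intro y hy
    have h1 := (summable_pow_mul_gauss_add hy 1).mul_left 2
    refine (((summable_gauss hy).add h1).add (summable_pow_mul_gauss_add hy 2)).congr fun n ↦ ?_
    ring
  have h := ((key hy).mul_of_nonneg (key hz) (fun n ↦ mul_nonneg (by positivity) (gauss_pos _ _).le)
    (fun n ↦ mul_nonneg (by positivity) (gauss_pos _ _).le)).mul_left C
  refine Summable.of_norm_bounded h fun p ↦ ?_
  have hp := mul_pos (gauss_pos y p.1) (gauss_pos z p.2)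
  rw [norm_mul, Real.norm_of_nonneg hp.le, Real.norm_eq_abs]
  calc _ ≤ _ := mul_le_mul_of_nonneg_right (hw p) hp.le
    _ = _ := by ring

lemma latSum_mul {c d : ℤ → ℝ} (hc : ∀ n, |c n| ≤ 1 + |(n : ℝ)|) (hd : ∀ n, |d n| ≤ 1 + |(n : ℝ)|)
    {y z : ℝ} (hy : 0 < y) (hz : 0 < z) :
    (∑' n : ℤ, c n * gauss y n) * ∑' n : ℤ, d n * gauss z n =
      latSum (fun p ↦ c p.1 * d p.2) y z := by
  rw [tsum_mul_tsum_of_summable_norm (summable_linear_gauss hy hc).norm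
    (summable_linear_gauss hz hd).norm, latSum]
  exact tsum_congr fun p ↦ by ring

lemma t2_eq_tsum_odd (y : ℝ) : t2 y = ∑' n : ℤ, ind (n % 2 = 1) * gauss (y / 4) n := by
  have hi : Function.Injective fun n : ℤ ↦ 2 * n + 1 := fun a b h ↦ by simpa using h
  rw [← hi.tsum_eq]
  · refine tsum_congr fun n ↦ ?_
    rw [ind, if_pos (by omega), one_mul, gauss, gauss]
    congr 1
    push_cast
    ring
  · intro n hn
    have h : ind (n % 2 = 1) ≠ 0 := fun h ↦ hn (by simp [h])
    have := ind_ne_zero.1 h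
    exact ⟨n / 2, by simp only; omega⟩

/-- The character of the even integers with values `1` on multiples of four. -/
def evenSign (n : ℤ) : ℝ := if n % 4 = 0 then 1 else if n % 4 = 2 then -1 else 0

lemma abs_evenSign_le (n : ℤ) : |evenSign n| ≤ 1 := by
  unfold evenSign; split_ifs <;> simp

lemma t4_eq_tsum_even (y : ℝ) : t4 y = ∑' n : ℤ, evenSign n * gauss (y / 4) n := by
  rw [← (mul_right_injective₀ (two_ne_zero' ℤ)).tsum_eq]
  · refine tsum_congr fun n ↦ ?_
    have e : gauss (y / 4) ((2 * n : ℤ) : ℝ) = gauss y n := by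
      rw [gauss, gauss]; congr 1; push_cast; ring
    rw [e]
    rcases Int.emod_two_eq_zero_or_one n with h | h
    · rw [if_pos (Int.even_iff.2 h), evenSign, if_pos (by omega)]
    · rw [if_neg (by rw [Int.even_iff]; omega), evenSign, if_neg (by omega), if_pos (by omega)]
  · intro n hn
    have h : evenSign n ≠ 0 := fun h ↦ hn (by simp [h])
    have h2 : n % 2 = 0 := by
      by_contra h2
      exact h (by rw [evenSign, if_neg (by omega), if_neg (by omega)])
    exact ⟨n / 2, by simp only; omega⟩

lemma latSum_congr_of_reindex {w v : ℤ × ℤ → ℝ} {φ : ℤ × ℤ → ℤ × ℤ} (hφ : Function.Bijective φ)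
    (hv : ∀ q, w (φ q) = v q) {y : ℝ} (hQ : ∀ q, (φ q).1 ^ 2 + (φ q).2 ^ 2 = q.1 ^ 2 + q.2 ^ 2) :
    latSum w y y = latSum v y y := by
  refine latSum_reindex hφ.1 (fun p _ ↦ hφ.2 p) hv fun q _ ↦ ?_
  rw [← mul_add, ← mul_add]
  congr 1
  exact_mod_cast hQ q

lemma bijective_flip : Function.Bijective fun p : ℤ × ℤ ↦ (p.1, -p.2) :=
  ⟨fun ⟨a, b⟩ ⟨c, d⟩ h ↦ by simpa using h, fun ⟨a, b⟩ ↦ ⟨(a, -b), by simp⟩⟩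

lemma latSum_eq_zero_of_odd {w : ℤ × ℤ → ℝ} (hw : ∀ p, w (p.1, -p.2) = -w p) (y : ℝ) :
    latSum w y y = 0 := by
  have h : latSum w y y = latSum (fun p ↦ -w p) y y :=
    latSum_congr_of_reindex bijective_flip hw fun q ↦ by simp
  have h2 : latSum (fun p ↦ -w p) y y = -latSum w y y := by
    rw [latSum, latSum, ← tsum_neg]
    exact tsum_congr fun p ↦ by ring
  linarith

lemma latSum_add_swap {w : ℤ × ℤ → ℝ} {C : ℝ}
    (hw : ∀ p, |w p| ≤ C * ((1 + |(p.1 : ℝ)|) ^ 2 * (1 + |(p.2 : ℝ)|) ^ 2)) {y : ℝ} (hy : 0 < y) :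
    latSum (fun p ↦ w p + w p.swap) y y = 2 * latSum w y y := by
  have h : latSum (fun p ↦ w p.swap) y y = latSum w y y :=
    latSum_congr_of_reindex Prod.swap_bijective (fun q ↦ by simp) fun q ↦ by
      simp [add_comm]
  have h3 : ∀ p : ℤ × ℤ, |w p.swap| ≤ C * ((1 + |(p.1 : ℝ)|) ^ 2 * (1 + |(p.2 : ℝ)|) ^ 2) :=
    fun p ↦ by rw [mul_comm ((1 + |(p.1 : ℝ)|) ^ 2)]; exact hw p.swap
  have h4 : latSum (fun p ↦ w p + w p.swap) y y =
      latSum w y y + latSum (fun p ↦ w p.swap) y y := by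
    rw [latSum, latSum, latSum,
      ← (summable_latSum_of_le hw hy hy).tsum_add (summable_latSum_of_le h3 hy hy)]
    exact tsum_congr fun p ↦ by ring
  rw [h4, h, two_mul]

lemma latSum_rotate {w v : ℤ × ℤ → ℝ} (hw : ∀ p, w p ≠ 0 → p.1 % 2 = 1 ∧ p.2 % 2 = 1)
    (hv : ∀ a b, w (a + b, a - b) = v (a, b)) (y : ℝ) :
    latSum w (y / 4) (y / 4) = latSum v (y / 2) (y / 2) := by
  refine latSum_reindex (injective_linear (a := 1) (b := 1) (c := 1) (d := -1) (by norm_num))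
    ?_ ?_ ?_
  · rintro ⟨a, b⟩ h
    have h := hw _ h
    simp only at h
    exact ⟨((a + b) / 2, (a - b) / 2), Prod.ext (by simp only; omega) (by simp only; omega)⟩
  · rintro ⟨a, b⟩
    simpa [sub_eq_add_neg] using hv a b
  · rintro ⟨a, b⟩ -
    push_cast; ring

lemma chi_ne_zero {n : ℤ} (h : chi n ≠ 0) : n % 2 = 1 := by
  by_contra h2
  exact h (by rw [chi, if_neg (by omega), if_neg (by omega)])

lemma chi_add (a b : ℤ) : chi (a + b) = evenSign b * chi a + evenSign a * chi b := by
  unfold chi evenSign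
  split_ifs <;> first | (exfalso; omega) | norm_num

lemma chi_mul_ind (a b : ℤ) : chi (a + b) * ind ((a - b) % 2 = 1) = chi (a + b) := by
  by_cases h : chi (a + b) = 0
  · rw [h, zero_mul]
  · have := chi_ne_zero h
    rw [ind, if_pos (by omega), mul_one]

lemma evenSign_neg (n : ℤ) : evenSign (-n) = evenSign n := by
  unfold evenSign
  split_ifs <;> first | (exfalso; omega) | norm_num

lemma abs_evenSign_le_linear (n : ℤ) : |evenSign n| ≤ 1 + |(n : ℝ)| :=
  (abs_evenSign_le n).trans (by linarith [abs_nonneg (n : ℝ)])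

lemma abs_ind_le_linear (P : Prop) [Decidable P] (n : ℤ) : |ind P| ≤ 1 + |(n : ℝ)| :=
  (abs_ind_le P).trans (by linarith [abs_nonneg (n : ℝ)])

/-- The duplication formula for the weight `3 / 2` theta series. -/
theorem t2_mul_thetaOdd {y : ℝ} (hy : 0 < y) :
    thetaOdd (y / 4) * t2 y = 2 * (thetaOdd (y / 2) * t4 (2 * y)) := by
  rw [t2_eq_tsum_odd, t4_eq_tsum_even, show 2 * y / 4 = y / 2 by ring, thetaOdd, thetaOdd,
    latSum_mul abs_chi_mul_le (fun n ↦ abs_ind_le_linear _ n) (by positivity) (by positivity),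
    latSum_mul abs_chi_mul_le abs_evenSign_le_linear (by positivity) (by positivity)]
  have hb : ∀ p : ℤ × ℤ, |evenSign p.2 * chi p.1| ≤ 1 := fun p ↦ by
    rw [abs_mul]; exact mul_le_one₀ (abs_evenSign_le _) (abs_nonneg _) (abs_chi_le _)
  have h1 : ∀ p : ℤ × ℤ, |evenSign p.2 * chi p.1 * p.1| ≤
      1 * ((1 + |(p.1 : ℝ)|) ^ 2 * (1 + |(p.2 : ℝ)|) ^ 2) := fun p ↦ by
    rw [abs_mul]
    have := mul_le_mul_of_nonneg_right (hb p) (abs_nonneg (p.1 : ℝ))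
    nlinarith [abs_nonneg (p.1 : ℝ), abs_nonneg (p.2 : ℝ),
      mul_nonneg (abs_nonneg (p.1 : ℝ)) (abs_nonneg (p.2 : ℝ)),
      one_le_pow₀ (n := 2) (show 1 ≤ 1 + |(p.2 : ℝ)| by linarith [abs_nonneg (p.2 : ℝ)])]
  have h2 : ∀ p : ℤ × ℤ, |evenSign p.2 * chi p.1 * p.2| ≤
      1 * ((1 + |(p.1 : ℝ)|) ^ 2 * (1 + |(p.2 : ℝ)|) ^ 2) := fun p ↦ by
    rw [abs_mul]
    have := mul_le_mul_of_nonneg_right (hb p) (abs_nonneg (p.2 : ℝ))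
    nlinarith [abs_nonneg (p.1 : ℝ), abs_nonneg (p.2 : ℝ),
      mul_nonneg (abs_nonneg (p.1 : ℝ)) (abs_nonneg (p.2 : ℝ)),
      one_le_pow₀ (n := 2) (show 1 ≤ 1 + |(p.1 : ℝ)| by linarith [abs_nonneg (p.1 : ℝ)])]
  have h3 : ∀ p : ℤ × ℤ, |evenSign p.2 * chi p.1 * (p.1 + p.2)| ≤
      2 * ((1 + |(p.1 : ℝ)|) ^ 2 * (1 + |(p.2 : ℝ)|) ^ 2) := fun p ↦ by
    rw [mul_add]
    exact (abs_add_le _ _).trans (by linarith [h1 p, h2 p])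
  rw [latSum_rotate (v := fun p ↦ evenSign p.2 * chi p.1 * (p.1 + p.2) +
    evenSign p.swap.2 * chi p.swap.1 * (p.swap.1 + p.swap.2)),
    latSum_add_swap (w := fun p ↦ evenSign p.2 * chi p.1 * (p.1 + p.2)) h3 (by positivity)]
  · congr 1
    have h4 := latSum_eq_zero_of_odd (w := fun p ↦ evenSign p.2 * chi p.1 * p.2)
      (fun p ↦ by simp only [evenSign_neg]; push_cast; ring) (y / 2)
    rw [← add_zero (latSum (fun p ↦ chi p.1 * p.1 * evenSign p.2) (y / 2) (y / 2)), ← h4, latSum,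
      latSum, latSum, ← Summable.tsum_add]
    · exact tsum_congr fun p ↦ by ring
    · exact (summable_latSum_of_le h1 (half_pos hy) (half_pos hy)).congr fun p ↦ by ring
    · exact summable_latSum_of_le h2 (half_pos hy) (half_pos hy)
  · intro p hp
    exact ⟨chi_ne_zero (left_ne_zero_of_mul (left_ne_zero_of_mul hp)),
      ind_ne_zero.1 (right_ne_zero_of_mul hp)⟩
  · intro a b
    have e1 := chi_mul_ind a b
    have e2 := chi_add a b
    simp only [Prod.fst_swap, Prod.snd_swap]
    push_cast
    linear_combination (a + b : ℝ) * e1 + (a + b : ℝ) * e2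

lemma tendsto_tsum_gauss {c : ℤ → ℝ} (hc : ∀ n, |c n| ≤ 1 + |(n : ℝ)|) {m : ℕ}
    (hm : ∀ n : ℤ, n ^ 2 < m → c n = 0) :
    Tendsto (fun y : ℝ ↦ exp (π * y * m) * ∑' n : ℤ, c n * gauss y n) atTop
      (𝓝 (∑' n : ℤ, if n ^ 2 = m then c n else 0)) := by
  have h1 : ∀ y : ℝ, exp (π * y * m) * ∑' n : ℤ, c n * gauss y n =
      ∑' n : ℤ, c n * exp (-(π * y * (n ^ 2 - m))) := fun y ↦ by
    rw [← tsum_mul_left]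
    refine tsum_congr fun n ↦ ?_
    rw [gauss, mul_left_comm, ← exp_add]
    congr 2
    ring
  simp only [h1]
  refine tendsto_tsum_of_dominated_convergence
    (bound := fun n : ℤ ↦ exp (π * m) * ((1 + |(n : ℝ)|) * gauss 1 n)) ?_ ?_ ?_
  · refine (summable_linear_gauss one_pos (c := fun n ↦ 1 + |(n : ℝ)|) fun n ↦ ?_).mul_left _
    rw [abs_of_nonneg (by positivity)]
  · intro n
    rcases lt_trichotomy (n ^ 2) (m : ℤ) with h | h | h
    · simp [hm n h]
    · have : ((n : ℝ) ^ 2 - m) = 0 := by rw [sub_eq_zero]; exact_mod_cast h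
      simp [this, h]
    · have h2 : 0 < ((n : ℝ) ^ 2 - m) := by rw [sub_pos]; exact_mod_cast h
      rw [if_neg h.ne']
      have h3 : Tendsto (fun y : ℝ ↦ π * y * ((n : ℝ) ^ 2 - m)) atTop atTop :=
        (tendsto_id.const_mul_atTop pi_pos).atTop_mul_const h2
      simpa using (tendsto_exp_neg_atTop_nhds_zero.comp h3).const_mul (c n)
  · filter_upwards [eventually_ge_atTop 1] with y hy n
    rw [norm_mul, Real.norm_of_nonneg (exp_pos _).le, Real.norm_eq_abs, mul_left_comm]
    by_cases h : (n : ℤ) ^ 2 < m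
    · rw [hm n h, abs_zero, zero_mul]
      exact mul_nonneg (by positivity) (mul_nonneg (exp_pos _).le (gauss_pos _ _).le)
    · have h2 : 0 ≤ ((n : ℝ) ^ 2 - m) := by
        rw [sub_nonneg]; exact_mod_cast not_lt.1 h
      refine mul_le_mul (hc n) ?_ (exp_pos _).le (by positivity)
      rw [gauss, ← exp_add]
      refine exp_le_exp.2 ?_
      nlinarith [mul_nonneg (mul_nonneg pi_pos.le h2) (sub_nonneg.2 hy)]

lemma tsum_ite_sq_eq_one (c : ℤ → ℝ) :
    (∑' n : ℤ, if n ^ 2 = ((1 : ℕ) : ℤ) then c n else 0) = c 1 + c (-1) := by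
  rw [tsum_eq_sum (s := {1, -1})]
  · rw [Finset.sum_pair (by norm_num)]
    norm_num
  · intro n hn
    rw [if_neg]
    intro h
    have h : n = 1 ∨ n = -1 := by
      rwa [Nat.cast_one, ← one_pow 2, sq_eq_sq_iff_eq_or_eq_neg] at h
    simp at hn
    omega

lemma tsum_ite_sq_eq_zero (c : ℤ → ℝ) :
    (∑' n : ℤ, if n ^ 2 = ((0 : ℕ) : ℤ) then c n else 0) = c 0 := by
  rw [tsum_eq_single 0]
  · norm_num
  · intro n hn
    rw [if_neg]
    simpa using hn

lemma tendsto_div_four_atTop : Tendsto (fun y : ℝ ↦ y / 4) atTop atTop :=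
  tendsto_id.atTop_div_const (by norm_num)

lemma tendsto_thetaOdd :
    Tendsto (fun y : ℝ ↦ exp (π * (y / 4)) * thetaOdd (y / 4)) atTop (𝓝 2) := by
  have h := (tendsto_tsum_gauss abs_chi_mul_le (m := 1) fun n hn ↦ by
    have : n = 0 := by
      have : n ^ 2 < 1 := by exact_mod_cast hn
      exact pow_eq_zero_iff (two_ne_zero) |>.1 (show n ^ 2 = 0 by nlinarith [sq_nonneg n])
    simp [this]).comp tendsto_div_four_atTop
  rw [tsum_ite_sq_eq_one] at h
  have e : chi 1 * ((1 : ℤ) : ℝ) + chi (-1) * ((-1 : ℤ) : ℝ) = 2 := by norm_num [chi]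
  rw [e] at h
  simpa only [thetaOdd, Function.comp_def, Nat.cast_one, mul_one] using h

lemma tendsto_t2 : Tendsto (fun y : ℝ ↦ exp (π * (y / 4)) * t2 y) atTop (𝓝 2) := by
  have h := (tendsto_tsum_gauss (c := fun n ↦ ind (n % 2 = 1))
    (fun n ↦ abs_ind_le_linear _ n) (m := 1) fun n hn ↦ by
    have : n = 0 := by
      have : n ^ 2 < 1 := by exact_mod_cast hn
      exact pow_eq_zero_iff (two_ne_zero) |>.1 (show n ^ 2 = 0 by nlinarith [sq_nonneg n])
    simp [this, ind]).comp tendsto_div_four_atTop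
  rw [tsum_ite_sq_eq_one] at h
  have e : ind ((1 : ℤ) % 2 = 1) + ind ((-1 : ℤ) % 2 = 1) = 2 := by norm_num [ind]
  rw [e] at h
  simpa only [t2_eq_tsum_odd, Function.comp_def, Nat.cast_one, mul_one] using h

lemma tendsto_t3 : Tendsto t3 atTop (𝓝 1) := by
  have h := tendsto_tsum_gauss (c := fun n ↦ 1) (fun n ↦ by simp) (m := 0)
    fun n hn ↦ by rw [Nat.cast_zero] at hn; exact absurd hn (sq_nonneg n).not_gt
  rw [tsum_ite_sq_eq_zero] at h
  simp only [Nat.cast_zero, mul_zero, exp_zero, one_mul] at h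
  exact h

lemma tendsto_t4 : Tendsto t4 atTop (𝓝 1) := by
  have h := tendsto_tsum_gauss (c := fun n ↦ if Even n then 1 else -1)
    (fun n ↦ by split_ifs <;> simp) (m := 0)
    fun n hn ↦ by rw [Nat.cast_zero] at hn; exact absurd hn (sq_nonneg n).not_gt
  rw [tsum_ite_sq_eq_zero] at h
  simp only [Nat.cast_zero, mul_zero, exp_zero, one_mul] at h
  rw [if_pos Even.zero] at h
  exact h

/-- The weight `3 / 2` theta series as a product of theta constants. -/
theorem thetaOdd_eq {y : ℝ} (hy : 0 < y) : thetaOdd (y / 4) = t2 y * t3 y * t4 y := by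
  set R : ℝ → ℝ := fun y ↦ thetaOdd (y / 4) / (t2 y * t3 y * t4 y) with hR
  have hpos : ∀ {y : ℝ}, 0 < y → 0 < t2 y * t3 y * t4 y := fun h ↦
    mul_pos (mul_pos (t2_pos h) (t3_pos h)) (t4_pos h)
  have hdouble : ∀ {y : ℝ}, 0 < y → R (2 * y) = R y := by
    intro y hy
    have h1 := t2_mul_thetaOdd hy
    have h2 := t2_sq hy
    have h3 := t4_two_mul_sq hy
    have hp := hpos hy
    have hp2 := hpos (y := 2 * y) (by positivity)
    have p2 := t2_pos hy
    simp only [hR]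
    rw [show 2 * y / 4 = y / 2 by ring, div_eq_div_iff hp2.ne' hp.ne']
    have p4 := t4_pos (y := 2 * y) (by positivity)
    refine mul_left_cancel₀ (mul_pos two_pos p4).ne' ?_
    linear_combination (-(t2 y * t3 y * t4 y)) * h1 + thetaOdd (y / 4) * t3 y * t4 y * h2 -
      2 * thetaOdd (y / 4) * t2 (2 * y) * t3 (2 * y) * h3
  have hpow : ∀ k : ℕ, R (2 ^ k * y) = R y := fun k ↦ by
    induction k with
    | zero => simp
    | succ k ih => rw [pow_succ', mul_assoc, hdouble (by positivity), ih]
  have hlim : Tendsto R atTop (𝓝 1) := by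
    have h := tendsto_thetaOdd.div ((tendsto_t2.mul tendsto_t3).mul tendsto_t4) (by norm_num)
    norm_num at h
    refine h.congr fun y ↦ ?_
    simp only [Pi.div_apply, hR]
    rw [mul_assoc, mul_assoc, mul_div_mul_left _ _ (exp_pos _).ne', ← mul_assoc]
  have h1 : Tendsto (fun k : ℕ ↦ R (2 ^ k * y)) atTop (𝓝 1) :=
    hlim.comp ((tendsto_pow_atTop_atTop_of_one_lt (r := (2 : ℝ)) (by norm_num)).atTop_mul_const hy)
  simp only [hpow] at h1
  have h2 := tendsto_nhds_unique h1 tendsto_const_nhds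
  rwa [eq_comm, div_eq_one_iff_eq (hpos hy).ne'] at h2

noncomputable def oddProd (X : ℂ) : ℂ := ∏' n : ℕ, (1 + X ^ (2 * n + 1))

noncomputable def oddLambert (X : ℂ) : ℂ :=
  ∑' n : ℕ, (2 * n + 1) * X ^ (2 * n + 1) / (1 + X ^ (2 * n + 1))

noncomputable def squareSeries (X : ℂ) : ℂ := ∑' k : ℤ, X ^ (k.natAbs ^ 2)

noncomputable def squareSeriesDeriv (X : ℂ) : ℂ := ∑' k : ℤ, (k : ℂ) ^ 2 * X ^ (k.natAbs ^ 2)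

lemma one_add_pow_ne_zero {X : ℂ} (hX : ‖X‖ < 1) (n : ℕ) : 1 + X ^ (2 * n + 1) ≠ 0 := by
  have h := one_sub_pow_ne_zero (Q := -X) (by rwa [norm_neg]) (2 * n)
  rwa [Odd.neg_pow ⟨n, rfl⟩, sub_neg_eq_add] at h

lemma summable_oddLambert {X : ℂ} (hX : ‖X‖ < 1) :
    Summable fun n : ℕ ↦ (2 * n + 1) * X ^ (2 * n) / (1 + X ^ (2 * n + 1)) := by
  have h1 := (summable_pow_mul_geometric_of_norm_lt_one 1 (r := ‖X‖)
    (by rwa [norm_norm])).mul_left 2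
  have h2 := summable_geometric_of_lt_one (norm_nonneg X) hX
  refine Summable.of_norm_bounded ((h1.add h2).mul_right (1 - ‖X‖)⁻¹) fun n ↦ ?_
  have hp : ‖X‖ ^ (2 * n) ≤ ‖X‖ ^ n := pow_le_pow_of_le_one (norm_nonneg _) hX.le (by omega)
  have hd : 1 - ‖X‖ ≤ ‖1 + X ^ (2 * n + 1)‖ := by
    have := norm_sub_le_norm_add (1 : ℂ) (X ^ (2 * n + 1))
    have h3 : ‖X ^ (2 * n + 1)‖ ≤ ‖X‖ := by
      rw [norm_pow]
      exact pow_le_of_le_one (norm_nonneg _) hX.le (by omega)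
    rw [norm_one] at this
    linarith
  have hn : ‖(2 * n + 1 : ℂ)‖ = 2 * n + 1 := by
    rw [show (2 * n + 1 : ℂ) = ((2 * n + 1 : ℕ) : ℂ) by push_cast; rfl, Complex.norm_natCast]
    push_cast; rfl
  rw [norm_div, norm_mul, norm_pow, hn, div_eq_mul_inv]
  have h0 : 0 < 1 - ‖X‖ := by linarith
  refine mul_le_mul ?_ (inv_anti₀ h0 hd) (inv_nonneg.2 (norm_nonneg _)) (by positivity)
  have := mul_le_mul_of_nonneg_left hp (show (0 : ℝ) ≤ 2 * n + 1 by positivity)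
  nlinarith

lemma oddProd_ne_zero {X : ℂ} (hX : ‖X‖ < 1) : oddProd X ≠ 0 := by
  refine tprod_one_add_ne_zero_of_summable (f := fun n : ℕ ↦ X ^ (2 * n + 1))
    (one_add_pow_ne_zero hX) ?_
  refine Summable.of_nonneg_of_le (fun n ↦ norm_nonneg _) (fun n ↦ ?_)
    (summable_geometric_of_lt_one (norm_nonneg X) hX)
  rw [norm_pow]
  exact pow_le_pow_of_le_one (norm_nonneg _) hX.le (by omega)

lemma hasDerivAt_oddProd {X : ℂ} (hX : ‖X‖ < 1) :
    HasDerivAt oddProd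
      (oddProd X * ∑' n : ℕ, (2 * n + 1) * X ^ (2 * n) / (1 + X ^ (2 * n + 1))) X := by
  obtain ⟨r, hr, hr1⟩ := exists_between hX
  have hr0 : 0 ≤ r := (norm_nonneg X).trans hr.le
  have hmem : X ∈ Metric.ball (0 : ℂ) r := by simpa using hr
  have hprod := Summable.hasProdLocallyUniformlyOn_nat_one_add (R := ℂ)
    (f := fun (n : ℕ) (X : ℂ) ↦ X ^ (2 * n + 1)) (Metric.isOpen_ball (x := 0) (ε := r))
    (summable_geometric_of_lt_one hr0 hr1) (.of_forall fun n x hx ↦ by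
      have hx : ‖x‖ < r := by simpa using hx
      rw [norm_pow]
      exact (pow_le_pow_left₀ (norm_nonneg _) hx.le _).trans
        (pow_le_pow_of_le_one hr0 hr1.le (by omega))) (fun n ↦ by fun_prop)
  have hdiff : DifferentiableOn ℂ oddProd (Metric.ball 0 r) :=
    hprod.differentiableOn (.of_forall fun s ↦ by
      simpa [Finset.prod_fn] using DifferentiableOn.finsetProd (fun _ _ ↦ by fun_prop))
      Metric.isOpen_ball
  have hder : ∀ n : ℕ, logDeriv (fun X : ℂ ↦ 1 + X ^ (2 * n + 1)) X =
      (2 * n + 1) * X ^ (2 * n) / (1 + X ^ (2 * n + 1)) := fun n ↦ by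
    have h : HasDerivAt (fun X : ℂ ↦ 1 + X ^ (2 * n + 1)) ((2 * n + 1) * X ^ (2 * n)) X := by
      have := (hasDerivAt_pow (2 * n + 1) X).const_add 1
      simpa using this
    rw [logDeriv_apply, h.deriv]
  have hlog := logDeriv_tprod_eq_tsum Metric.isOpen_ball hmem
    (f := fun (n : ℕ) (X : ℂ) ↦ 1 + X ^ (2 * n + 1)) (one_add_pow_ne_zero hX)
    (fun n ↦ by fun_prop) (by simpa only [hder] using summable_oddLambert hX) ⟨_, hprod⟩
    (oddProd_ne_zero hX)
  simp only [hder] at hlog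
  have hd := (hdiff.differentiableAt (Metric.isOpen_ball.mem_nhds hmem)).hasDerivAt
  rw [← hlog]
  convert! hd using 1
  rw [logDeriv_apply]
  exact mul_div_cancel₀ _ (oddProd_ne_zero hX)

lemma mul_deriv_oddProd (X : ℂ) :
    X * (oddProd X * ∑' n : ℕ, (2 * n + 1) * X ^ (2 * n) / (1 + X ^ (2 * n + 1))) =
      oddProd X * oddLambert X := by
  rw [mul_left_comm, oddLambert, ← tsum_mul_left]
  congr 1
  exact tsum_congr fun n ↦ by ring

lemma summable_squareSeries {X : ℂ} (hX : ‖X‖ < 1) (h0 : X ≠ 0) :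
    Summable fun k : ℤ ↦ ‖X ^ (k.natAbs ^ 2)‖ := by
  refine (summable_norm_zpow_sq_mul_zpow h0 hX one_ne_zero).congr fun k ↦ ?_
  rw [one_zpow, mul_one, ← zpow_natCast, Nat.cast_pow, Int.natCast_natAbs, sq_abs]

lemma squareSeries_eq {X : ℂ} (hX : ‖X‖ < 1) (h0 : X ≠ 0) :
    squareSeries X = (∏' n : ℕ, (1 - (X ^ 2) ^ (n + 1))) * oddProd X ^ 2 := by
  have h := jacobi_triple_product h0 hX one_ne_zero
  simp only [one_zpow, mul_one, inv_one, one_mul] at h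
  rw [oddProd, sq (∏' n : ℕ, (1 + X ^ (2 * n + 1))), ← h, squareSeries]
  refine tsum_congr fun k ↦ ?_
  rw [← zpow_natCast, Nat.cast_pow, Int.natCast_natAbs, sq_abs]

lemma hasDerivAt_squareSeries {X : ℂ} (hX : ‖X‖ < 1) (h0 : X ≠ 0) :
    HasDerivAt squareSeries (X⁻¹ * squareSeriesDeriv X) X := by
  obtain ⟨r, hr, hr1⟩ := exists_between hX
  have hr0 : 0 < r := (norm_nonneg X).trans_lt hr
  have hmem : X ∈ Metric.ball (0 : ℂ) r := by simpa using hr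
  have hrn : ‖(r : ℂ)‖ = r := by rw [Complex.norm_real, norm_of_nonneg hr0.le]
  have hu : Summable fun k : ℤ ↦ r ^ (k.natAbs ^ 2) := by
    refine (summable_squareSeries (X := r) (by rwa [hrn]) (by exact_mod_cast hr0.ne')).congr
      fun k ↦ ?_
    rw [norm_pow, hrn]
  have hle : ∀ (k : ℤ) (w : ℂ), w ∈ Metric.ball (0 : ℂ) r →
      ‖w ^ (k.natAbs ^ 2)‖ ≤ r ^ (k.natAbs ^ 2) := fun k w hw ↦ by
    have hw : ‖w‖ < r := by simpa using hw
    rw [norm_pow]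
    exact pow_le_pow_left₀ (norm_nonneg _) hw.le _
  have hdiff := Complex.differentiableOn_tsum_of_summable_norm hu (fun k ↦ by fun_prop)
    Metric.isOpen_ball hle
  have hs := Complex.hasSum_deriv_of_summable_norm hu (fun k ↦ by fun_prop)
    Metric.isOpen_ball hle hmem
  have hd := (hdiff.differentiableAt (Metric.isOpen_ball.mem_nhds hmem)).hasDerivAt
  convert! hd using 1
  rw [← hs.tsum_eq, squareSeriesDeriv, ← tsum_mul_left]
  refine tsum_congr fun k ↦ ?_
  rw [deriv_pow_field]
  have e : ((k.natAbs ^ 2 : ℕ) : ℂ) = (k : ℂ) ^ 2 := by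
    rw [← Int.cast_natCast, Nat.cast_pow, Int.natCast_natAbs, sq_abs, Int.cast_pow]
  rw [e]
  rcases eq_or_ne k 0 with rfl | hk
  · simp
  · have : k.natAbs ^ 2 ≠ 0 := by positivity
    obtain ⟨m, hm⟩ := Nat.exists_eq_succ_of_ne_zero this
    rw [hm, Nat.succ_sub_one, Nat.succ_eq_add_one]
    field_simp
    ring

/-- The logarithmic derivative of the triple product at `X` and `-X`. -/
theorem squareSeriesDeriv_sub {X : ℂ} (hX : ‖X‖ < 1) (h0 : X ≠ 0) :
    squareSeriesDeriv X * squareSeries (-X) - squareSeriesDeriv (-X) * squareSeries X =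
      2 * (oddLambert X - oddLambert (-X)) * (squareSeries X * squareSeries (-X)) := by
  have hX' : ‖-X‖ < 1 := by rwa [norm_neg]
  have h0' : -X ≠ 0 := neg_ne_zero.2 h0
  have hloc : (fun Z ↦ squareSeries Z * oddProd (-Z) ^ 2) =ᶠ[𝓝 X]
      fun Z ↦ squareSeries (-Z) * oddProd Z ^ 2 := by
    have hb : ∀ᶠ Z : ℂ in 𝓝 X, ‖Z‖ < 1 := (continuous_norm.tendsto X).eventually_lt_const hX
    filter_upwards [hb, eventually_ne_nhds h0] with Z hZ hZ0
    rw [squareSeries_eq hZ hZ0, squareSeries_eq (by rwa [norm_neg]) (neg_ne_zero.2 hZ0), neg_sq]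
    ring
  have d1 := hasDerivAt_squareSeries hX h0
  have d2 := HasDerivAt.comp X (hasDerivAt_squareSeries hX' h0') (hasDerivAt_neg X)
  have d3 := hasDerivAt_oddProd hX
  have d4 := HasDerivAt.comp X (hasDerivAt_oddProd hX') (hasDerivAt_neg X)
  have e1 := d1.mul (d4.pow 2)
  have e2 := d2.mul (d3.pow 2)
  have h := (e1.congr_of_eventuallyEq hloc.symm).unique e2
  have m1 := mul_deriv_oddProd X
  have m2 := mul_deriv_oddProd (-X)
  have s1 := squareSeries_eq hX h0
  have s2 := squareSeries_eq hX' h0'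
  rw [neg_sq] at s2
  simp only [Function.comp_apply, Nat.cast_ofNat, Nat.add_one_sub_one, pow_one, Pi.pow_apply] at h
  generalize (oddProd X * ∑' n : ℕ, (2 * n + 1) * X ^ (2 * n) / (1 + X ^ (2 * n + 1))) = P at *
  generalize (oddProd (-X) * ∑' n : ℕ, (2 * n + 1) * (-X) ^ (2 * n) / (1 + (-X) ^ (2 * n + 1))) = M
    at *
  generalize (∏' n : ℕ, (1 - (X ^ 2) ^ (n + 1))) = E at *
  have hi : X * X⁻¹ = 1 := mul_inv_cancel₀ h0
  rw [inv_neg] at h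
  have hh : squareSeriesDeriv X * oddProd (-X) ^ 2 +
      2 * squareSeries X * oddProd (-X) ^ 2 * oddLambert (-X) =
      squareSeriesDeriv (-X) * oddProd X ^ 2 +
        2 * squareSeries (-X) * oddProd X ^ 2 * oddLambert X := by
    linear_combination X * h - 2 * squareSeries X * oddProd (-X) * m2 +
      2 * squareSeries (-X) * oddProd X * m1 -
      (squareSeriesDeriv X * oddProd (-X) ^ 2 - squareSeriesDeriv (-X) * oddProd X ^ 2) * hi
  linear_combination E * hh +
    (squareSeriesDeriv X + 2 * squareSeries X * oddLambert (-X)) * s2 -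
    (squareSeriesDeriv (-X) + 2 * squareSeries (-X) * oddLambert X) * s1

lemma I_pow_sq (m : ℕ) : Complex.I ^ (m ^ 2) = if m % 2 = 0 then 1 else Complex.I := by
  split_ifs with h
  · obtain ⟨j, rfl⟩ : ∃ j, m = 2 * j := ⟨m / 2, by omega⟩
    rw [show (2 * j) ^ 2 = 4 * j ^ 2 by ring, pow_mul, Complex.I_pow_four, one_pow]
  · obtain ⟨j, rfl⟩ : ∃ j, m = 2 * j + 1 := ⟨m / 2, by omega⟩
    rw [show (2 * j + 1) ^ 2 = 4 * (j ^ 2 + j) + 1 by ring, pow_succ, pow_mul, Complex.I_pow_four,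
      one_pow, one_mul]

lemma sign_pow_sq {ε : ℂ} (hε : ε ^ 2 = 1) (m : ℕ) :
    ε ^ (m ^ 2) = if m % 2 = 0 then 1 else ε := by
  split_ifs with h
  · obtain ⟨j, rfl⟩ : ∃ j, m = 2 * j := ⟨m / 2, by omega⟩
    rw [show (2 * j) ^ 2 = 2 * (2 * j ^ 2) by ring, pow_mul, hε, one_pow]
  · obtain ⟨j, rfl⟩ : ∃ j, m = 2 * j + 1 := ⟨m / 2, by omega⟩
    rw [show (2 * j + 1) ^ 2 = 2 * (2 * (j ^ 2 + j)) + 1 by ring, pow_succ, pow_mul, hε,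
      one_pow, one_mul]

lemma tsum_mul_I_pow {y : ℝ} {c : ℤ → ℝ} (hs : Summable fun k : ℤ ↦ |c k| * gauss (y / 2) k)
    {ε : ℂ} (hε : ε ^ 2 = 1) :
    ∑' k : ℤ, (c k : ℂ) * (ε * Complex.I * (exp (-(π * y / 2)) : ℝ)) ^ (k.natAbs ^ 2) =
      ((∑' k : ℤ, c k * ind (k % 2 = 0) * gauss (y / 2) k : ℝ) : ℂ) +
        ε * Complex.I * ((∑' k : ℤ, c k * ind (k % 2 = 1) * gauss (y / 2) k : ℝ) : ℂ) := by
  have key : ∀ P : ℤ → Prop, [DecidablePred P] →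
      Summable fun k : ℤ ↦ ((c k * ind (P k) * gauss (y / 2) k : ℝ) : ℂ) := fun P _ ↦ by
    rw [Complex.summable_ofReal]
    refine Summable.of_norm_bounded hs fun k ↦ ?_
    rw [norm_mul, norm_mul, norm_of_nonneg (gauss_pos _ _).le, norm_eq_abs, norm_eq_abs]
    exact mul_le_mul_of_nonneg_right (mul_le_of_le_one_right (abs_nonneg _) (abs_ind_le _))
      (gauss_pos _ _).le
  rw [Complex.ofReal_tsum, Complex.ofReal_tsum, ← tsum_mul_left,
    ← (key _).tsum_add ((key _).mul_left _)]
  refine tsum_congr fun k ↦ ?_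
  have hg : ((exp (-(π * y / 2)) : ℝ) : ℂ) ^ (k.natAbs ^ 2) = (gauss (y / 2) k : ℝ) := by
    rw [← Complex.ofReal_pow, ← exp_nat_mul, gauss]
    congr 2
    have : ((k.natAbs ^ 2 : ℕ) : ℝ) = (k : ℝ) ^ 2 := by
      rw [← Int.cast_natCast, Nat.cast_pow, Int.natCast_natAbs, sq_abs, Int.cast_pow]
    rw [this]
    ring
  rw [mul_pow, mul_pow, hg, I_pow_sq, sign_pow_sq hε]
  rcases Int.emod_two_eq_zero_or_one k with h | h
  · rw [if_pos (by omega), if_pos (by omega), ind, ind, if_pos h, if_neg (by omega)]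
    push_cast
    ring
  · rw [if_neg (by omega), if_neg (by omega), ind, ind, if_neg (by omega), if_pos h]
    push_cast
    ring

lemma t3_eq_tsum_even (y : ℝ) : t3 y = ∑' n : ℤ, ind (n % 2 = 0) * gauss (y / 4) n := by
  rw [← (mul_right_injective₀ (two_ne_zero' ℤ)).tsum_eq]
  · refine tsum_congr fun n ↦ ?_
    rw [ind, if_pos (by omega), one_mul, gauss, gauss]
    congr 1
    push_cast
    ring
  · intro n hn
    have h : ind (n % 2 = 0) ≠ 0 := fun h ↦ hn (by simp only [h, zero_mul])
    have := ind_ne_zero.1 h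
    exact ⟨n / 2, by simp only; omega⟩

lemma squareSeries_I_mul {y : ℝ} (hy : 0 < y) {ε : ℂ} (hε : ε ^ 2 = 1) :
    squareSeries (ε * Complex.I * (exp (-(π * y / 2)) : ℝ)) =
      (t3 (2 * y) : ℂ) + ε * Complex.I * (t2 (2 * y) : ℂ) := by
  have h := tsum_mul_I_pow (y := y) (c := fun _ ↦ 1)
    (by simpa using summable_gauss (y := y / 2) (by positivity)) hε
  simp only [Complex.ofReal_one, one_mul] at h
  rw [squareSeries, h, t3_eq_tsum_even, t2_eq_tsum_odd, show 2 * y / 4 = y / 2 by ring]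

lemma squareSeriesDeriv_I_mul {y : ℝ} (hy : 0 < y) {ε : ℂ} (hε : ε ^ 2 = 1) :
    squareSeriesDeriv (ε * Complex.I * (exp (-(π * y / 2)) : ℝ)) =
      ((∑' k : ℤ, (k : ℝ) ^ 2 * ind (k % 2 = 0) * gauss (y / 2) k : ℝ) : ℂ) +
        ε * Complex.I * ((∑' k : ℤ, (k : ℝ) ^ 2 * ind (k % 2 = 1) * gauss (y / 2) k : ℝ) : ℂ) := by
  have h := tsum_mul_I_pow (y := y) (c := fun k ↦ (k : ℝ) ^ 2)
    (by simpa using summable_pow_mul_gauss_add (y := y / 2) (by positivity) 2) hε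
  rw [← h, squareSeriesDeriv]
  push_cast
  rfl

/-- The squared weight `3 / 2` theta series as a Wronskian of theta constants. -/
lemma thetaOdd_sq {y : ℝ} (hy : 0 < y) :
    thetaOdd (y / 4) ^ 2 =
      2 * ((∑' k : ℤ, (k : ℝ) ^ 2 * ind (k % 2 = 1) * gauss (y / 2) k) * t3 (2 * y) -
        (∑' k : ℤ, (k : ℝ) ^ 2 * ind (k % 2 = 0) * gauss (y / 2) k) * t2 (2 * y)) := by
  have hy2 : 0 < y / 2 := by positivity
  have hsq : ∀ P : ℤ → Prop, [DecidablePred P] →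
      Summable fun k : ℤ ↦ (k : ℝ) ^ 2 * ind (P k) * gauss (y / 2) k := fun P _ ↦ by
    refine Summable.of_norm_bounded (summable_pow_mul_gauss_add hy2 2) fun k ↦ ?_
    rw [norm_mul, norm_mul, norm_of_nonneg (gauss_pos _ _).le, norm_pow, norm_eq_abs, norm_eq_abs]
    exact mul_le_mul_of_nonneg_right (mul_le_of_le_one_right (by positivity) (abs_ind_le _))
      (gauss_pos _ _).le
  have hind : ∀ P : ℤ → Prop, [DecidablePred P] →
      Summable fun k : ℤ ↦ ind (P k) * gauss (y / 2) k := fun P _ ↦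
    summable_linear_gauss hy2 fun k ↦ abs_ind_le_linear _ k
  have hi1 : ∀ a : ℤ, (0 ≤ ind (a % 2 = 1)) ∧ ind (a % 2 = 1) ≤ 1 := fun a ↦ by
    unfold ind; split_ifs <;> simp
  have hi0 : ∀ a : ℤ, (0 ≤ ind (a % 2 = 0)) ∧ ind (a % 2 = 0) ≤ 1 := fun a ↦ by
    unfold ind; split_ifs <;> simp
  have hb : ∀ p : ℤ × ℤ,
      |ind (p.1 % 2 = 1) * ind (p.2 % 2 = 0) * ((p.1 : ℝ) ^ 2 - (p.2 : ℝ) ^ 2)| ≤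
      1 * ((1 + |(p.1 : ℝ)|) ^ 2 * (1 + |(p.2 : ℝ)|) ^ 2) := fun p ↦ by
    have h1 : |ind (p.1 % 2 = 1) * ind (p.2 % 2 = 0)| ≤ 1 := by
      rw [abs_mul]; exact mul_le_one₀ (abs_ind_le _) (abs_nonneg _) (abs_ind_le _)
    rw [abs_mul, one_mul]
    refine (mul_le_of_le_one_left (abs_nonneg _) h1).trans ((abs_sub _ _).trans ?_)
    rw [abs_pow, abs_pow]
    have ha := abs_nonneg (p.1 : ℝ)
    have hb := abs_nonneg (p.2 : ℝ)
    nlinarith [mul_nonneg ha hb, mul_nonneg (mul_nonneg ha hb) ha, mul_nonneg (mul_nonneg ha hb) hb,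
      sq_nonneg (|(p.1 : ℝ)| * |(p.2 : ℝ)|)]
  have h1 : thetaOdd (y / 4) ^ 2 = 2 * latSum
      (fun p ↦ ind (p.1 % 2 = 1) * ind (p.2 % 2 = 0) * ((p.1 : ℝ) ^ 2 - (p.2 : ℝ) ^ 2))
      (y / 2) (y / 2) := by
    rw [← latSum_add_swap hb hy2, sq, thetaOdd,
      latSum_mul abs_chi_mul_le abs_chi_mul_le (by positivity) (by positivity)]
    refine latSum_rotate (fun p hp ↦ ?_) (fun a b ↦ ?_) y
    · exact ⟨chi_ne_zero (left_ne_zero_of_mul (left_ne_zero_of_mul hp)),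
        chi_ne_zero (left_ne_zero_of_mul (right_ne_zero_of_mul hp))⟩
    · have e : chi (a + b) * chi (a - b) = ind (a % 2 = 1) * ind (b % 2 = 0) -
          ind (b % 2 = 1) * ind (a % 2 = 0) := by
        unfold chi ind
        split_ifs <;> first | (exfalso; omega) | norm_num
      simp only [Prod.fst_swap, Prod.snd_swap]
      push_cast
      linear_combination ((a : ℝ) ^ 2 - (b : ℝ) ^ 2) * e
  have hm : ∀ {c d : ℤ → ℝ}, (Summable fun k : ℤ ↦ c k * gauss (y / 2) k) →
      (Summable fun k : ℤ ↦ d k * gauss (y / 2) k) →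
      HasSum (fun p : ℤ × ℤ ↦ c p.1 * gauss (y / 2) p.1 * (d p.2 * gauss (y / 2) p.2))
        ((∑' k : ℤ, c k * gauss (y / 2) k) * ∑' k : ℤ, d k * gauss (y / 2) k) := fun hc hd ↦ by
    rw [tsum_mul_tsum_of_summable_norm hc.norm hd.norm]
    exact (summable_mul_of_summable_norm hc.norm hd.norm).hasSum
  have k1 := (hm (hsq fun k ↦ k % 2 = 1) (hind fun k ↦ k % 2 = 0)).sub
    (hm (hind fun k ↦ k % 2 = 1) (hsq fun k ↦ k % 2 = 0))
  rw [h1, t2_eq_tsum_odd, t3_eq_tsum_even, show 2 * y / 4 = y / 2 by ring, latSum]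
  refine congrArg (2 * ·) ?_
  refine (tsum_congr fun p ↦ ?_).trans (k1.tsum_eq.trans ?_)
  · ring
  · exact congrArg _ (mul_comm _ _)

/-- The Lambert series attached to the odd character modulo four. -/
noncomputable def chiLambert (x : ℝ) : ℝ :=
  ∑' n : ℕ, (-1) ^ n * (2 * n + 1) * (x ^ (2 * n + 1) / (1 + (x ^ (2 * n + 1)) ^ 2))

lemma summable_oddLambert' {X : ℂ} (hX : ‖X‖ < 1) :
    Summable fun n : ℕ ↦ (2 * n + 1) * X ^ (2 * n + 1) / (1 + X ^ (2 * n + 1)) :=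
  ((summable_oddLambert hX).mul_left X).congr fun n ↦ by ring

lemma oddLambert_sub {x : ℝ} (hx0 : 0 ≤ x) (hx : x < 1) :
    oddLambert (Complex.I * x) - oddLambert (-(Complex.I * x)) =
      2 * Complex.I * (chiLambert x : ℂ) := by
  have hX : ‖Complex.I * x‖ < 1 := by
    rwa [norm_mul, Complex.norm_I, one_mul, Complex.norm_real, norm_of_nonneg hx0]
  have hX' : ‖-(Complex.I * x)‖ < 1 := by rwa [norm_neg]
  rw [oddLambert, oddLambert, ← (summable_oddLambert' hX).tsum_sub (summable_oddLambert' hX'),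
    chiLambert, Complex.ofReal_tsum, ← tsum_mul_left]
  refine tsum_congr fun n ↦ ?_
  have h1 := one_add_pow_ne_zero hX n
  have h2 := one_add_pow_ne_zero hX' n
  have e1 : (Complex.I * (x : ℂ)) ^ (2 * n + 1) = (-1) ^ n * Complex.I * (x : ℂ) ^ (2 * n + 1) := by
    rw [mul_pow, pow_succ Complex.I, pow_mul, Complex.I_sq]
  have e2 : (-(Complex.I * (x : ℂ))) ^ (2 * n + 1) =
      -((-1) ^ n * Complex.I * (x : ℂ) ^ (2 * n + 1)) := by
    rw [Odd.neg_pow ⟨n, rfl⟩, e1]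
  rw [e1] at h1
  rw [e2] at h2
  rw [e1, e2]
  have hs : ((-1 : ℂ) ^ n) ^ 2 = 1 := by rw [← pow_mul, mul_comm, pow_mul]; norm_num
  have h3 : 1 + ((x : ℂ) ^ (2 * n + 1)) ^ 2 ≠ 0 := by
    have := mul_ne_zero h1 h2
    intro h
    refine this ?_
    linear_combination h - ((x : ℂ) ^ (2 * n + 1)) ^ 2 * (Complex.I ^ 2 * hs + Complex.I_sq)
  push_cast
  generalize (x : ℂ) ^ (2 * n + 1) = p at *
  generalize (-1 : ℂ) ^ n = s at *
  rw [div_sub_div _ _ h1 h2, mul_div_assoc', mul_div_assoc', div_eq_div_iff (mul_ne_zero h1 h2) h3]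
  have hI := Complex.I_sq
  linear_combination (2 * (2 * n + 1) * s * Complex.I * p * p ^ 2) *
    (Complex.I ^ 2 * hs + hI)

theorem chiLambert_eq {y : ℝ} (hy : 0 < y) :
    chiLambert (exp (-(π * y / 2))) = 1 / 4 * (t2 y ^ 2 * t4 y ^ 2) := by
  have hx0 := exp_pos (-(π * y / 2))
  have hx1 : exp (-(π * y / 2)) < 1 := exp_lt_one_iff.2 (by have := mul_pos pi_pos hy; linarith)
  have hX : ‖Complex.I * (exp (-(π * y / 2)) : ℝ)‖ < 1 := by
    rwa [norm_mul, Complex.norm_I, one_mul, Complex.norm_real, norm_of_nonneg hx0.le]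
  have hX0 : Complex.I * ((exp (-(π * y / 2)) : ℝ) : ℂ) ≠ 0 :=
    mul_ne_zero Complex.I_ne_zero (by exact_mod_cast hx0.ne')
  have h := squareSeriesDeriv_sub hX hX0
  have a1 := squareSeries_I_mul hy (ε := 1) (by norm_num)
  have a2 := squareSeries_I_mul hy (ε := -1) (by norm_num)
  have b1 := squareSeriesDeriv_I_mul hy (ε := 1) (by norm_num)
  have b2 := squareSeriesDeriv_I_mul hy (ε := -1) (by norm_num)
  simp only [one_mul, neg_mul] at a1 a2 b1 b2
  rw [oddLambert_sub hx0.le hx1, a1, a2, b1, b2] at h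
  have hw := thetaOdd_sq hy
  rw [thetaOdd_eq hy] at hw
  generalize (∑' k : ℤ, (k : ℝ) ^ 2 * ind (k % 2 = 1) * gauss (y / 2) k) = v at *
  generalize (∑' k : ℤ, (k : ℝ) ^ 2 * ind (k % 2 = 0) * gauss (y / 2) k) = u at *
  have h2 : v * t3 (2 * y) - u * t2 (2 * y) =
      2 * chiLambert (exp (-(π * y / 2))) * (t3 (2 * y) ^ 2 + t2 (2 * y) ^ 2) := by
    have hI := Complex.I_sq
    have : (2 * Complex.I) * ((v * t3 (2 * y) - u * t2 (2 * y) : ℝ) : ℂ) = (2 * Complex.I) *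
        ((2 * chiLambert (exp (-(π * y / 2))) * (t3 (2 * y) ^ 2 + t2 (2 * y) ^ 2) : ℝ) : ℂ) := by
      push_cast
      linear_combination h - 4 * Complex.I * (chiLambert (exp (-(π * y / 2)))) *
        (t2 (2 * y)) ^ 2 * hI
    exact_mod_cast mul_left_cancel₀ (mul_ne_zero two_ne_zero Complex.I_ne_zero) this
  have h3 := two_mul_t3_two_mul_sq hy
  have h4 := two_mul_t2_two_mul_sq hy
  have hp := t3_pos hy
  refine mul_left_cancel₀ (pow_pos hp 2).ne' ?_
  have h5 : t3 (2 * y) ^ 2 + t2 (2 * y) ^ 2 = t3 y ^ 2 := by linarith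
  rw [h2, h5] at hw
  linear_combination -(1 / 4) * hw

/-- The Bessel integral of order one half. -/
theorem integral_inv_sqrt_mul_exp {A B : ℝ} (hA : 0 < A) (hB : 0 < B) :
    IntegrableOn (fun y ↦ (√y)⁻¹ * exp (-(A * y + B / y))) (Set.Ioi 0) ∧
      ∫ y in Set.Ioi 0, (√y)⁻¹ * exp (-(A * y + B / y)) = √(π / A) * exp (-(2 * √(A * B))) := by
  obtain ⟨c, hc0, hcB⟩ : ∃ c : ℝ, 0 < c ∧ B = A * c ^ 2 :=
    ⟨√(B / A), by positivity, by rw [sq_sqrt (by positivity)]; field_simp⟩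
  subst hcB
  have hAB : √(A * (A * c ^ 2)) = A * c := by
    rw [show A * (A * c ^ 2) = (A * c) ^ 2 by ring, sqrt_sq (by positivity)]
  set P : ℝ → ℝ := fun y ↦ (√y)⁻¹ * exp (-(A * y + A * c ^ 2 / y)) with hP
  set Q : ℝ → ℝ := fun y ↦ c / (y * √y) * exp (-(A * y + A * c ^ 2 / y)) with hQ
  have hderiv : ∀ y ∈ Set.Ioi (0 : ℝ), HasDerivWithinAt (fun y ↦ √y - c / √y)
      (1 / 2 * ((√y)⁻¹ + c / (y * √y))) (Set.Ioi 0) y := fun y hy ↦ by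
    have hy : 0 < y := hy
    have h1 := hasDerivAt_sqrt hy.ne'
    have h2 := h1.sub ((h1.inv (sqrt_ne_zero'.2 hy)).const_mul c)
    refine HasDerivAt.hasDerivWithinAt ?_
    convert! h2 using 1
    rw [sq_sqrt hy.le]
    have := (sqrt_pos.2 hy).ne'
    field_simp
    ring
  have hmono : StrictMonoOn (fun y ↦ √y - c / √y) (Set.Ioi (0 : ℝ)) := by
    intro a ha b hb hab
    have h1 := sqrt_lt_sqrt (le_of_lt ha) hab
    have h2 := div_lt_div_of_pos_left hc0 (sqrt_pos.2 ha) h1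
    simp only
    linarith
  have himg : (fun y ↦ √y - c / √y) '' Set.Ioi (0 : ℝ) = Set.univ := by
    refine Set.eq_univ_of_forall fun v ↦ ?_
    have h1 : |v| < √(v ^ 2 + 4 * c) := by
      rw [← sqrt_sq_eq_abs]
      exact sqrt_lt_sqrt (sq_nonneg v) (by linarith)
    have h2 : 0 < (v + √(v ^ 2 + 4 * c)) / 2 := by linarith [neg_abs_le v]
    refine ⟨((v + √(v ^ 2 + 4 * c)) / 2) ^ 2, pow_pos h2 2, ?_⟩
    have h3 : √(v ^ 2 + 4 * c) ^ 2 = v ^ 2 + 4 * c := sq_sqrt (by positivity)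
    simp only
    rw [sqrt_sq h2.le, sub_eq_iff_eq_add, ← sub_eq_iff_eq_add', eq_div_iff h2.ne']
    linear_combination (1 / 4) * h3
  have hval : ∀ y ∈ Set.Ioi (0 : ℝ), |1 / 2 * ((√y)⁻¹ + c / (y * √y))| •
      exp (-A * (√y - c / √y) ^ 2) = exp (2 * (A * c)) / 2 * (P y + Q y) := fun y hy ↦ by
    have hy : 0 < y := hy
    have hs := sqrt_pos.2 hy
    have e : -A * (√y - c / √y) ^ 2 = 2 * (A * c) + -(A * y + A * c ^ 2 / y) := by
      have h := sq_sqrt hy.le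
      have h1 : (√y - c / √y) ^ 2 = √y ^ 2 - 2 * c + c ^ 2 / √y ^ 2 := by
        field_simp
        ring
      rw [h1, h]
      ring
    rw [abs_of_pos (by positivity), smul_eq_mul, e, exp_add]
    simp only [hP, hQ]
    ring
  have hgauss := integrable_exp_neg_mul_sq hA
  have hinteg : IntegrableOn (fun y ↦ exp (2 * (A * c)) / 2 * (P y + Q y)) (Set.Ioi 0) := by
    refine IntegrableOn.congr_fun ?_ hval measurableSet_Ioi
    rw [← integrableOn_image_iff_integrableOn_abs_deriv_smul measurableSet_Ioi hderiv
      hmono.injOn (fun v ↦ exp (-A * v ^ 2)), himg]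
    exact hgauss.integrableOn
  have hsum : exp (2 * (A * c)) / 2 * ∫ y in Set.Ioi 0, (P y + Q y) = √(π / A) := by
    have hg : ∫ x in (fun y ↦ √y - c / √y) '' Set.Ioi 0, exp (-A * x ^ 2) = √(π / A) := by
      rw [himg, setIntegral_univ, integral_gaussian]
    rw [← integral_const_mul, ← hg,
      integral_image_eq_integral_abs_deriv_smul measurableSet_Ioi hderiv hmono.injOn]
    exact (setIntegral_congr_fun measurableSet_Ioi hval).symm
  have hint2 : IntegrableOn (fun y ↦ P y + Q y) (Set.Ioi 0) :=
    (integrable_const_mul_iff (IsUnit.mk0 _ (by positivity)) _).1 hinteg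
  have hPm : Measurable P := by fun_prop
  have hQm : Measurable Q := by fun_prop
  have hpos : ∀ y ∈ Set.Ioi (0 : ℝ), 0 ≤ P y ∧ 0 ≤ Q y := fun y hy ↦ by
    have hy : 0 < y := hy
    exact ⟨by positivity, by positivity⟩
  have hPi : IntegrableOn P (Set.Ioi 0) := by
    refine Integrable.mono' hint2 hPm.aestronglyMeasurable
      ((ae_restrict_iff' measurableSet_Ioi).2 (Eventually.of_forall fun y hy ↦ ?_))
    rw [norm_of_nonneg (hpos y hy).1]
    linarith [(hpos y hy).2]
  have hQi : IntegrableOn Q (Set.Ioi 0) := by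
    refine Integrable.mono' hint2 hQm.aestronglyMeasurable
      ((ae_restrict_iff' measurableSet_Ioi).2 (Eventually.of_forall fun y hy ↦ ?_))
    rw [norm_of_nonneg (hpos y hy).2]
    linarith [(hpos y hy).1]
  have hPQ : ∫ y in Set.Ioi 0, P y = ∫ y in Set.Ioi 0, Q y := by
    have hd : ∀ y ∈ Set.Ioi (0 : ℝ), HasDerivWithinAt (fun y ↦ c ^ 2 / y) (-(c ^ 2 / y ^ 2))
        (Set.Ioi 0) y := fun y hy ↦ by
      have h := ((hasDerivAt_inv (ne_of_gt hy)).const_mul (c ^ 2)).hasDerivWithinAt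
        (s := Set.Ioi (0 : ℝ))
      convert! h using 1
      ring
    have hinj : Set.InjOn (fun y ↦ c ^ 2 / y) (Set.Ioi (0 : ℝ)) := fun a ha b hb h ↦ by
      simp only at h
      rw [div_eq_div_iff (ne_of_gt ha) (ne_of_gt hb)] at h
      exact (mul_left_cancel₀ (by positivity) h).symm
    have him : (fun y ↦ c ^ 2 / y) '' Set.Ioi (0 : ℝ) = Set.Ioi 0 := by
      ext v
      constructor
      · rintro ⟨y, hy, rfl⟩
        have hy : 0 < y := hy
        exact div_pos (by positivity) hy
      · intro hv
        have hv : 0 < v := hv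
        exact ⟨c ^ 2 / v, div_pos (by positivity) hv, by simp only; field_simp⟩
    conv_lhs => rw [← him]
    rw [integral_image_eq_integral_abs_deriv_smul measurableSet_Ioi hd hinj]
    refine setIntegral_congr_fun measurableSet_Ioi fun y hy ↦ ?_
    have hy : 0 < y := hy
    have hs := sqrt_pos.2 hy
    have e1 : √(c ^ 2 / y) = c / √y := by rw [sqrt_div (by positivity), sqrt_sq hc0.le]
    have e2 : A * (c ^ 2 / y) + A * c ^ 2 / (c ^ 2 / y) = A * y + A * c ^ 2 / y := by
      field_simp
      ring
    have e3 : c ^ 2 / y ^ 2 * (c / √y)⁻¹ = c / (y * √y) := by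
      have h := sq_sqrt hy.le
      field_simp
      linear_combination h
    simp only [hP, hQ, smul_eq_mul]
    rw [abs_neg, abs_of_pos (by positivity), e1, e2, ← mul_assoc, e3]
  refine ⟨hPi, ?_⟩
  rw [integral_add hPi hQi, ← hPQ] at hsum
  rw [hAB, ← hsum, exp_neg]
  field_simp
  ring

lemma chi_two_mul_add_one (k : ℕ) : chi (2 * k + 1) = (-1) ^ k := by
  rcases Nat.even_or_odd k with h | h
  · rw [h.neg_one_pow, chi, if_pos (by have := Nat.even_iff.1 h; omega)]
  · have := Nat.odd_iff.1 h
    rw [h.neg_one_pow, chi, if_neg (by omega), if_pos (by omega)]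

lemma summable_thetaOdd_nat {y : ℝ} (hy : 0 < y) :
    Summable fun k : ℕ ↦ (-1) ^ k * (2 * k + 1) * gauss y (2 * k + 1) := by
  have hi : Function.Injective fun k : ℕ ↦ (2 * k + 1 : ℤ) := fun a b h ↦ by simpa using h
  refine ((summable_linear_gauss hy abs_chi_mul_le).comp_injective hi).congr fun k ↦ ?_
  simp only [Function.comp, chi_two_mul_add_one]
  push_cast
  ring

lemma thetaOdd_eq_tsum_nat {y : ℝ} (hy : 0 < y) :
    thetaOdd y = 2 * ∑' k : ℕ, (-1) ^ k * (2 * k + 1) * gauss y (2 * k + 1) := by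
  have hi : Function.Injective fun k : ℕ ↦ Nat.succPNat (2 * k) := fun a b h ↦ by
    simpa using Nat.succPNat_injective h
  have heven : Function.Even fun n : ℤ ↦ chi n * n * gauss y n := fun n ↦ by
    have h1 : chi (-n) = -chi n := by
      unfold chi
      split_ifs <;> first | omega | simp
    have h2 : gauss y ((-n : ℤ) : ℝ) = gauss y n := by
      rw [gauss, gauss]
      push_cast
      rw [neg_sq]
    simp only [h1, h2]
    push_cast
    ring
  rw [thetaOdd, tsum_int_eq_zero_add_two_mul_tsum_pnat heven
    (summable_linear_gauss hy abs_chi_mul_le), ← hi.tsum_eq]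
  · simp only [Int.cast_zero, mul_zero, zero_mul, zero_add, nsmul_eq_mul, Nat.cast_ofNat]
    congr 1
    refine tsum_congr fun k ↦ ?_
    have e : ((Nat.succPNat (2 * k) : ℕ) : ℤ) = 2 * k + 1 := by simp
    rw [e, chi_two_mul_add_one]
    push_cast
    rfl
  · intro n hn
    have h : chi n ≠ 0 := fun h ↦ hn (by simp [h])
    have h2 : (n : ℕ) % 2 = 1 := by
      by_contra h3
      refine h ?_
      rw [chi, if_neg (by omega), if_neg (by omega)]
    refine ⟨(n : ℕ) / 2, ?_⟩
    apply PNat.eq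
    simp only [Nat.succPNat_coe]
    omega

lemma summable_odd_mul_pow {x : ℝ} (hx0 : 0 ≤ x) (hx1 : x < 1) :
    Summable fun p : ℕ × ℕ ↦ (2 * (p.1 : ℝ) + 1) * x ^ ((2 * p.1 + 1) * (2 * p.2 + 1)) := by
  have h1 : Summable fun n : ℕ ↦ (2 * (n : ℝ) + 1) * x ^ n := by
    have h := ((summable_pow_mul_geometric_of_norm_lt_one 1
      (by rwa [norm_of_nonneg hx0] : ‖x‖ < 1)).mul_left 2).add (summable_geometric_of_lt_one hx0 hx1)
    refine h.congr fun n ↦ ?_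
    ring
  have h2 := h1.mul_of_nonneg (summable_geometric_of_lt_one hx0 hx1) (fun n ↦ by positivity)
    (fun n ↦ by positivity)
  refine Summable.of_nonneg_of_le (fun p ↦ by positivity) (fun p ↦ ?_) h2
  rw [mul_assoc, ← pow_add]
  refine mul_le_mul_of_nonneg_left (pow_le_pow_of_le_one hx0 hx1.le ?_) (by positivity)
  nlinarith [Nat.zero_le (p.1 * p.2)]

lemma tsum_odd_mul_pow {x : ℝ} (hx0 : 0 ≤ x) (hx1 : x < 1) :
    ∑' p : ℕ × ℕ, (-1) ^ p.1 * (-1) ^ p.2 *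
      ((2 * (p.1 : ℝ) + 1) * x ^ ((2 * p.1 + 1) * (2 * p.2 + 1))) = chiLambert x := by
  have hs : Summable fun p : ℕ × ℕ ↦ (-1) ^ p.1 * (-1) ^ p.2 *
      ((2 * (p.1 : ℝ) + 1) * x ^ ((2 * p.1 + 1) * (2 * p.2 + 1))) := by
    refine Summable.of_norm_bounded (summable_odd_mul_pow hx0 hx1) fun p ↦ ?_
    rw [norm_mul, norm_mul, norm_pow, norm_pow, norm_neg, norm_one, one_pow, one_pow, one_mul,
      one_mul, norm_of_nonneg (by positivity)]
  rw [hs.tsum_prod, chiLambert]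
  refine tsum_congr fun n ↦ ?_
  have hz0 : 0 ≤ x ^ (2 * n + 1) := by positivity
  have hz1 : x ^ (2 * n + 1) < 1 := pow_lt_one₀ hx0 hx1 (by omega)
  have hg : ‖-(x ^ (2 * n + 1)) ^ 2‖ < 1 := by
    rw [norm_neg, norm_of_nonneg (by positivity)]
    exact pow_lt_one₀ hz0 hz1 two_ne_zero
  have h := (hasSum_geometric_of_norm_lt_one hg).mul_left
    ((-1) ^ n * (2 * (n : ℝ) + 1) * x ^ (2 * n + 1))
  rw [sub_neg_eq_add] at h
  rw [div_eq_mul_inv, ← mul_assoc, ← h.tsum_eq]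
  refine tsum_congr fun m ↦ ?_
  simp only
  rw [neg_pow ((x ^ (2 * n + 1)) ^ 2) m, pow_mul x (2 * n + 1)]
  ring

lemma theta_prod_inv {z : ℝ} (hz : 0 < z) :
    t2 (1 / z) * t3 (1 / z) * t4 (1 / z) = z * √z * (t2 z * t3 z * t4 z) := by
  rw [t2_inv hz, t3_inv hz, t4_inv hz]
  linear_combination (√z * (t2 z * t3 z * t4 z)) * sq_sqrt hz.le

theorem integral_theta_prod_mul {a b : ℝ} (ha : 0 < a) (hb : 0 < b) :
    ∫ y in Set.Ioi 0, (1 / 2 * (t2 (a * y) * t3 (a * y) * t4 (a * y))) *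
      (1 / 2 * (t2 (b * y) * t3 (b * y) * t4 (b * y))) * y =
    (t2 √(a / b) ^ 2 * t4 √(a / b) ^ 2) / (2 * b * √(a * b)) := by
  set F : ℕ × ℕ → ℝ → ℝ := fun p y ↦ ((-1) ^ p.1 * (-1) ^ p.2 * ((2 * (p.1 : ℝ) + 1) *
    (2 * (p.2 : ℝ) + 1)) / (b * √b)) * ((√y)⁻¹ * exp (-(π * a * (2 * (p.2 : ℝ) + 1) ^ 2 / 4 * y +
      π * (2 * (p.1 : ℝ) + 1) ^ 2 / (4 * b) / y))) with hF
  set x := exp (-(π * √(a / b) / 2)) with hx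
  have hx0 : 0 ≤ x := (exp_pos _).le
  have hx1 : x < 1 := exp_lt_one_iff.2 (by
    have : 0 < π * √(a / b) := by positivity
    linarith)
  have hab : √(a / b) = √a / √b := sqrt_div ha.le b
  have hsb := sq_sqrt hb.le
  have hsa := sq_sqrt ha.le
  have hpa := sqrt_pos.2 ha
  have hpb := sqrt_pos.2 hb
  have key : ∀ p : ℕ × ℕ, √(π / (π * a * (2 * (p.2 : ℝ) + 1) ^ 2 / 4)) *
      exp (-(2 * √(π * a * (2 * (p.2 : ℝ) + 1) ^ 2 / 4 * (π * (2 * (p.1 : ℝ) + 1) ^ 2 / (4 * b))))) =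
      2 / (√a * (2 * (p.2 : ℝ) + 1)) * x ^ ((2 * p.1 + 1) * (2 * p.2 + 1)) := fun p ↦ by
    have e1 : π / (π * a * (2 * (p.2 : ℝ) + 1) ^ 2 / 4) = (2 / (√a * (2 * (p.2 : ℝ) + 1))) ^ 2 := by
      rw [div_pow, mul_pow, hsa]
      have := pi_pos.ne'
      field_simp
      norm_num
    have e2 : π * a * (2 * (p.2 : ℝ) + 1) ^ 2 / 4 * (π * (2 * (p.1 : ℝ) + 1) ^ 2 / (4 * b)) =
        (π * √(a / b) * ((2 * (p.2 : ℝ) + 1) * (2 * (p.1 : ℝ) + 1)) / 4) ^ 2 := by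
      rw [div_pow, mul_pow, mul_pow, mul_pow, sq_sqrt (by positivity)]
      field_simp
    rw [e1, e2, sqrt_sq (by positivity), sqrt_sq (by positivity), hx, ← exp_nat_mul]
    congr 2
    push_cast
    ring
  have hI : ∀ p : ℕ × ℕ, _ := fun p ↦ integral_inv_sqrt_mul_exp
    (A := π * a * (2 * (p.2 : ℝ) + 1) ^ 2 / 4) (B := π * (2 * (p.1 : ℝ) + 1) ^ 2 / (4 * b))
    (by positivity) (by positivity)
  have hnorm : ∀ p y, ‖F p y‖ = ((2 * (p.1 : ℝ) + 1) * (2 * (p.2 : ℝ) + 1)) / (b * √b) *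
      ((√y)⁻¹ * exp (-(π * a * (2 * (p.2 : ℝ) + 1) ^ 2 / 4 * y +
      π * (2 * (p.1 : ℝ) + 1) ^ 2 / (4 * b) / y))) := fun p y ↦ by
    rw [hF, norm_mul, norm_div, norm_mul, norm_mul, norm_pow, norm_pow, norm_neg, norm_one, one_pow,
      one_pow, one_mul, one_mul, norm_of_nonneg (by positivity), norm_of_nonneg (by positivity),
      norm_of_nonneg (by positivity)]
  have h := (hasSum_integral_of_summable_integral_norm (μ := volume.restrict (Set.Ioi 0)) (F := F)
    (fun p ↦ (hI p).1.const_mul _) (by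
      simp only [hnorm, integral_const_mul, fun p ↦ (hI p).2, key]
      refine ((summable_odd_mul_pow hx0 hx1).mul_left (2 / (b * √b * √a))).congr
        fun p ↦ ?_
      field_simp)).tsum_eq
  have e : ∀ y ∈ Set.Ioi (0 : ℝ), (1 / 2 * (t2 (a * y) * t3 (a * y) * t4 (a * y))) *
      (1 / 2 * (t2 (b * y) * t3 (b * y) * t4 (b * y))) * y = ∑' p, F p y := fun y hy ↦ by
    have hy : 0 < y := hy
    have hay : 0 < a * y := by positivity
    have hby : 0 < b * y := by positivity
    have h1 := theta_prod_inv hby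
    rw [← thetaOdd_eq (by positivity), thetaOdd_eq_tsum_nat (by positivity)] at h1
    have h2 : t2 (b * y) * t3 (b * y) * t4 (b * y) = 2 * (∑' k : ℕ, (-1) ^ k * (2 * k + 1) *
        gauss (1 / (b * y) / 4) (2 * k + 1)) / (b * y * √(b * y)) := by
      rw [h1]
      field_simp
    rw [← thetaOdd_eq hay, thetaOdd_eq_tsum_nat (by positivity), h2]
    have h3 := tsum_mul_tsum_of_summable_norm (summable_thetaOdd_nat
      (y := 1 / (b * y) / 4) (by positivity)).norm (summable_thetaOdd_nat
      (y := a * y / 4) (by positivity)).norm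
    rw [sqrt_mul hb.le]
    have hsy := sqrt_pos.2 hy
    have h4 : ∀ S T : ℝ, 1 / 2 * (2 * S) * (1 / 2 * (2 * T / (b * y * (√b * √y)))) * y =
        (b * √b)⁻¹ * (√y)⁻¹ * (T * S) := fun S T ↦ by
      field_simp
    rw [h4, h3, ← tsum_mul_left]
    refine tsum_congr fun p ↦ ?_
    have h5 : gauss (1 / (b * y) / 4) (2 * p.1 + 1) * gauss (a * y / 4) (2 * p.2 + 1) =
        exp (-(π * a * (2 * (p.2 : ℝ) + 1) ^ 2 / 4 * y +
          π * (2 * (p.1 : ℝ) + 1) ^ 2 / (4 * b) / y)) := by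
      rw [gauss, gauss, ← exp_add]
      congr 1
      field_simp
      ring
    simp only [hF]
    rw [← h5]
    ring
  rw [setIntegral_congr_fun measurableSet_Ioi e, ← h]
  simp only [hF, integral_const_mul, fun p ↦ (hI p).2, key]
  have h6 := tsum_odd_mul_pow hx0 hx1
  rw [show chiLambert x = _ from chiLambert_eq (by positivity)] at h6
  rw [show (t2 √(a / b) ^ 2 * t4 √(a / b) ^ 2) / (2 * b * √(a * b)) = 2 / (b * √b * √a) *
    (1 / 4 * (t2 √(a / b) ^ 2 * t4 √(a / b) ^ 2)) by rw [sqrt_mul ha.le]; field_simp; norm_num,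
    ← h6, ← tsum_mul_left]
  refine tsum_congr fun p ↦ ?_
  field_simp

lemma integrableOn_theta_prod_mul {a b : ℝ} (ha : 0 < a) (hb : 0 < b) :
    IntegrableOn (fun y ↦ (1 / 2 * (t2 (a * y) * t3 (a * y) * t4 (a * y))) *
      (1 / 2 * (t2 (b * y) * t3 (b * y) * t4 (b * y))) * y) (Set.Ioi 0) := by
  refine Integrable.of_integral_ne_zero ?_
  rw [integral_theta_prod_mul ha hb]
  have hr : 0 < √(a / b) := by positivity
  have h2 := t2_pos hr
  have h4 := t4_pos hr
  positivity

theorem integral_cuspForm_eq_theta {α β : ℝ} (hα : 0 < α) (h : α * β = 5) (hβ : β = 3 * α) :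
    ∫ y in Set.Ioi (0 : ℝ), cuspFormF (Complex.I * y) * y =
      ((1 / 48 * (t3 α ^ 2 * t3 β ^ 2) : ℝ) : ℂ) := by
  have hα2 : α ^ 2 = 5 / 3 := by rw [hβ] at h; linarith
  have hβ2 : β ^ 2 = 15 := by rw [hβ, mul_pow, hα2]; norm_num
  have hβ0 : 0 < β := by rw [hβ]; positivity
  have h15 : √15 = β := by rw [← hβ2, sqrt_sq hβ0.le]
  have h1 := integral_theta_prod_mul (a := 5) (b := 3) (by norm_num) (by norm_num)
  have h2 := integral_theta_prod_mul (a := 15) (b := 1) (by norm_num) (by norm_num)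
  rw [show √(5 / 3 : ℝ) = α by rw [← hα2, sqrt_sq hα.le],
    show √(5 * 3 : ℝ) = β by rw [← h15]; norm_num] at h1
  rw [show √(15 / 1 : ℝ) = β by rw [← h15]; norm_num,
    show √(15 * 1 : ℝ) = β by rw [← h15]; norm_num] at h2
  have hθ := (theta_values hα h hβ).2.2
  rw [h15] at hθ
  have hsum := integral_add
    (integrableOn_theta_prod_mul (a := 5) (b := 3) (by norm_num) (by norm_num))
    (integrableOn_theta_prod_mul (a := 15) (b := 1) (by norm_num) (by norm_num))
  rw [h1, h2] at hsum
  have hv : (t2 α ^ 2 * t4 α ^ 2) / (2 * 3 * β) + (t2 β ^ 2 * t4 β ^ 2) / (2 * 1 * β) =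
      1 / 48 * (t3 α ^ 2 * t3 β ^ 2) := by
    field_simp
    linear_combination 48 * hθ
  rw [← hv, ← hsum, ← integral_complex_ofReal]
  refine setIntegral_congr_fun measurableSet_Ioi fun y hy ↦ ?_
  have hy : 0 < y := hy
  have e : ∀ c : ℝ, 0 < c → dedekindEta ((c : ℂ) * (Complex.I * y)) ^ 3 =
      ((1 / 2 * (t2 (c * y) * t3 (c * y) * t4 (c * y)) : ℝ) : ℂ) := fun c hc ↦ by
    rw [← dedekindEta_cube (by positivity : 0 < c * y)]
    congr 2
    push_cast
    ring
  have e1 := e 1 one_pos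
  have e3 := e 3 (by norm_num)
  have e5 := e 5 (by norm_num)
  have e15 := e 15 (by norm_num)
  rw [Complex.ofReal_one, one_mul] at e1
  rw [Complex.ofReal_ofNat] at e3 e5 e15
  simp only [cuspFormF]
  rw [e1, e3, e5, e15]
  push_cast
  ring

end Broadhurst

theorem broadhurst_conjecture :
    (feynmanI 1 : ℂ) = ((12 * Real.pi / Real.sqrt 15 : ℝ) : ℂ) * Lf2 := by
  have h15 : (0 : ℝ) < √15 := by positivity
  have hβ : √15 = 3 * (√15 / 3) := by ring
  have h : √15 / 3 * √15 = 5 := by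
    have := Real.sq_sqrt (show (0 : ℝ) ≤ 15 by norm_num)
    linear_combination this / 3
  have hα : 0 < √15 / 3 := by positivity
  rw [feynmanI, Broadhurst.integral_feynman_eq_theta hα h hβ, Lf2,
    Broadhurst.integral_cuspForm_eq_theta hα h hβ]
  push_cast
  ring
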